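/- Let p_1, p_2 > 2, and fix q_1, q_2 with p_1′ < q_1 < p_1 and p_2′ < q_2 < p_2. Assume 1/p_1 + 1/q_2 < min(1, 3/2 − 1/q_1) and 1/p_2 + 1/q_1 < min(1, 3/2 − 1/q_2). Define BHT ⊗ BHT(f_1,f_2)(z_1,z_2) = ∫_{x_1<x_2} ∫_{y_1<y_2} f̂_1(x_1,y_1) f̂_2(x_2,y_2) e^{2πi(z_1(x_1+x_2) + z_2(y_1+y_2))} dx_1 dx_2 dy_1 dy_2 for Schwartz f_1, f_2 on ℝ². Then there is a constant C such that for all Schwartz f_1, f_2 on ℝ², ( ∫_ℝ ( ∫_ℝ |BHT ⊗ BHT(f_1,f_2)(z_1,z_2)|^{s} dz_2 )^{r/s} dz_1 )^{1/r} ≤ C ‖f_1‖_{W^1_{p_1}[L_2^{q_1}]} ‖f_2‖_{W^2_{p_2}[L_1^{q_2}]}, where r = p_1 q_2/(p_1 + q_2) and s = p_2 q_1/(p_2 + q_1). -/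

import Mathlib

open MeasureTheory Complex
open scoped Real ENNReal

/-- The two-dimensional Fourier transform on `ℝ²`. -/
noncomputable def FT2 (f : ℝ × ℝ → ℂ) (ξ : ℝ × ℝ) : ℂ :=
  ∫ x : ℝ × ℝ, f x * Complex.exp (-(2 * π * Complex.I * (x.1 * ξ.1 + x.2 * ξ.2)))

/-- The tensor product `BHT ⊗ BHT` of two bilinear Hilbert transforms. -/
noncomputable def BHT2 (f₁ f₂ : ℝ × ℝ → ℂ) (z : ℝ × ℝ) : ℂ :=
  ∫ w in {w : (ℝ × ℝ) × (ℝ × ℝ) | w.1.1 < w.1.2 ∧ w.2.1 < w.2.2},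
    FT2 f₁ (w.1.1, w.2.1) * FT2 f₂ (w.1.2, w.2.2) *
      Complex.exp (2 * π * Complex.I *
        (z.1 * (w.1.1 + w.1.2) + z.2 * (w.2.1 + w.2.2)))

/-- The partial Fourier transform in the first variable. -/
noncomputable def FT1v (f : ℝ × ℝ → ℂ) (ξ y : ℝ) : ℂ :=
  ∫ x : ℝ, f (x, y) * Complex.exp (-(2 * π * Complex.I * x * ξ))

/-- The partial Fourier transform in the second variable. -/
noncomputable def FT2v (f : ℝ × ℝ → ℂ) (x η : ℝ) : ℂ :=
  ∫ y : ℝ, f (x, y) * Complex.exp (-(2 * π * Complex.I * y * η))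

section

open scoped FourierTransform SchwartzMap ContDiff
open Set Filter Topology

theorem fourier_ae_eq_toLp {w : ℝ → ℂ} (h1 : Integrable w) (h2 : MemLp w 2) :
    ((𝓕 (h2.toLp w) : Lp ℂ 2 (volume : Measure ℝ)) : ℝ → ℂ) =ᵐ[volume] 𝓕 w := by
  have hc : Continuous (𝓕 w) := VectorFourier.fourierIntegral_continuous
    Real.continuous_fourierChar (by exact continuous_inner) h1
  apply ae_eq_of_integral_contDiff_smul_eq
  · exact (Lp.memLp _).locallyIntegrable (by norm_num)
  · exact hc.locallyIntegrable
  intro g hg hgs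
  have hg' : ContDiff ℝ ∞ (fun x => (g x : ℂ)) := by
    exact Complex.ofRealCLM.contDiff.comp hg
  have hgs' : HasCompactSupport (fun x => (g x : ℂ)) :=
    hgs.comp_left (g := fun x : ℝ => (x : ℂ)) (by simp)
  let φ : 𝓢(ℝ, ℂ) := hgs'.toSchwartzMap hg'
  have hφ : ∀ x, φ x = g x := fun x => rfl
  have e1 := congrArg (fun T : 𝓢'(ℝ, ℂ) => T φ) (Lp.fourier_toTemperedDistribution_eq (h2.toLp w))
  simp only [TemperedDistribution.fourier_apply, Lp.toTemperedDistribution_apply] at e1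
  have e2 : ∫ x, (𝓕 φ) x • (h2.toLp w : ℝ → ℂ) x = ∫ x, (𝓕 φ) x • w x := by
    apply integral_congr_ae
    filter_upwards [h2.coeFn_toLp] with x hx
    rw [hx]
  have e3 : ∫ x, (𝓕 φ) x • w x = ∫ x, φ x • 𝓕 w x := by
    have := VectorFourier.integral_fourierIntegral_smul_eq_flip (L := innerₗ ℝ)
      (μ := volume) (ν := volume)
      (f := φ) (g := w) Real.continuous_fourierChar continuous_inner φ.integrable h1
    simpa [flip_innerₗ] using! this
  rw [e2, e3] at e1
  simpa [hφ] using e1.symm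

theorem plancherel_fourier {w : ℝ → ℂ} (h1 : Integrable w) (h2 : MemLp w 2) :
    ∫⁻ x, ‖𝓕 w x‖ₑ ^ 2 = ∫⁻ x, ‖w x‖ₑ ^ 2 := by
  have h := fourier_ae_eq_toLp h1 h2
  have key : ‖(𝓕 (h2.toLp w) : Lp ℂ 2 (volume : Measure ℝ))‖ₑ = ‖h2.toLp w‖ₑ := by
    rw [← ofReal_norm, ← ofReal_norm, Lp.norm_fourier_eq]
  rw [Lp.enorm_def, Lp.enorm_def, eLpNorm_congr_ae h, eLpNorm_congr_ae h2.coeFn_toLp] at key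
  have hp (f : ℝ → ℂ) : eLpNorm f 2 volume ^ 2 = ∫⁻ x, ‖f x‖ₑ ^ 2 := by
    have := eLpNorm_nnreal_pow_eq_lintegral (f := f) (μ := volume) (p := 2) (by norm_num)
    simpa using! this
  rw [← hp, ← hp, key]

/-- The character `t ↦ e^{2πit}`. -/
noncomputable def ex (t : ℝ) : ℂ := Complex.exp (2 * π * t * Complex.I)

theorem ex_add (s t : ℝ) : ex (s + t) = ex s * ex t := by
  rw [ex, ex, ex, ← Complex.exp_add]; push_cast; ring_nf

@[simp] theorem norm_ex (t : ℝ) : ‖ex t‖ = 1 := by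
  have := Complex.norm_exp_ofReal_mul_I (2 * π * t)
  simpa [ex] using this

@[simp] theorem enorm_ex (t : ℝ) : ‖ex t‖ₑ = 1 := by
  rw [← ofReal_norm, norm_ex, ENNReal.ofReal_one]

@[fun_prop] theorem continuous_ex : Continuous ex := by unfold ex; fun_prop

@[fun_prop] theorem measurable_ex : Measurable ex := continuous_ex.measurable

theorem conj_ex (t : ℝ) : (starRingEnd ℂ) (ex t) = ex (-t) := by
  have : (starRingEnd ℂ) 2 = 2 := map_ofNat _ 2
  simp [ex, ← Complex.exp_conj, this]

/-- Bounded measurable functions with bounded support. -/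
def BS {E : Type*} [MeasurableSpace E] [NormedAddCommGroup E] (F : E → ℂ) : Prop :=
  Measurable F ∧ (∃ M, ∀ x, ‖F x‖ ≤ M) ∧ ∃ R, ∀ x, R < ‖x‖ → F x = 0

namespace BS
variable {E : Type*} [MeasurableSpace E] [NormedAddCommGroup E] {F G : E → ℂ}

theorem bound (h : BS F) : ∃ M, 0 ≤ M ∧ ∀ x, ‖F x‖ ≤ M := by
  obtain ⟨-, ⟨M, hM⟩, -⟩ := h
  exact ⟨M, (norm_nonneg _).trans (hM 0), hM⟩

theorem mul_bdd (h : BS F) (hG : Measurable G) {M : ℝ} (hM : ∀ x, ‖G x‖ ≤ M) :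
    BS (fun x => G x * F x) := by
  obtain ⟨M', h0, hM'⟩ := h.bound
  obtain ⟨hm, -, R, hR⟩ := h
  refine ⟨hG.mul hm, ⟨M * M', fun x => ?_⟩, R, fun x hx => by simp [hR x hx]⟩
  rw [norm_mul]
  exact mul_le_mul (hM x) (hM' x) (norm_nonneg _) ((norm_nonneg _).trans (hM x))

theorem add (h : BS F) (hG : BS G) : BS (fun x => F x + G x) := by
  obtain ⟨hm, ⟨M, hM⟩, R, hR⟩ := h
  obtain ⟨hm', ⟨M', hM'⟩, R', hR'⟩ := hG
  refine ⟨hm.add hm', ⟨M + M', fun x => (norm_add_le _ _).trans (add_le_add (hM x) (hM' x))⟩,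
    max R R', fun x hx => ?_⟩
  simp [hR x ((le_max_left _ _).trans_lt hx), hR' x ((le_max_right _ _).trans_lt hx)]

theorem zero : BS (fun _ : E => (0 : ℂ)) := ⟨measurable_const, ⟨0, by simp⟩, 0, by simp⟩

theorem sum {ι : Type*} {s : Finset ι} {F : ι → E → ℂ} (h : ∀ i ∈ s, BS (F i)) :
    BS (fun x => ∑ i ∈ s, F i x) := by
  classical
  induction s using Finset.induction_on with
  | empty => simpa using zero
  | insert i s hi ih =>
    simp only [Finset.sum_insert hi]
    exact (h i (by simp)).add (ih fun j hj => h j (by simp [hj]))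

theorem indicator (h : BS F) {s : Set E} (hs : MeasurableSet s) : BS (s.indicator F) := by
  obtain ⟨hm, ⟨M, hM⟩, R, hR⟩ := h
  refine ⟨hm.indicator hs, ⟨M, fun x => (norm_indicator_le_norm_self _ _).trans (hM x)⟩, R,
    fun x hx => ?_⟩
  by_cases hxs : x ∈ s
  · rw [indicator_of_mem hxs, hR x hx]
  · rw [indicator_of_notMem hxs]

theorem conj (h : BS F) : BS (fun x => (starRingEnd ℂ) (F x)) := by
  obtain ⟨hm, ⟨M, hM⟩, R, hR⟩ := h
  refine ⟨Complex.continuous_conj.measurable.comp hm, ⟨M, fun x => by simpa using hM x⟩, R,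
    fun x hx => by simp [hR x hx]⟩

theorem comp_neg (h : BS F) [MeasurableNeg E] : BS (fun x => F (-x)) := by
  obtain ⟨hm, ⟨M, hM⟩, R, hR⟩ := h
  exact ⟨hm.comp measurable_neg, ⟨M, fun x => hM _⟩, R, fun x hx => hR _ (by simpa using hx)⟩

theorem comp_sub (h : BS F) [MeasurableAdd E] (a : E) : BS (fun x => F (x + a)) := by
  obtain ⟨hm, ⟨M, hM⟩, R, hR⟩ := h
  refine ⟨hm.comp (measurable_add_const a), ⟨M, fun x => hM _⟩, R + ‖a‖, fun x hx => hR _ ?_⟩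
  have := norm_sub_norm_le x (-a)
  simp only [norm_neg, sub_neg_eq_add] at this
  linarith

theorem memLp [ProperSpace E] [OpensMeasurableSpace E] {μ : Measure E}
    [IsFiniteMeasureOnCompacts μ] (h : BS F) (p : ℝ≥0∞) :
    MemLp F p μ := by
  obtain ⟨hm, ⟨M, hM⟩, R, hR⟩ := h
  have e : F = (Metric.closedBall 0 R).indicator F := by
    ext x
    by_cases hx : x ∈ Metric.closedBall (0 : E) R
    · rw [indicator_of_mem hx]
    · rw [indicator_of_notMem hx, hR x (by simpa using hx)]
  rw [e, memLp_indicator_iff_restrict Metric.isClosed_closedBall.measurableSet]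
  have : IsFiniteMeasure (μ.restrict (Metric.closedBall 0 R)) :=
    ⟨by simpa using (isCompact_closedBall (0 : E) R).measure_lt_top⟩
  exact MemLp.of_bound hm.aestronglyMeasurable M (Eventually.of_forall hM)

theorem integrable [ProperSpace E] [OpensMeasurableSpace E] {μ : Measure E}
    [IsFiniteMeasureOnCompacts μ] (h : BS F) : Integrable F μ :=
  memLp_one_iff_integrable.1 (h.memLp 1)

theorem section_snd {F : ℝ × ℝ → ℂ} (h : BS F) (ξ : ℝ) : BS (fun u => F (ξ, u)) := by
  obtain ⟨hm, ⟨M, hM⟩, R, hR⟩ := h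
  exact ⟨hm.comp measurable_prodMk_left, ⟨M, fun x => hM _⟩, R,
    fun x hx => hR _ (hx.trans_le (by simp [Prod.norm_def]))⟩

theorem indicator_one {s : Set E} (hs : MeasurableSet s) (hb : Bornology.IsBounded s) :
    BS (s.indicator (fun _ => (1 : ℂ))) := by
  obtain ⟨R, hR⟩ := hb.exists_norm_le
  refine ⟨measurable_const.indicator hs, ⟨1, fun x => (norm_indicator_le_norm_self _ _).trans
    (by simp)⟩, R, fun x hx => ?_⟩
  rw [indicator_of_notMem]
  exact fun h => absurd (hR x h) (not_le.2 hx)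

theorem indicator_of_bdd {s : Set E} (hs : MeasurableSet s) (hb : Bornology.IsBounded s)
    (hF : Measurable F) {M : ℝ} (hM : ∀ x, ‖F x‖ ≤ M) : BS (s.indicator F) := by
  convert (indicator_one hs hb).mul_bdd hF hM using 1
  ext x
  by_cases hx : x ∈ s <;> simp [hx]

end BS

/-- The inverse Fourier integral. -/
noncomputable def Fi (w : ℝ → ℂ) (x : ℝ) : ℂ := ∫ ξ, ex (ξ * x) * w ξ

theorem Fi_eq (w : ℝ → ℂ) (x : ℝ) : Fi w x = 𝓕 w (-x) := by
  rw [Real.fourier_eq', Fi]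
  congr 1; ext ξ
  simp [ex]; left
  ring_nf

theorem Fi_continuous {w : ℝ → ℂ} (h : Integrable w) : Continuous (Fi w) := by
  have : Fi w = fun x => 𝓕 w (-x) := funext (Fi_eq w)
  rw [this]
  exact (VectorFourier.fourierIntegral_continuous
    Real.continuous_fourierChar (by exact continuous_inner) h).comp continuous_neg

theorem norm_Fi_le (w : ℝ → ℂ) (x : ℝ) : ‖Fi w x‖ ≤ ∫ ξ, ‖w ξ‖ := by
  refine (norm_integral_le_integral_norm _).trans_eq ?_
  simp

theorem plancherel {w : ℝ → ℂ} (h : BS w) : ∫⁻ x, ‖Fi w x‖ₑ ^ 2 = ∫⁻ x, ‖w x‖ₑ ^ 2 := by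
  rw [← plancherel_fourier h.integrable (h.memLp 2)]
  simp_rw [Fi_eq]
  exact (Measure.measurePreserving_neg volume).lintegral_comp_emb
    (MeasurableEquiv.neg ℝ).measurableEmbedding (fun x => ‖𝓕 w x‖ₑ ^ 2)

theorem plancherel_neg {w : ℝ → ℂ} (h : BS w) :
    ∫⁻ x, ‖Fi w (-x)‖ₑ ^ 2 = ∫⁻ x, ‖w x‖ₑ ^ 2 := by
  rw [← plancherel h]
  exact (Measure.measurePreserving_neg volume).lintegral_comp_emb
    (MeasurableEquiv.neg ℝ).measurableEmbedding (fun x => ‖Fi w x‖ₑ ^ 2)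

/-- Convolution. -/
noncomputable def cv (u v : ℝ → ℂ) (x : ℝ) : ℂ := ∫ t, u t * v (x - t)

theorem cv_support {u v : ℝ → ℂ} {A B : Set ℝ} (hu : ∀ x ∉ A, u x = 0) (hv : ∀ x ∉ B, v x = 0)
    {x : ℝ} (hx : ∀ a ∈ A, ∀ b ∈ B, a + b ≠ x) : cv u v x = 0 := by
  have : ∀ t, u t * v (x - t) = 0 := fun t => by
    by_cases h : t ∈ A
    · rw [hv (x - t) fun hb => hx t h _ hb (by ring), mul_zero]
    · rw [hu t h, zero_mul]
  simp [cv, this]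

theorem BS.cv {u v : ℝ → ℂ} (hu : BS u) (hv : BS v) : BS (cv u v) := by
  have hm : Measurable fun p : ℝ × ℝ => u p.2 * v (p.1 - p.2) :=
    (hu.1.comp measurable_snd).mul (hv.1.comp (measurable_fst.sub measurable_snd))
  obtain ⟨M, h0, hM⟩ := hv.bound
  obtain ⟨R, hR⟩ := hu.2.2
  obtain ⟨R', hR'⟩ := hv.2.2
  refine ⟨(StronglyMeasurable.integral_prod_right hm.stronglyMeasurable).measurable,
    ⟨∫ t, ‖u t‖ * M, fun x => ?_⟩, R + R', fun x hx => ?_⟩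
  · refine norm_integral_le_of_norm_le (hu.integrable.norm.mul_const M) (Eventually.of_forall ?_)
    intro t
    rw [norm_mul]
    exact mul_le_mul_of_nonneg_left (hM _) (norm_nonneg _)
  · refine cv_support (A := {t | ‖t‖ ≤ R}) (B := {t | ‖t‖ ≤ R'})
      (fun x hx => hR x (by simpa using hx))
      (fun x hx => hR' x (by simpa using hx)) ?_
    rintro a ha b hb rfl
    have := norm_add_le a b
    simp only [mem_ofPred_eq] at ha hb
    linarith

theorem Fi_cv {u v : ℝ → ℂ} (hu : BS u) (hv : BS v) (x : ℝ) :
    Fi (cv u v) x = Fi u x * Fi v x := by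
  have hm : Integrable (fun p : ℝ × ℝ => (ex (p.1 * x) * u p.1) * (ex (p.2 * x) * v p.2)) := by
    refine Integrable.mul_prod (f := fun t => ex (t * x) * u t)
      (g := fun t => ex (t * x) * v t) ?_ ?_
    · exact (hu.mul_bdd (M := 1) (by fun_prop) (by simp)).integrable
    · exact (hv.mul_bdd (M := 1) (by fun_prop) (by simp)).integrable
  have e1 : Fi u x * Fi v x = ∫ p : ℝ × ℝ, (ex (p.1 * x) * u p.1) * (ex (p.2 * x) * v p.2) := by
    rw [Measure.volume_eq_prod, integral_prod_mul (fun t => ex (t * x) * u t)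
      (fun t => ex (t * x) * v t)]
    rfl
  have hmp : MeasurePreserving (fun p : ℝ × ℝ => (p.1, p.2 - p.1)) (volume.prod volume)
      (volume.prod volume) := by
    have := measurePreserving_prod_neg_add (volume : Measure ℝ) (volume : Measure ℝ)
    convert this using 3
    ring
  have hemb : MeasurableEmbedding (fun p : ℝ × ℝ => (p.1, p.2 - p.1)) := by
    let e : ℝ × ℝ ≃ᵐ ℝ × ℝ :=
      { toFun := fun p => (p.1, p.2 - p.1)
        invFun := fun p => (p.1, p.2 + p.1)
        left_inv := fun p => by simp
        right_inv := fun p => by simp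
        measurable_toFun := by simp; fun_prop
        measurable_invFun := by simp; fun_prop }
    exact e.measurableEmbedding
  rw [e1, Measure.volume_eq_prod, ← hmp.integral_comp hemb, integral_prod_symm]
  · rw [Fi]
    congr 1; ext y
    rw [cv, ← integral_const_mul]
    congr 1; ext t
    have : ex (y * x) = ex (t * x) * ex ((y - t) * x) := by rw [← ex_add]; ring_nf
    rw [this]; ring
  · exact (hmp.integrable_comp_emb hemb).2 hm

theorem parseval {u v : ℝ → ℂ} (hu : BS u) (hv : BS v) :
    ∫ x, (starRingEnd ℂ) (Fi u x) * Fi v x = ∫ x, (starRingEnd ℂ) (u x) * v x := by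
  have h1 := hu.integrable (μ := volume)
  have h2 := hu.memLp (μ := volume) 2
  have k1 := hv.integrable (μ := volume)
  have k2 := hv.memLp (μ := volume) 2
  have key := Lp.inner_fourier_eq (h2.toLp u) (k2.toLp v)
  rw [L2.inner_def, L2.inner_def] at key
  have e1 : ∫ x, (starRingEnd ℂ) (u x) * v x = ∫ x, (starRingEnd ℂ) (𝓕 u x) * 𝓕 v x := by
    convert key.symm using 1
    · apply integral_congr_ae
      filter_upwards [h2.coeFn_toLp, k2.coeFn_toLp] with x hx hy
      rw [hx, hy, RCLike.inner_apply, mul_comm]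
    · apply integral_congr_ae
      filter_upwards [fourier_ae_eq_toLp h1 h2, fourier_ae_eq_toLp k1 k2] with x hx hy
      rw [hx, hy, RCLike.inner_apply, mul_comm]
  rw [e1]
  simp_rw [Fi_eq]
  exact (Measure.measurePreserving_neg volume).integral_comp
    (MeasurableEquiv.neg ℝ).measurableEmbedding (fun x => (starRingEnd ℂ) (𝓕 u x) * 𝓕 v x)

theorem conj_Fi (u : ℝ → ℂ) (x : ℝ) :
    (starRingEnd ℂ) (Fi u x) = Fi (fun ξ => (starRingEnd ℂ) (u (-ξ))) x := by
  rw [Fi, ← integral_conj, Fi, ← integral_neg_eq_self]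
  congr 1; ext ξ
  rw [map_mul, conj_ex]; simp

theorem integral_Fi_mul_Fi_eq_zero {u v : ℝ → ℂ} (hu : BS u) (hv : BS v)
    (h : ∀ ξ, u (-ξ) * v ξ = 0) : ∫ x, Fi u x * Fi v x = 0 := by
  have hu' : BS fun ξ => (starRingEnd ℂ) (u (-ξ)) := hu.comp_neg.conj
  have := parseval hu' hv
  simp only [conj_Fi, neg_neg, Complex.conj_conj, h, integral_zero] at this
  exact this

theorem Fi_add {u v : ℝ → ℂ} (hu : BS u) (hv : BS v) (x : ℝ) :
    Fi (fun ξ => u ξ + v ξ) x = Fi u x + Fi v x := by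
  simp only [Fi, mul_add]
  exact integral_add (hu.mul_bdd (M := 1) (by fun_prop) (by simp)).integrable
    (hv.mul_bdd (M := 1) (by fun_prop) (by simp)).integrable

theorem Fi_sum {ι : Type*} (s : Finset ι) {u : ι → ℝ → ℂ} (hu : ∀ i ∈ s, BS (u i)) (x : ℝ) :
    Fi (fun ξ => ∑ i ∈ s, u i ξ) x = ∑ i ∈ s, Fi (u i) x := by
  simp only [Fi, Finset.mul_sum]
  exact integral_finsetSum _ fun i hi =>
    ((hu i hi).mul_bdd (M := 1) (by fun_prop) (by simp)).integrable

theorem Fi_const_mul (c : ℂ) (u : ℝ → ℂ) (x : ℝ) : Fi (fun ξ => c * u ξ) x = c * Fi u x := by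
  simp only [Fi, ← integral_const_mul]
  congr 1; ext; ring

/-- The Fourier multiplier operator with symbol `χ`. -/
noncomputable def Mu (χ g : ℝ → ℂ) (z : ℝ) : ℂ := Fi (fun ξ => χ ξ * Fi g (-ξ)) z

theorem BS.mul_Fi {χ g : ℝ → ℂ} (hχ : BS χ) (hg : BS g) : BS (fun ξ => χ ξ * Fi g (-ξ)) := by
  have := hχ.mul_bdd (G := fun ξ => Fi g (-ξ))
    ((Fi_continuous hg.integrable).comp continuous_neg).measurable (fun x => norm_Fi_le g (-x))
  simpa [mul_comm] using this

theorem Mu_eq {χ g : ℝ → ℂ} (hχ : BS χ) (hg : BS g) (z : ℝ) :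
    Mu χ g z = ∫ u, Fi χ (z - u) * g u := by
  have hi : Integrable (fun p : ℝ × ℝ => χ p.1 * g p.2) (volume.prod volume) :=
    Integrable.mul_prod hχ.integrable hg.integrable
  have hi' : Integrable (fun p : ℝ × ℝ => ex (p.1 * (z - p.2)) * (χ p.1 * g p.2))
      (volume.prod volume) := by
    refine hi.bdd_mul (c := 1) (Measurable.aestronglyMeasurable (by fun_prop)) (by simp)
  simp only [Mu, Fi, ← integral_mul_const, ← integral_const_mul]
  rw [integral_integral_swap]
  · congr 1; ext u; congr 1; ext ξ
    have : ex (ξ * (z - u)) = ex (ξ * z) * ex (u * -ξ) := by rw [← ex_add]; ring_nf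
    rw [this]; ring
  · convert hi' using 1
    ext p
    have : ex (p.1 * (z - p.2)) = ex (p.1 * z) * ex (p.2 * -p.1) := by rw [← ex_add]; ring_nf
    simp only [Function.uncurry]
    rw [this]; ring

/-- Frequency projection. -/
noncomputable def PJ (J : Set ℝ) (g : ℝ → ℂ) (z : ℝ) : ℂ := Mu (J.indicator fun _ => 1) g z

/-- The kernel of the frequency projection. -/
noncomputable def kr (J : Set ℝ) (s : ℝ) : ℂ := Fi (J.indicator fun _ => 1) s

section
variable {J : Set ℝ}

theorem PJ_eq_kernel (hJ : MeasurableSet J) (hb : Bornology.IsBounded J)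
    {g : ℝ → ℂ} (hg : BS g) (z : ℝ) : PJ J g z = ∫ u, kr J (z - u) * g u :=
  Mu_eq (BS.indicator_one hJ hb) hg z

theorem kr_continuous (hJ : MeasurableSet J) (hb : Bornology.IsBounded J) :
    Continuous (kr J) :=
  Fi_continuous (BS.indicator_one hJ hb).integrable

theorem kr_bound (J : Set ℝ) : ∃ M, ∀ s, ‖kr J s‖ ≤ M := ⟨_, norm_Fi_le _⟩

theorem PJ_continuous (hJ : MeasurableSet J) (hb : Bornology.IsBounded J)
    {g : ℝ → ℂ} (hg : BS g) : Continuous (PJ J g) :=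
  Fi_continuous ((BS.indicator_one hJ hb).mul_Fi hg).integrable

theorem plancherel_PJ (hJ : MeasurableSet J) (hb : Bornology.IsBounded J)
    {g : ℝ → ℂ} (hg : BS g) :
    ∫⁻ z, ‖PJ J g z‖ₑ ^ 2 = ∫⁻ ξ in J, ‖Fi g (-ξ)‖ₑ ^ 2 := by
  unfold PJ Mu
  rw [plancherel ((BS.indicator_one hJ hb).mul_Fi hg), ← lintegral_indicator hJ]
  congr 1; ext ξ
  by_cases h : ξ ∈ J <;> simp [h]

end

theorem bessel {ι : Type*} [Fintype ι] {J : ι → Set ℝ} (hJ : ∀ i, MeasurableSet (J i))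
    (hb : ∀ i, Bornology.IsBounded (J i)) (hd : Pairwise fun i j => Disjoint (J i) (J j))
    {g : ℝ → ℂ} (hg : BS g) :
    ∑ i, ∫⁻ z, ‖PJ (J i) g z‖ₑ ^ 2 ≤ ∫⁻ u, ‖g u‖ₑ ^ 2 := by
  simp_rw [fun i => plancherel_PJ (hJ i) (hb i) hg]
  rw [← plancherel_neg hg]
  have := lintegral_iUnion (μ := volume) hJ hd (fun ξ => ‖Fi g (-ξ)‖ₑ ^ 2)
  rw [tsum_fintype] at this
  rw [← this]
  exact setLIntegral_le_lintegral _ _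

theorem kr_neg (J : Set ℝ) (s : ℝ) : kr (-J) s = kr J (-s) := by
  simp only [kr, Fi]
  rw [← integral_neg_eq_self]
  congr 1; ext ξ
  have : (-J).indicator (fun _ => (1 : ℂ)) (-ξ) = J.indicator (fun _ => (1 : ℂ)) ξ := by
    by_cases h : ξ ∈ J <;> simp [h]
  rw [this]; congr 2; ring

theorem integral_PJ_mul {J : Set ℝ} (hJ : MeasurableSet J) (hb : Bornology.IsBounded J)
    {g k : ℝ → ℂ} (hg : BS g) (hk : BS k) :
    ∫ z, k z * PJ J g z = ∫ u, g u * PJ (-J) k u := by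
  obtain ⟨M, hM⟩ := kr_bound J
  have hi : Integrable (fun p : ℝ × ℝ => kr J (p.1 - p.2) * (k p.1 * g p.2))
      (volume.prod volume) := by
    refine (Integrable.mul_prod hk.integrable hg.integrable).bdd_mul (c := M)
      (Measurable.aestronglyMeasurable ?_) (Eventually.of_forall fun p => hM _)
    exact (kr_continuous hJ hb).measurable.comp (by fun_prop)
  simp_rw [PJ_eq_kernel hJ hb hg, PJ_eq_kernel hJ.neg hb.neg hk, ← integral_const_mul]
  rw [integral_integral_swap]
  · congr 1; ext u; congr 1; ext z
    rw [kr_neg]; ring_nf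
  · convert hi using 1
    ext p; simp only [Function.uncurry]; ring

theorem norm_pow_le_re_pow {k : ℕ} (hk : k ≠ 0) : ∃ A B : ℝ, 0 ≤ A ∧ ∀ w : ℂ,
    ‖w‖ ^ (2 * k) ≤ A * |w.re| ^ (2 * k) + B * ((-1) ^ k * (w ^ (2 * k)).re) := by
  obtain ⟨m, hm⟩ : ∃ m, 2 * k = m + 1 := ⟨2 * k - 1, by omega⟩
  set K : ℝ := 2 ^ k * (2 * k) with hK
  have hK0 : 0 ≤ K := by positivity
  refine ⟨2 * (2 ^ k + K * (2 * K) ^ m), 2 * 2 ^ k, by positivity, fun w => ?_⟩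
  have h1 : ‖w‖ ^ (2 * k) ≤ 2 ^ k * (|w.re| ^ (2 * k) + |w.im| ^ (2 * k)) := by
    rw [pow_mul, pow_mul, pow_mul, sq_abs, sq_abs, ← Complex.normSq_eq_norm_sq, Complex.normSq_apply,
      ← sq, ← sq]
    refine (add_pow_le (sq_nonneg _) (sq_nonneg _) k).trans ?_
    gcongr
    · norm_num
    · omega
  have h2 : ‖w ^ (2 * k) - (w.im * I) ^ (2 * k)‖ ≤ 2 * k * |w.re| * ‖w‖ ^ m := by
    rw [← (Commute.all w (w.im * I)).mul_geom_sum₂, norm_mul]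
    have e1 : ‖w - w.im * I‖ = |w.re| := by
      have : w - w.im * I = w.re := by
        apply Complex.ext <;> simp
      rw [this, Complex.norm_real, Real.norm_eq_abs]
    have e2 : ‖∑ i ∈ Finset.range (2 * k), w ^ i * (w.im * I) ^ (2 * k - 1 - i)‖ ≤
        ∑ i ∈ Finset.range (2 * k), ‖w‖ ^ m := by
      refine norm_sum_le_of_le _ fun i hi => ?_
      have hi' : i ≤ m := by have := Finset.mem_range.1 hi; omega
      have : 2 * k - 1 - i = m - i := by omega
      rw [norm_mul, norm_pow, norm_pow, this]
      calc ‖w‖ ^ i * ‖(w.im : ℂ) * I‖ ^ (m - i) ≤ ‖w‖ ^ i * ‖w‖ ^ (m - i) := by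
            gcongr
            simpa using Complex.abs_im_le_norm w
        _ = ‖w‖ ^ m := by rw [← pow_add]; congr 1; omega
    rw [Finset.sum_const, Finset.card_range, nsmul_eq_mul] at e2
    rw [e1]
    calc _ ≤ |w.re| * (((2 * k : ℕ) : ℝ) * ‖w‖ ^ m) := by gcongr
      _ = _ := by push_cast; ring
  have h3 : |w.im| ^ (2 * k) ≤ (-1) ^ k * (w ^ (2 * k)).re + 2 * k * |w.re| * ‖w‖ ^ m := by
    have e : (w.im * I : ℂ) ^ (2 * k) = (((-1) ^ k * |w.im| ^ (2 * k) : ℝ) : ℂ) := by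
      rw [pow_mul |w.im|, sq_abs, ← pow_mul, mul_pow, pow_mul I, I_sq]
      push_cast; ring
    have := (Complex.abs_re_le_norm _).trans h2
    rw [e, Complex.sub_re, Complex.ofReal_re] at this
    have hs : |(-1 : ℝ) ^ k| = 1 := by simp
    have h4 : |(-1) ^ k * (w ^ (2 * k)).re - |w.im| ^ (2 * k)| ≤ 2 * k * |w.re| * ‖w‖ ^ m := by
      have e3 : (-1) ^ k * (w ^ (2 * k)).re - |w.im| ^ (2 * k)
          = (-1) ^ k * ((w ^ (2 * k)).re - (-1) ^ k * |w.im| ^ (2 * k)) := by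
        have : (-1 : ℝ) ^ k * (-1) ^ k = 1 := by rw [← mul_pow]; simp
        linear_combination (|w.im| ^ (2 * k)) * this
      rw [e3, abs_mul, hs, one_mul]; exact this
    have := (abs_le.1 h4).1
    linarith
  have h5 : K * |w.re| * ‖w‖ ^ m ≤ ‖w‖ ^ (2 * k) / 2 + K * (2 * K) ^ m * |w.re| ^ (2 * k) := by
    rw [hm]
    rcases le_total (K * |w.re|) (‖w‖ / 2) with h | h
    · have : K * |w.re| * ‖w‖ ^ m ≤ ‖w‖ / 2 * ‖w‖ ^ m := by gcongr
      have h0 : 0 ≤ K * (2 * K) ^ m * |w.re| ^ (m + 1) := by positivity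
      rw [pow_succ]; linarith
    · have h' : ‖w‖ ≤ 2 * K * |w.re| := by linarith
      have : K * |w.re| * ‖w‖ ^ m ≤ K * |w.re| * (2 * K * |w.re|) ^ m := by gcongr
      have h0 : 0 ≤ ‖w‖ ^ (m + 1) := by positivity
      rw [mul_pow] at this
      calc _ ≤ _ := this
        _ = K * (2 * K) ^ m * |w.re| ^ (m + 1) := by ring
        _ ≤ _ := by linarith
  have h6 : ‖w‖ ^ (2 * k) ≤ 2 ^ k * |w.re| ^ (2 * k) + 2 ^ k * ((-1) ^ k * (w ^ (2 * k)).re)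
      + K * |w.re| * ‖w‖ ^ m := by
    calc _ ≤ _ := h1
      _ ≤ 2 ^ k * (|w.re| ^ (2 * k) +
          ((-1) ^ k * (w ^ (2 * k)).re + 2 * k * |w.re| * ‖w‖ ^ m)) := by gcongr
      _ = _ := by rw [hK]; ring
  linarith

theorem integrable_Fi_pow {u : ℝ → ℂ} (hu : BS u) {n : ℕ} (hn : 2 ≤ n) :
    Integrable fun x => Fi u x ^ n := by
  obtain ⟨m, rfl⟩ := Nat.exists_eq_add_of_le hn
  have hc := Fi_continuous (hu.integrable (μ := volume))
  have h2 : Integrable fun x => Fi u x ^ 2 := by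
    refine ⟨(hc.pow 2).aestronglyMeasurable, ?_⟩
    simp only [HasFiniteIntegral, enorm_pow]
    rw [plancherel hu]
    have h := (hu.memLp (μ := volume) 2).eLpNorm_lt_top
    have := eLpNorm_nnreal_pow_eq_lintegral (f := u) (μ := volume) (p := 2) (by norm_num)
    have e : ∫⁻ x, ‖u x‖ₑ ^ 2 = eLpNorm u 2 volume ^ 2 := by simpa using! this.symm
    rw [e]
    exact ENNReal.pow_lt_top h
  have := h2.bdd_mul (c := (∫ ξ, ‖u ξ‖) ^ m) (hc.pow m).aestronglyMeasurable
    (Eventually.of_forall fun x => by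
      rw [Pi.pow_apply, norm_pow]; exact pow_le_pow_left₀ (norm_nonneg _) (norm_Fi_le u x) m)
  simpa [pow_add, mul_comm] using this

theorem integral_Fi_pow_eq_zero {u : ℝ → ℂ} (hu : BS u) (hs : ∀ ξ ≤ 0, u ξ = 0) {n : ℕ}
    (hn : 2 ≤ n) : ∫ x, Fi u x ^ n = 0 := by
  have key : ∀ n : ℕ, ∃ v : ℝ → ℂ, BS v ∧ (∀ ξ ≤ 0, v ξ = 0) ∧ ∀ x, Fi v x = Fi u x ^ (n + 1) := by
    intro n
    induction n with
    | zero => exact ⟨u, hu, hs, by simp⟩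
    | succ n ih =>
      obtain ⟨v, hv, hvs, hvf⟩ := ih
      refine ⟨cv v u, hv.cv hu, fun ξ hξ => ?_, fun x => by rw [Fi_cv hv hu, hvf, ← pow_succ]⟩
      refine cv_support (A := Ioi 0) (B := Ioi 0) (fun x hx => hvs x (by simpa using hx))
        (fun x hx => hs x (by simpa using hx)) fun a ha b hb => ?_
      simp only [mem_Ioi] at ha hb
      linarith
  obtain ⟨v, hv, hvs, hvf⟩ := key (n - 2)
  have := integral_Fi_mul_Fi_eq_zero hv hu fun ξ => by
    rcases le_total ξ 0 with h | h
    · rw [hs ξ h, mul_zero]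
    · rw [hvs _ (by simpa using h), zero_mul]
  simp_rw [hvf, ← pow_succ] at this
  rwa [show n - 2 + 1 + 1 = n by omega] at this

theorem riesz_hermitian {k : ℕ} (hk : k ≠ 0) : ∃ C : ℝ≥0∞, C ≠ ⊤ ∧ ∀ w : ℝ → ℂ, BS w →
    (∀ ξ, w (-ξ) = (starRingEnd ℂ) (w ξ)) →
    ∫⁻ x, ‖Fi ((Ioi 0).indicator w) x‖ₑ ^ (2 * k) ≤ C * ∫⁻ x, ‖Fi w x‖ₑ ^ (2 * k) := by
  obtain ⟨A, B, hA, hAB⟩ := norm_pow_le_re_pow hk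
  refine ⟨ENNReal.ofReal A, ENNReal.ofReal_ne_top, fun w hw hh => ?_⟩
  have hg := hw.indicator (measurableSet_Ioi (a := (0 : ℝ)))
  set g := (Ioi 0).indicator w with hgdef
  have hre : ∀ x, |(Fi g x).re| ≤ ‖Fi w x‖ := fun x => by
    have e1 : Fi w x = Fi g x + (starRingEnd ℂ) (Fi g x) := by
      rw [conj_Fi, ← Fi_add hg hg.comp_neg.conj, Fi, Fi]
      apply integral_congr_ae
      have h0 : ∀ᵐ ξ : ℝ, ξ ≠ 0 := by simp [ae_iff]
      filter_upwards [h0] with ξ hξ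
      congr 1
      rcases lt_or_gt_of_ne hξ with h | h
      · rw [hgdef, indicator_of_notMem (by simpa using h.le),
          indicator_of_mem (by simpa using h), hh]; simp
      · rw [hgdef, indicator_of_notMem (a := -ξ) (by simpa using h.le),
          indicator_of_mem (by simpa using h)]; simp
    have e2 : Fi w x = ((2 * (Fi g x).re : ℝ) : ℂ) := by rw [e1, Complex.add_conj]
    rw [e2, Complex.norm_real, Real.norm_eq_abs, abs_mul, abs_two]
    linarith [abs_nonneg (Fi g x).re]
  have hk2 : 2 ≤ 2 * k := by omega
  have hi := integrable_Fi_pow hg hk2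
  have hiw := integrable_Fi_pow hw hk2
  have hz := integral_Fi_pow_eq_zero hg (fun ξ hξ => by simp [hgdef, hξ]) hk2
  have hle : ∫ x, ‖Fi g x ^ (2 * k)‖ ≤ ∫ x, A * ‖Fi w x ^ (2 * k)‖ := by
    have hir : Integrable fun x => (Fi g x ^ (2 * k)).re := hi.re
    have : ∫ x, ‖Fi g x ^ (2 * k)‖ ≤
        ∫ x, (A * ‖Fi w x ^ (2 * k)‖ + B * ((-1) ^ k * (Fi g x ^ (2 * k)).re)) := by
      refine integral_mono hi.norm ((hiw.norm.const_mul A).add ((hir.const_mul _).const_mul _))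
        fun x => ?_
      have h1 := hAB (Fi g x)
      have h2 : |(Fi g x).re| ^ (2 * k) ≤ ‖Fi w x‖ ^ (2 * k) :=
        pow_le_pow_left₀ (abs_nonneg _) (hre x) _
      simp only [norm_pow]
      have := mul_le_mul_of_nonneg_left h2 hA
      linarith
    rw [integral_add (hiw.norm.const_mul A) ((hir.const_mul _).const_mul _), integral_const_mul B,
      integral_const_mul ((-1) ^ k)] at this
    have h3 : ∫ x, (Fi g x ^ (2 * k)).re = 0 := by
      have := integral_re hi
      simp only [RCLike.re_to_complex] at this
      rw [this, hz]; simp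
    simpa [h3] using this
  rw [integral_const_mul] at hle
  have e : ∀ {u : ℝ → ℂ}, BS u → ∫⁻ x, ‖Fi u x‖ₑ ^ (2 * k) =
      ENNReal.ofReal (∫ x, ‖Fi u x ^ (2 * k)‖) := fun hu => by
    rw [ofReal_integral_norm_eq_lintegral_enorm (integrable_Fi_pow hu hk2)]
    simp
  rw [e hg, e hw, ← ENNReal.ofReal_mul hA]
  exact ENNReal.ofReal_le_ofReal hle

theorem ennreal_add_pow_le (a b : ℝ≥0∞) (n : ℕ) : (a + b) ^ n ≤ 2 ^ n * (a ^ n + b ^ n) := by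
  rcases le_total a b with h | h
  · calc (a + b) ^ n ≤ (2 * b) ^ n := by rw [two_mul]; gcongr
      _ = 2 ^ n * b ^ n := mul_pow _ _ _
      _ ≤ _ := by gcongr; exact le_add_self
  · calc (a + b) ^ n ≤ (2 * a) ^ n := by rw [two_mul]; gcongr
      _ = 2 ^ n * a ^ n := mul_pow _ _ _
      _ ≤ _ := by gcongr; exact le_self_add

theorem lintegral_pow_le_of_le_add {F G H : ℝ → ℂ} (hG : Continuous G) {n : ℕ}
    (h : ∀ x, ‖F x‖ₑ ≤ ‖G x‖ₑ + ‖H x‖ₑ) {c : ℝ≥0∞} (hGc : ∫⁻ x, ‖G x‖ₑ ^ n ≤ c)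
    (hHc : ∫⁻ x, ‖H x‖ₑ ^ n ≤ c) : ∫⁻ x, ‖F x‖ₑ ^ n ≤ 2 ^ (n + 1) * c := by
  calc ∫⁻ x, ‖F x‖ₑ ^ n ≤ ∫⁻ x, 2 ^ n * (‖G x‖ₑ ^ n + ‖H x‖ₑ ^ n) :=
        lintegral_mono fun x => (pow_le_pow_left' (h x) n).trans (ennreal_add_pow_le _ _ _)
    _ = 2 ^ n * ((∫⁻ x, ‖G x‖ₑ ^ n) + ∫⁻ x, ‖H x‖ₑ ^ n) := by
        rw [lintegral_const_mul' _ _ (by simp), lintegral_add_left]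
        exact (hG.enorm.measurable.pow_const n)
    _ ≤ 2 ^ n * (c + c) := by gcongr
    _ = _ := by rw [← two_mul, pow_succ, mul_assoc]

theorem riesz_zero {k : ℕ} (hk : k ≠ 0) : ∃ C : ℝ≥0∞, C ≠ ⊤ ∧ ∀ w : ℝ → ℂ, BS w →
    ∫⁻ x, ‖Fi ((Ioi 0).indicator w) x‖ₑ ^ (2 * k) ≤ C * ∫⁻ x, ‖Fi w x‖ₑ ^ (2 * k) := by
  obtain ⟨C, hC, h⟩ := riesz_hermitian hk
  refine ⟨2 ^ (2 * k + 1) * (C * 2 ^ (2 * k)), by finiteness, fun w hw => ?_⟩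
  have hr : ∀ c : ℂ, ‖c‖ = 1 → BS fun ξ => c * w ξ + (starRingEnd ℂ) (c * w (-ξ)) := fun c hc =>
    (hw.mul_bdd (G := fun _ => c) (M := 1) (by fun_prop) (by simp [hc])).add
      (hw.comp_neg.mul_bdd (G := fun _ => c) (M := 1) (by fun_prop) (by simp [hc])).conj
  have hb : ∀ c : ℂ, ‖c‖ = 1 →
      ∫⁻ x, ‖Fi ((Ioi 0).indicator fun ξ => c * w ξ + (starRingEnd ℂ) (c * w (-ξ))) x‖ₑ ^ (2 * k) ≤
      C * 2 ^ (2 * k) * ∫⁻ x, ‖Fi w x‖ₑ ^ (2 * k) := fun c hc => by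
    have hcw := (hw.mul_bdd (G := fun _ => c) (M := 1) (by fun_prop) (by simp [hc]))
    refine (h _ (hr c hc) fun ξ => by simp [add_comm]).trans ?_
    rw [mul_assoc]
    refine mul_le_mul_of_nonneg_left ?_ zero_le
    rw [← lintegral_const_mul' _ _ (by simp)]
    refine lintegral_mono fun x => ?_
    rw [← mul_pow]
    refine pow_le_pow_left' ?_ _
    have hcj := conj_Fi (fun ξ => c * w ξ) x
    rw [Fi_add hcw hcw.comp_neg.conj, ← hcj, Fi_const_mul]
    refine (enorm_add_le _ _).trans_eq ?_
    have : ‖c‖ₑ = 1 := by rw [← ofReal_norm, hc, ENNReal.ofReal_one]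
    rw [RCLike.enorm_conj, enorm_mul, this, one_mul, two_mul]
  rw [mul_assoc]
  refine lintegral_pow_le_of_le_add (Fi_continuous ((hr 1 (by simp)).indicator
    measurableSet_Ioi).integrable) (fun x => ?_) (hb 1 (by simp)) (hb I (by simp))
  have e : (Ioi 0).indicator w = fun ξ =>
      (1 / 2) * (Ioi 0).indicator (fun ξ => 1 * w ξ + (starRingEnd ℂ) (1 * w (-ξ))) ξ +
      (-I / 2) * (Ioi 0).indicator (fun ξ => I * w ξ + (starRingEnd ℂ) (I * w (-ξ))) ξ := by
    ext ξ
    by_cases hξ : ξ ∈ Ioi (0 : ℝ)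
    · simp only [indicator_of_mem hξ, map_mul, conj_I, map_one]
      linear_combination ((1 / 2) * w ξ - (1 / 2) * (starRingEnd ℂ) (w (-ξ))) * I_sq
    · simp only [indicator_of_notMem hξ]; simp
  have h1 := (hr 1 (by simp)).indicator (measurableSet_Ioi (a := (0 : ℝ)))
  have h2 := (hr I (by simp)).indicator (measurableSet_Ioi (a := (0 : ℝ)))
  rw [e, Fi_add (h1.mul_bdd (G := fun _ => (1 / 2 : ℂ)) (M := 1) (by fun_prop) (by norm_num))
    (h2.mul_bdd (G := fun _ => (-I / 2 : ℂ)) (M := 1) (by fun_prop) (by norm_num)),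
    Fi_const_mul, Fi_const_mul]
  refine (enorm_add_le _ _).trans ?_
  rw [enorm_mul, enorm_mul]
  refine add_le_add (mul_le_of_le_one_left zero_le ?_) (mul_le_of_le_one_left zero_le ?_)
  · rw [← ofReal_norm, ENNReal.ofReal_le_one]; norm_num
  · rw [← ofReal_norm, ENNReal.ofReal_le_one]; norm_num

theorem Fi_indicator_Ioi (w : ℝ → ℂ) (α x : ℝ) : Fi ((Ioi α).indicator w) x =
    ex (α * x) * Fi ((Ioi 0).indicator fun ξ => w (ξ + α)) x := by
  rw [Fi, Fi, ← integral_const_mul, ← integral_add_right_eq_self _ α]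
  congr 1; ext ξ
  have : (Ioi α).indicator w (ξ + α) = (Ioi 0).indicator (fun ξ => w (ξ + α)) ξ := by
    by_cases h : 0 < ξ <;> simp [h]
  rw [this, ← mul_assoc, ← ex_add]; ring_nf

theorem Fi_translate (w : ℝ → ℂ) (α x : ℝ) :
    Fi w x = ex (α * x) * Fi (fun ξ => w (ξ + α)) x := by
  rw [Fi, Fi, ← integral_const_mul, ← integral_add_right_eq_self _ α]
  congr 1; ext ξ
  rw [← mul_assoc, ← ex_add]; ring_nf

theorem riesz_Ioi {k : ℕ} (hk : k ≠ 0) : ∃ C : ℝ≥0∞, C ≠ ⊤ ∧ ∀ w : ℝ → ℂ, BS w → ∀ α : ℝ,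
    ∫⁻ x, ‖Fi ((Ioi α).indicator w) x‖ₑ ^ (2 * k) ≤ C * ∫⁻ x, ‖Fi w x‖ₑ ^ (2 * k) := by
  obtain ⟨C, hC, h⟩ := riesz_zero hk
  refine ⟨C, hC, fun w hw α => ?_⟩
  simp_rw [Fi_indicator_Ioi w α, Fi_translate w α, enorm_mul, enorm_ex, one_mul]
  exact h _ (hw.comp_sub α)

theorem indicator_ae_eq_sub {J : Set ℝ} (hb : Bornology.IsBounded J) (ho : J.OrdConnected)
    (hne : J.Nonempty) (w : ℝ → ℂ) :
    J.indicator w =ᵐ[volume] fun ξ => (Ioi (sInf J)).indicator w ξ - (Ioi (sSup J)).indicator w ξ := by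
  have h0 : ∀ᵐ ξ : ℝ, ξ ≠ sInf J := by simp [ae_iff]
  have h1 : ∀ᵐ ξ : ℝ, ξ ≠ sSup J := by simp [ae_iff]
  have hba := hb.bddAbove
  have hbb := hb.bddBelow
  filter_upwards [h0, h1] with ξ hξ0 hξ1
  by_cases hξ : ξ ∈ J
  · have a1 : sInf J < ξ := lt_of_le_of_ne (csInf_le hbb hξ) hξ0.symm
    have a2 : ¬ sSup J < ξ := not_lt.2 (le_csSup hba hξ)
    simp [hξ, a1, a2]
  · by_cases a1 : sInf J < ξ
    · have a2 : sSup J < ξ := by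
        by_contra h
        have hlt : ξ < sSup J := lt_of_le_of_ne (not_lt.1 h) hξ1
        obtain ⟨a, ha, ha'⟩ := exists_lt_of_csInf_lt hne a1
        obtain ⟨b, hb, hb'⟩ := exists_lt_of_lt_csSup hne hlt
        exact hξ (ho.out ha hb ⟨ha'.le, hb'.le⟩)
      simp [hξ, a1, a2]
    · have a2 : ¬ sSup J < ξ := fun h =>
        a1 (((csInf_le hbb hne.some_mem).trans (le_csSup hba hne.some_mem)).trans_lt h)
      simp [hξ, a1, a2]

theorem riesz_interval {k : ℕ} (hk : k ≠ 0) : ∃ C : ℝ≥0∞, C ≠ ⊤ ∧ ∀ w : ℝ → ℂ, BS w →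
    ∀ J : Set ℝ, Bornology.IsBounded J → J.OrdConnected →
    ∫⁻ x, ‖Fi (J.indicator w) x‖ₑ ^ (2 * k) ≤ C * ∫⁻ x, ‖Fi w x‖ₑ ^ (2 * k) := by
  obtain ⟨C, hC, h⟩ := riesz_Ioi hk
  refine ⟨2 ^ (2 * k + 1) * C, by finiteness, fun w hw J hb ho => ?_⟩
  rcases J.eq_empty_or_nonempty with rfl | hne
  · simp [Fi, hk]
  rw [mul_assoc]
  refine lintegral_pow_le_of_le_add (Fi_continuous (hw.indicator
    measurableSet_Ioi).integrable) (fun x => ?_) (h w hw (sInf J)) (h w hw (sSup J))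
  have e : Fi (J.indicator w) x = Fi ((Ioi (sInf J)).indicator w) x -
      Fi ((Ioi (sSup J)).indicator w) x := by
    rw [Fi, Fi, Fi, ← integral_sub
      ((hw.indicator measurableSet_Ioi).mul_bdd (M := 1) (by fun_prop) (by simp)).integrable
      ((hw.indicator measurableSet_Ioi).mul_bdd (M := 1) (by fun_prop) (by simp)).integrable]
    apply integral_congr_ae
    filter_upwards [indicator_ae_eq_sub hb ho hne w] with ξ hξ
    rw [hξ, mul_sub]
  rw [e]
  exact enorm_sub_le

theorem young_pow {κ g : ℝ → ℝ≥0∞} (hκ : Measurable κ) (hg : Measurable g) {n : ℕ} (hn : 2 ≤ n) :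
    ∫⁻ z, (∫⁻ u, κ (z - u) * g u) ^ n ≤ (∫⁻ s, κ s) ^ n * ∫⁻ u, g u ^ n := by
  have hn' : (1 : ℝ) < n := by exact_mod_cast (by omega : 1 < n)
  have hc := Real.HolderConjugate.conjExponent hn'
  set q := Real.conjExponent (n : ℝ) with hq
  have hk (z : ℝ) : Measurable fun u => κ (z - u) := hκ.comp (by fun_prop)
  have hK (z : ℝ) : ∫⁻ u, κ (z - u) = ∫⁻ s, κ s := lintegral_sub_left_eq_self κ z
  have hpt (z : ℝ) : (∫⁻ u, κ (z - u) * g u) ^ n ≤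
      (∫⁻ s, κ s) ^ (n - 1) * ∫⁻ u, κ (z - u) * g u ^ n := by
    have h := ENNReal.lintegral_mul_le_Lp_mul_Lq volume hc
      (f := fun u => κ (z - u) ^ (1 / (n : ℝ)) * g u) (g := fun u => κ (z - u) ^ (1 / q))
      (((hk z).pow_const _).mul hg).aemeasurable ((hk z).pow_const _).aemeasurable
    have e1 : ∀ u, ((fun u => κ (z - u) ^ (1 / (n : ℝ)) * g u) * fun u => κ (z - u) ^ (1 / q)) u
        = κ (z - u) * g u := fun u => by
      simp only [Pi.mul_apply]
      rw [mul_right_comm, ← ENNReal.rpow_add_of_nonneg _ _ (by positivity) (by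
        have := hc.symm.pos; positivity)]
      have : 1 / (n : ℝ) + 1 / q = 1 := by simpa using hc.inv_add_inv_eq_one
      rw [this, ENNReal.rpow_one]
    have e2 : ∀ u, (κ (z - u) ^ (1 / (n : ℝ)) * g u) ^ (n : ℝ) = κ (z - u) * g u ^ n := fun u => by
      rw [ENNReal.mul_rpow_of_nonneg _ _ (by positivity), ← ENNReal.rpow_mul,
        one_div_mul_cancel (by positivity), ENNReal.rpow_one, ENNReal.rpow_natCast]
    have e3 : ∀ u, (κ (z - u) ^ (1 / q)) ^ q = κ (z - u) := fun u => by
      rw [← ENNReal.rpow_mul, one_div_mul_cancel hc.symm.pos.ne', ENNReal.rpow_one]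
    simp_rw [e1, e2, e3, hK] at h
    calc _ ≤ _ := pow_le_pow_left' h n
      _ = _ := by
        rw [mul_pow, ← ENNReal.rpow_natCast, ← ENNReal.rpow_mul,
          one_div_mul_cancel (by positivity), ENNReal.rpow_one, mul_comm, ← ENNReal.rpow_natCast,
          ← ENNReal.rpow_mul]
        congr 1
        have : 1 / q * n = ((n - 1 : ℕ) : ℝ) := by
          rw [hq, Real.conjExponent, Nat.cast_sub (by omega)]
          have : (n : ℝ) - 1 ≠ 0 := by linarith
          field_simp; simp
        rw [this, ENNReal.rpow_natCast]
  have hmeas : Measurable fun p : ℝ × ℝ => κ (p.1 - p.2) * g p.2 ^ n :=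
    (hκ.comp (by fun_prop)).mul ((hg.comp measurable_snd).pow_const n)
  calc _ ≤ ∫⁻ z, (∫⁻ s, κ s) ^ (n - 1) * ∫⁻ u, κ (z - u) * g u ^ n := lintegral_mono hpt
    _ = (∫⁻ s, κ s) ^ (n - 1) * ∫⁻ z, ∫⁻ u, κ (z - u) * g u ^ n :=
        lintegral_const_mul _ hmeas.lintegral_prod_right
    _ = (∫⁻ s, κ s) ^ (n - 1) * ∫⁻ u, ∫⁻ z, κ (z - u) * g u ^ n := by
        rw [lintegral_lintegral_swap hmeas.aemeasurable]
    _ = (∫⁻ s, κ s) ^ (n - 1) * ∫⁻ u, (∫⁻ s, κ s) * g u ^ n := by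
        congr 1; congr 1; ext u
        have hm : Measurable fun z => κ (z - u) := hκ.comp (measurable_sub_const u)
        rw [lintegral_mul_const _ hm, lintegral_sub_right_eq_self κ u]
    _ = _ := by
        rw [lintegral_const_mul _ (hg.pow_const n), ← mul_assoc, ← pow_succ]
        congr 2; omega

theorem exists_cutoff : ∃ K : ℝ≥0∞, K ≠ ⊤ ∧ ∀ R : ℝ, 0 < R → ∃ χ : ℝ → ℂ, BS χ ∧
    (∀ ξ, |ξ| ≤ R → χ ξ = 1) ∧ ∫⁻ s, ‖Fi χ s‖ₑ = K := by
  let b : ContDiffBump (0 : ℝ) := ⟨1, 2, one_pos, one_lt_two⟩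
  have hg' : ContDiff ℝ ∞ (fun x => (b x : ℂ)) := Complex.ofRealCLM.contDiff.comp b.contDiff
  have hgs' : HasCompactSupport (fun x => (b x : ℂ)) :=
    b.hasCompactSupport.comp_left (g := fun x : ℝ => (x : ℂ)) (by simp)
  let φ : 𝓢(ℝ, ℂ) := hgs'.toSchwartzMap hg'
  have hφ : ∀ x, φ x = b x := fun x => rfl
  have hF : ∀ x, Fi φ x = (𝓕 φ) (-x) := fun x => by rw [Fi_eq, SchwartzMap.fourier_coe]
  have hi : Integrable (Fi φ) := by
    have := (𝓕 φ).integrable (μ := volume)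
    have h2 := this.comp_neg
    exact h2.congr (Eventually.of_forall fun x => (hF x).symm)
  refine ⟨∫⁻ s, ‖Fi φ s‖ₑ, hi.2.ne, fun R hR => ⟨fun ξ => φ (ξ / R), ?_, ?_, ?_⟩⟩
  · refine ⟨φ.continuous.measurable.comp (by fun_prop), ⟨1, fun x => ?_⟩, 2 * R, fun x hx => ?_⟩
    · simp only [hφ]
      rw [Complex.norm_real, Real.norm_eq_abs, abs_of_nonneg b.nonneg]
      exact b.le_one
    · simp only [hφ]
      rw [b.zero_of_le_dist, Complex.ofReal_zero]
      rw [Real.norm_eq_abs] at hx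
      simp only [dist_zero_right, norm_div, Real.norm_eq_abs, abs_of_pos hR, b]
      rw [le_div_iff₀ hR]; exact hx.le
  · intro ξ hξ
    simp only [hφ]
    rw [b.one_of_mem_closedBall, Complex.ofReal_one]
    simp only [Metric.mem_closedBall, dist_zero_right, norm_div, Real.norm_eq_abs, abs_of_pos hR, b]
    rw [div_le_one hR]; exact hξ
  · have e : ∀ s, Fi (fun ξ => φ (ξ / R)) s = R * Fi φ (R * s) := fun s => by
      have := Measure.integral_comp_div (fun ξ => ex (ξ * (R * s)) * φ ξ) R
      rw [abs_of_pos hR] at this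
      simp only [Fi]
      rw [← Complex.real_smul, ← this]
      congr 1; ext ξ; congr 2; field_simp
    simp_rw [e, enorm_mul]
    rw [lintegral_const_mul' _ _ (by simp), ← ofReal_integral_norm_eq_lintegral_enorm hi,
      ← ofReal_integral_norm_eq_lintegral_enorm (hi.comp_mul_left' hR.ne'),
      Measure.integral_comp_mul_left (fun s => ‖Fi φ s‖), ← ofReal_norm, ← ENNReal.ofReal_mul
      (norm_nonneg _), Complex.norm_real, Real.norm_eq_abs, abs_of_pos hR, abs_of_pos (inv_pos.2 hR),
      smul_eq_mul, mul_inv_cancel_left₀ hR.ne']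

theorem riesz_PJ {k : ℕ} (hk : k ≠ 0) : ∃ C : ℝ≥0∞, C ≠ ⊤ ∧ ∀ g : ℝ → ℂ, BS g →
    ∀ J : Set ℝ, Bornology.IsBounded J → J.OrdConnected →
    ∫⁻ x, ‖PJ J g x‖ₑ ^ (2 * k) ≤ C * ∫⁻ x, ‖g x‖ₑ ^ (2 * k) := by
  obtain ⟨C, hC, h⟩ := riesz_interval hk
  obtain ⟨K, hK, hχ⟩ := exists_cutoff
  refine ⟨C * K ^ (2 * k), by finiteness, fun g hg J hb ho => ?_⟩
  obtain ⟨R, hR0, hR⟩ := hb.exists_pos_norm_le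
  obtain ⟨χ, hχb, hχ1, hχK⟩ := hχ R hR0
  have e : ∀ x, PJ J g x = Fi (J.indicator fun ξ => χ ξ * Fi g (-ξ)) x := fun x => by
    rw [PJ, Mu]
    congr 1; ext ξ
    by_cases hξ : ξ ∈ J
    · simp [hξ, hχ1 ξ (hR ξ hξ)]
    · simp [hξ]
  simp_rw [e]
  refine (h _ (hχb.mul_Fi hg) J hb ho).trans ?_
  rw [mul_assoc]
  gcongr
  rw [← hχK]
  refine le_trans (lintegral_mono fun z => ?_) (young_pow (κ := fun s => ‖Fi χ s‖ₑ)
    (g := fun u => ‖g u‖ₑ) (Fi_continuous hχb.integrable).enorm.measurable hg.1.enorm (by omega))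
  refine pow_le_pow_left' ?_ _
  have := Mu_eq hχb hg z
  rw [Mu] at this
  rw [this]
  refine (enorm_integral_le_lintegral_enorm _).trans_eq ?_
  simp_rw [enorm_mul]

theorem differentiable_integral_mul_exp {X : Type*} [MeasurableSpace X] {μ : Measure X} {G : X → ℂ}
    (hG : Integrable G μ) {L : X → ℝ} (hL : Measurable L) {B : ℝ} (hB : ∀ x, |L x| ≤ B) :
    Differentiable ℂ fun ζ : ℂ => ∫ x, G x * Complex.exp (ζ * L x) ∂μ := by
  intro ζ₀
  have hn : ∀ ζ x, ‖Complex.exp (ζ * L x)‖ ≤ Real.exp (‖ζ‖ * B) := fun ζ x => by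
    rw [Complex.norm_exp]
    refine Real.exp_le_exp.2 ((Complex.re_le_norm _).trans ?_)
    rw [norm_mul, Complex.norm_real, Real.norm_eq_abs]
    exact mul_le_mul_of_nonneg_left (hB x) (norm_nonneg _)
  have hm : ∀ ζ : ℂ, Measurable fun x => Complex.exp (ζ * L x) := fun ζ => by fun_prop
  refine (hasDerivAt_integral_of_dominated_loc_of_deriv_le (s := Metric.ball ζ₀ 1)
    (F := fun ζ x => G x * Complex.exp (ζ * L x))
    (F' := fun ζ x => G x * (Complex.exp (ζ * L x) * L x))
    (bound := fun x => ‖G x‖ * (Real.exp ((‖ζ₀‖ + 1) * |B|) * |B|)) (Metric.ball_mem_nhds _ one_pos)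
    (Eventually.of_forall fun ζ => hG.1.mul (hm ζ).aestronglyMeasurable) ?_
    (hG.1.mul ((hm ζ₀).mul (by fun_prop)).aestronglyMeasurable) ?_ (hG.norm.mul_const _)
    ?_).2.differentiableAt
  · exact hG.mul_bdd (hm ζ₀).aestronglyMeasurable (Eventually.of_forall (hn ζ₀))
  · refine Eventually.of_forall fun x ζ hζ => ?_
    rw [norm_mul, norm_mul, Complex.norm_real, Real.norm_eq_abs]
    have h1 : ‖ζ‖ ≤ ‖ζ₀‖ + 1 := by
      have := norm_le_norm_add_norm_sub' ζ ζ₀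
      rw [mem_ball_iff_norm] at hζ
      linarith
    have h2 : Real.exp (‖ζ‖ * B) ≤ Real.exp ((‖ζ₀‖ + 1) * |B|) :=
      Real.exp_le_exp.2 (mul_le_mul h1 (le_abs_self B) ((abs_nonneg _).trans (hB x)) (by positivity))
    exact mul_le_mul_of_nonneg_left (mul_le_mul ((hn ζ x).trans h2)
      ((hB x).trans (le_abs_self B)) (abs_nonneg _) (Real.exp_pos _).le) (norm_nonneg _)
  · refine Eventually.of_forall fun x ζ _ => ?_
    have h : HasDerivAt (fun ζ : ℂ => ζ * (L x : ℂ)) (L x : ℂ) ζ := by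
      simpa using (hasDerivAt_id ζ).mul_const (L x : ℂ)
    exact (h.cexp).const_mul (G x)

/-- Interpolation between the two edges of the strip for exponential families. -/
theorem norm_integral_mul_exp_le {X : Type*} [MeasurableSpace X] {μ : Measure X} {G : X → ℂ}
    (hG : Integrable G μ) {L : X → ℝ} (hL : Measurable L) {B : ℝ} (hB : ∀ x, |L x| ≤ B)
    {C₀ C₁ : ℝ} (h₀ : ∀ y : ℝ, ‖∫ x, G x * Complex.exp ((y * I) * L x) ∂μ‖ ≤ C₀)
    (h₁ : ∀ y : ℝ, ‖∫ x, G x * Complex.exp ((1 + y * I) * L x) ∂μ‖ ≤ C₁) {t : ℝ}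
    (ht : t ∈ Icc (0 : ℝ) 1) :
    ‖∫ x, G x * Complex.exp (t * L x) ∂μ‖ ≤ C₀ ^ (1 - t) * C₁ ^ t := by
  have hd := differentiable_integral_mul_exp hG hL hB
  have h := Complex.HadamardThreeLines.norm_le_interp_of_mem_verticalClosedStrip₀₁' (z := (t : ℂ))
    (a := C₀) (b := C₁)
    (fun ζ : ℂ => ∫ x, G x * Complex.exp (ζ * L x) ∂μ) (by
      simpa [Complex.HadamardThreeLines.verticalClosedStrip] using ht)
    ⟨hd.differentiableOn, hd.continuous.continuousOn⟩ ?_ ?_ ?_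
  · simpa using h
  · refine ⟨(∫ x, ‖G x‖ ∂μ) * Real.exp |B|, ?_⟩
    rintro _ ⟨ζ, hζ, rfl⟩
    simp only [Complex.HadamardThreeLines.verticalClosedStrip, mem_preimage, mem_Icc] at hζ
    rw [Function.comp, ← integral_mul_const]
    refine norm_integral_le_of_norm_le (hG.norm.mul_const _) (Eventually.of_forall fun x => ?_)
    rw [norm_mul, Complex.norm_exp]
    refine mul_le_mul_of_nonneg_left (Real.exp_le_exp.2 ?_) (norm_nonneg _)
    rw [Complex.re_mul_ofReal]
    have : ζ.re * L x ≤ |ζ.re * L x| := le_abs_self _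
    rw [abs_mul, abs_of_nonneg hζ.1] at this
    have h3 : ζ.re * |L x| ≤ 1 * |L x| := mul_le_mul_of_nonneg_right hζ.2 (abs_nonneg _)
    linarith [hB x, le_abs_self B]
  · intro ζ hζ
    have : ζ = ζ.im * I := by apply Complex.ext <;> simp [show ζ.re = 0 from hζ]
    rw [this]; exact h₀ _
  · intro ζ hζ
    have : ζ = 1 + ζ.im * I := by apply Complex.ext <;> simp [show ζ.re = 1 from hζ]
    rw [this]; exact h₁ _

theorem sq_lintegral_mul_le {X : Type*} [MeasurableSpace X] {μ : Measure X} {f g : X → ℝ≥0∞}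
    (hf : AEMeasurable f μ) (hg : AEMeasurable g μ) :
    (∫⁻ x, f x * g x ∂μ) ^ 2 ≤ (∫⁻ x, f x ^ 2 ∂μ) * ∫⁻ x, g x ^ 2 ∂μ := by
  have h := ENNReal.lintegral_mul_le_Lp_mul_Lq μ Real.HolderConjugate.two_two hf hg
  have e : ∀ a : ℝ≥0∞, (a ^ (1 / 2 : ℝ)) ^ 2 = a := fun a => by
    rw [← ENNReal.rpow_natCast, ← ENNReal.rpow_mul]; norm_num
  calc _ ≤ _ := pow_le_pow_left' h 2
    _ = _ := by rw [mul_pow, e, e]; norm_num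

/-- The squared exponential `exp (s)` as an extended nonnegative real. -/
theorem enorm_exp_ofReal_sq (s : ℝ) (t : ℂ) (h : t.re = s / 2) :
    ‖Complex.exp t‖ₑ ^ 2 = ENNReal.ofReal (Real.exp s) := by
  rw [← ofReal_norm, Complex.norm_exp, h, ← ENNReal.ofReal_pow (Real.exp_pos _).le,
    ← Real.exp_nat_mul]
  congr 2; push_cast; ring

theorem Fi_indicator {I : Set ℝ} (hI : MeasurableSet I) (w : ℝ → ℂ) (x : ℝ) :
    Fi (I.indicator w) x = ∫ ξ in I, ex (ξ * x) * w ξ := by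
  rw [Fi, ← integral_indicator hI]
  congr 1; ext ξ
  by_cases h : ξ ∈ I <;> simp [h]

theorem plancherel_indicator {I : Set ℝ} (hI : MeasurableSet I) (hIb : Bornology.IsBounded I)
    {w : ℝ → ℂ} (hw : Measurable w) {M : ℝ} (hM : ∀ x, ‖w x‖ ≤ M) :
    ∫⁻ x, ‖Fi (I.indicator w) x‖ₑ ^ 2 = ∫⁻ ξ in I, ‖w ξ‖ₑ ^ 2 := by
  rw [plancherel (BS.indicator_of_bdd hI hIb hw hM), ← lintegral_indicator hI]
  congr 1; ext ξ
  by_cases h : ξ ∈ I <;> simp [h]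

theorem measurable_Fi_indicator {I : Set ℝ} (hI : MeasurableSet I) {X : Type*} [MeasurableSpace X]
    {W : X → ℝ → ℂ} (hW : Measurable (Function.uncurry W)) {g : X → ℝ} (hg : Measurable g) :
    Measurable fun z => Fi (I.indicator (W z)) (g z) := by
  simp_rw [Fi_indicator hI]
  have : Measurable fun p : X × ℝ => ex (p.2 * g p.1) * W p.1 p.2 :=
    (by fun_prop : Measurable fun p : X × ℝ => ex (p.2 * g p.1)).mul hW
  exact (this.stronglyMeasurable.integral_prod_right (ν := volume.restrict I)).measurable

theorem weighted_hausdorff_young_box {θ : ℝ} (hθ : θ ∈ Icc (0 : ℝ) 1) {I : Set ℝ}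
    (hI : MeasurableSet I) (hIb : Bornology.IsBounded I) {α σ : ℝ → ℝ} (hα : Measurable α)
    (hσ : Measurable σ) {B : ℝ} (hαB : ∀ x, |α x| ≤ B) (hσB : ∀ x, |σ x| ≤ B) {T : ℝ}
    (hσ2 : ∫⁻ x in Metric.closedBall 0 T, ENNReal.ofReal (Real.exp (σ x)) ≤ 2)
    {W : ℝ × ℝ → ℂ} (hW : Measurable W) {M : ℝ} (hM : ∀ x, ‖W x‖ ≤ M)
    (hW2 : ∀ ξ, ∫⁻ y, ‖W (ξ, y)‖ₑ ^ 2 ≤ ENNReal.ofReal (Real.exp ((1 + θ) * α ξ))) :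
    ∫⁻ z in Metric.closedBall (0 : ℝ × ℝ) T,
        ‖Fi (I.indicator fun ξ => W (ξ, z.2)) z.1‖ₑ ^ 2 * ENNReal.ofReal (Real.exp (θ * σ z.1)) ≤
      2 * (∫⁻ ξ in I, ENNReal.ofReal (Real.exp (α ξ))) ^ (1 + θ) := by
  set K := Metric.closedBall (0 : ℝ × ℝ) T with hK
  have hKm : MeasurableSet K := measurableSet_closedBall
  have hKf : IsFiniteMeasure (volume.restrict K) :=
    ⟨by simpa using (isCompact_closedBall (0 : ℝ × ℝ) T).measure_lt_top⟩
  have hIf : IsFiniteMeasure (volume.restrict I) :=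
    ⟨by simpa using hIb.measure_lt_top⟩
  set Ψ := ∫⁻ ξ in I, ENNReal.ofReal (Real.exp (α ξ)) with hΨ
  have hΨf : Ψ ≠ ⊤ := by
    refine ((lintegral_mono fun ξ => ENNReal.ofReal_le_ofReal (Real.exp_le_exp.2
      ((le_abs_self _).trans (hαB ξ)))).trans_lt ?_).ne
    rw [lintegral_const]
    finiteness
  set A : ℝ × ℝ → ℂ := fun z => Fi (I.indicator fun ξ => W (ξ, z.2)) z.1 with hA
  have hAm : Measurable A := measurable_Fi_indicator hI
    (W := fun (z : ℝ × ℝ) ξ => W (ξ, z.2)) (hW.comp (by fun_prop)) measurable_fst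
  have hM0 : 0 ≤ M := (norm_nonneg _).trans (hM 0)
  have hAb : ∀ z, ‖A z‖ ≤ M * volume.real I := fun z => by
    simp only [hA, Fi_indicator hI]
    exact norm_setIntegral_le_of_norm_le_const hIb.measure_lt_top fun ξ _ => by simpa using hM _
  have hexpB : ∀ (c : ℂ) (s : ℝ), |s| ≤ B → ‖Complex.exp (c * s)‖ ≤ Real.exp (‖c‖ * B) := by
    intro c s hs
    rw [Complex.norm_exp]
    refine Real.exp_le_exp.2 ((Complex.re_le_norm _).trans ?_)
    rw [norm_mul, Complex.norm_real, Real.norm_eq_abs]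
    exact mul_le_mul_of_nonneg_left hs (norm_nonneg _)
  set h : ℝ × ℝ → ℂ := fun z => (starRingEnd ℂ) (A z) * Complex.exp ((θ / 2 : ℝ) * σ z.1) with hh
  have hhm : Measurable h := (Complex.continuous_conj.measurable.comp hAm).mul (by fun_prop)
  have hhb : ∀ z, ‖h z‖ ≤ (M * volume.real I) * Real.exp (‖((θ / 2 : ℝ) : ℂ)‖ * B) := fun z => by
    rw [hh, norm_mul, RCLike.norm_conj]
    exact mul_le_mul (hAb z) (hexpB _ _ (hσB _)) (norm_nonneg _) (by positivity)
  set Q := ∫⁻ z in K, ‖h z‖ₑ ^ 2 with hQ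
  have hQe : Q = ∫⁻ z in K, ‖A z‖ₑ ^ 2 * ENNReal.ofReal (Real.exp (θ * σ z.1)) := by
    refine lintegral_congr fun z => ?_
    rw [hh, enorm_mul, mul_pow, RCLike.enorm_conj, enorm_exp_ofReal_sq (θ * σ z.1)]
    rw [Complex.re_mul_ofReal, Complex.ofReal_re]; ring
  have hQf : Q ≠ ⊤ := by
    refine ((lintegral_mono fun z => pow_le_pow_left' (?_ : ‖h z‖ₑ ≤ ENNReal.ofReal
      ((M * volume.real I) * Real.exp (‖((θ / 2 : ℝ) : ℂ)‖ * B))) 2).trans_lt ?_).ne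
    · rw [← ofReal_norm]; exact ENNReal.ofReal_le_ofReal (hhb z)
    · rw [lintegral_const]
      finiteness
  rw [← hQe]
  set G : (ℝ × ℝ) × ℝ → ℂ := fun p => h p.1 *
    (ex (p.2 * p.1.1) * (W (p.2, p.1.2) * Complex.exp ((-θ / 2 : ℝ) * α p.2))) with hG
  have hWm : Measurable fun p : (ℝ × ℝ) × ℝ => W (p.2, p.1.2) := hW.comp (by fun_prop)
  have hGm : Measurable G := (hhm.comp measurable_fst).mul
    ((by fun_prop : Measurable fun p : (ℝ × ℝ) × ℝ => ex (p.2 * p.1.1)).mul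
      (hWm.mul (by fun_prop)))
  set μ := (volume.restrict K).prod (volume.restrict I) with hμ
  have hGi : Integrable G μ := by
    refine Integrable.of_bound hGm.aestronglyMeasurable
      ((M * volume.real I) * Real.exp (‖((θ / 2 : ℝ) : ℂ)‖ * B) *
        (1 * (M * Real.exp (‖((-θ / 2 : ℝ) : ℂ)‖ * B)))) (Eventually.of_forall fun p => ?_)
    simp only [hG]
    rw [norm_mul (h p.1), norm_mul (ex _), norm_mul (W _), norm_ex]
    exact mul_le_mul (hhb _) (mul_le_mul_of_nonneg_left (mul_le_mul (hM _) (hexpB _ _ (hαB _))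
      (norm_nonneg _) hM0) zero_le_one) (by positivity) (by positivity)
  set L : (ℝ × ℝ) × ℝ → ℝ := fun p => (σ p.1.1 + α p.2) / 2 with hL
  have hLm : Measurable L := by fun_prop
  have hLB : ∀ p, |L p| ≤ B := fun p => by
    have h1 := abs_le.1 (hσB p.1.1)
    have h2 := abs_le.1 (hαB p.2)
    rw [abs_le]; constructor <;> simp only [hL] <;> linarith
  -- the section norm
  have hsec : ∫⁻ ξ in I, ∫⁻ y, ‖W (ξ, y) * Complex.exp ((-θ / 2 : ℝ) * α ξ)‖ₑ ^ 2 ≤ Ψ := by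
    refine lintegral_mono fun ξ => ?_
    simp_rw [enorm_mul, mul_pow]
    rw [lintegral_mul_const' _ _ (by finiteness), enorm_exp_ofReal_sq (-θ * α ξ)
      _ (by rw [Complex.re_mul_ofReal, Complex.ofReal_re]; ring)]
    calc _ ≤ ENNReal.ofReal (Real.exp ((1 + θ) * α ξ)) * ENNReal.ofReal (Real.exp (-θ * α ξ)) := by
          gcongr; exact hW2 ξ
      _ = _ := by
        rw [← ENNReal.ofReal_mul (Real.exp_pos _).le, ← Real.exp_add]; congr 2; ring
  have hWE : Measurable fun p : ℝ × ℝ => W p * Complex.exp ((-θ / 2 : ℝ) * α p.1) :=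
    hW.mul (by fun_prop)
  have h_int : ∀ ζ : ℂ, ∫ p, G p * Complex.exp (ζ * L p) ∂μ = ∫ z in K, h z *
      (Complex.exp (ζ / 2 * σ z.1) * Fi (I.indicator fun ξ => W (ξ, z.2) *
        Complex.exp ((-θ / 2 : ℝ) * α ξ) * Complex.exp (ζ / 2 * α ξ)) z.1) := by
    intro ζ
    rw [hμ, integral_prod _ (hGi.mul_bdd (c := Real.exp (‖ζ‖ * B)) (by fun_prop)
      (Eventually.of_forall fun p => hexpB _ _ (hLB p)))]
    refine integral_congr_ae (Eventually.of_forall fun z => ?_)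
    simp only [Fi_indicator hI, hG, hL]
    rw [← integral_const_mul, ← integral_const_mul]
    congr 1; ext ξ
    have : Complex.exp (ζ * ((σ z.1 + α ξ) / 2 : ℝ)) =
        Complex.exp (ζ / 2 * σ z.1) * Complex.exp (ζ / 2 * α ξ) := by
      rw [← Complex.exp_add]; congr 1; push_cast; ring
    rw [this]; ring
  have h0 : ∀ y : ℝ, ‖∫ p, G p * Complex.exp ((y * Complex.I) * L p) ∂μ‖ₑ ^ 2 ≤ Q * Ψ := by
    intro y
    have hu : ∀ s : ℝ, ‖Complex.exp (y * Complex.I / 2 * s)‖ₑ = 1 := fun s => by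
      rw [← ofReal_norm, Complex.norm_exp]; simp
    have hFm : Measurable fun p : ℝ × ℝ => W p * Complex.exp ((-θ / 2 : ℝ) * α p.1) *
      Complex.exp (y * Complex.I / 2 * α p.1) := hWE.mul (by fun_prop)
    set F : ℝ × ℝ → ℂ := fun z => Fi (I.indicator fun ξ => W (ξ, z.2) *
        Complex.exp ((-θ / 2 : ℝ) * α ξ) * Complex.exp (y * Complex.I / 2 * α ξ)) z.1 with hF
    have hFm' : Measurable F := measurable_Fi_indicator hI (W := fun (z : ℝ × ℝ) ξ => W (ξ, z.2) *
        Complex.exp ((-θ / 2 : ℝ) * α ξ) * Complex.exp (y * Complex.I / 2 * α ξ))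
        (hFm.comp (by fun_prop : Measurable fun p : (ℝ × ℝ) × ℝ => (p.2, p.1.2))) measurable_fst
    rw [h_int]
    calc _ ≤ (∫⁻ z in K, ‖h z‖ₑ * ‖F z‖ₑ) ^ 2 := by
          refine pow_le_pow_left' ((enorm_integral_le_lintegral_enorm _).trans_eq ?_) 2
          refine lintegral_congr fun z => ?_
          rw [enorm_mul (h z), enorm_mul (Complex.exp _), hu, one_mul]
      _ ≤ Q * ∫⁻ z in K, ‖F z‖ₑ ^ 2 :=
          sq_lintegral_mul_le hhm.enorm.aemeasurable hFm'.enorm.aemeasurable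
      _ ≤ Q * ∫⁻ z, ‖F z‖ₑ ^ 2 := by gcongr; exact Measure.restrict_le_self
      _ ≤ Q * Ψ := by
          gcongr
          refine le_trans (le_of_eq ?_) hsec
          rw [Measure.volume_eq_prod, lintegral_prod_symm _ (hFm'.enorm.pow_const 2).aemeasurable]
          conv_rhs => rw [lintegral_lintegral_swap (f := fun ξ y' => ‖W (ξ, y') *
            Complex.exp ((-θ / 2 : ℝ) * α ξ)‖ₑ ^ 2) (hWE.enorm.pow_const 2).aemeasurable]
          refine lintegral_congr fun y' => ?_
          · refine (plancherel_indicator hI hIb (M := M * Real.exp (‖((-θ / 2 : ℝ) : ℂ)‖ * B) *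
              Real.exp (‖y * Complex.I / 2‖ * B))
              (hFm.comp (by fun_prop : Measurable fun ξ => (ξ, y'))) ?_).trans ?_
            · intro ξ
              simp only [Function.comp]
              rw [norm_mul, norm_mul]
              exact mul_le_mul (mul_le_mul (hM _) (hexpB _ _ (hαB _)) (norm_nonneg _) hM0)
                (hexpB _ _ (hαB _)) (norm_nonneg _) (by positivity)
            · refine lintegral_congr fun ξ => ?_
              simp only [Function.comp]; rw [enorm_mul, hu, mul_one]
  have h1 : ∀ y : ℝ, ‖∫ p, G p * Complex.exp ((1 + y * Complex.I) * L p) ∂μ‖ₑ ^ 2 ≤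
      Q * Ψ * (2 * Ψ) := by
    intro y
    have hbm : Measurable fun p : (ℝ × ℝ) × ℝ => ‖W (p.2, p.1.2) *
        Complex.exp ((-θ / 2 : ℝ) * α p.2)‖ₑ * ‖Complex.exp (σ p.1.1 / 2 : ℂ)‖ₑ :=
      (hWE.comp (by fun_prop : Measurable fun p : (ℝ × ℝ) × ℝ => (p.2, p.1.2))).enorm.mul
        (by fun_prop)
    calc _ ≤ (∫⁻ p, (‖h p.1‖ₑ * ‖Complex.exp (α p.2 / 2 : ℂ)‖ₑ) *
          (‖W (p.2, p.1.2) * Complex.exp ((-θ / 2 : ℝ) * α p.2)‖ₑ *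
            ‖Complex.exp (σ p.1.1 / 2 : ℂ)‖ₑ) ∂μ) ^ 2 := by
          refine pow_le_pow_left' ((enorm_integral_le_lintegral_enorm _).trans_eq ?_) 2
          refine lintegral_congr fun p => ?_
          simp only [hG, hL]
          have : ‖Complex.exp ((1 + y * Complex.I) * ((σ p.1.1 + α p.2) / 2 : ℝ))‖ₑ =
              ‖Complex.exp (α p.2 / 2 : ℂ)‖ₑ * ‖Complex.exp (σ p.1.1 / 2 : ℂ)‖ₑ := by
            rw [← enorm_mul, ← Complex.exp_add, ← ofReal_norm, ← ofReal_norm, Complex.norm_exp,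
              Complex.norm_exp]
            congr 2
            rw [Complex.re_mul_ofReal]
            simp
            ring
          rw [enorm_mul (h p.1 * _), enorm_mul (h p.1), enorm_mul (ex _), enorm_ex, this]
          ring
      _ ≤ _ := sq_lintegral_mul_le ((hhm.comp measurable_fst).enorm.mul
            (by fun_prop)).aemeasurable hbm.aemeasurable
      _ ≤ _ := by
          simp_rw [mul_pow]
          refine mul_le_mul' (le_of_eq ?_) ?_
          · rw [hμ, lintegral_prod_mul (hhm.enorm.pow_const 2).aemeasurable
              (f := fun z => ‖h z‖ₑ ^ 2) (g := fun ξ => ‖Complex.exp (α ξ / 2 : ℂ)‖ₑ ^ 2)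
              (by fun_prop)]
            congr 1
            refine lintegral_congr fun ξ => ?_
            rw [enorm_exp_ofReal_sq (α ξ)]
            simp
          · simp_rw [← mul_pow]
            rw [hμ, lintegral_prod_symm _ (hbm.pow_const 2).aemeasurable]
            have hstep : ∀ ξ, ∫⁻ z in K, (‖W (ξ, z.2) * Complex.exp ((-θ / 2 : ℝ) * α ξ)‖ₑ *
                ‖Complex.exp (σ z.1 / 2 : ℂ)‖ₑ) ^ 2 ≤
                2 * ∫⁻ y, ‖W (ξ, y) * Complex.exp ((-θ / 2 : ℝ) * α ξ)‖ₑ ^ 2 := by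
              intro ξ
              have hm1 : Measurable fun y => ‖W (ξ, y) * Complex.exp ((-θ / 2 : ℝ) * α ξ)‖ₑ ^ 2 :=
                ((hWE.comp (by fun_prop : Measurable fun y : ℝ => (ξ, y))).enorm.pow_const 2)
              have hKp : (volume : Measure (ℝ × ℝ)).restrict K =
                  (volume.restrict (Metric.closedBall 0 T)).prod
                    (volume.restrict (Metric.closedBall 0 T)) := by
                rw [Measure.prod_restrict, closedBall_prod_same, hK, Measure.volume_eq_prod]; rfl
              simp_rw [mul_pow, mul_comm (‖W _ * _‖ₑ ^ 2)]
              rw [hKp, lintegral_prod_mul (f := fun x => ‖Complex.exp (σ x / 2 : ℂ)‖ₑ ^ 2)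
                (by fun_prop) hm1.aemeasurable]
              refine mul_le_mul' ?_ (lintegral_mono' Measure.restrict_le_self le_rfl)
              refine le_trans (le_of_eq (lintegral_congr fun x => ?_)) hσ2
              rw [enorm_exp_ofReal_sq (σ x)]
              simp
            refine (lintegral_mono hstep).trans ?_
            rw [lintegral_const_mul' _ _ (by simp)]
            exact mul_le_mul_of_nonneg_left hsec zero_le
  rcases eq_or_ne Q 0 with hQ0 | hQ0
  · rw [hQ0]; exact zero_le
  have key := norm_integral_mul_exp_le hGi hLm hLB (C₀ := √(Q * Ψ).toReal)
    (C₁ := √(Q * Ψ * (2 * Ψ)).toReal) ?_ ?_ hθ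
  · have hfθ : ∫ p, G p * Complex.exp (θ * L p) ∂μ = ((Q.toReal : ℝ) : ℂ) := by
      rw [h_int, hQ, ← integral_toReal (hhm.enorm.pow_const 2).aemeasurable
        (Eventually.of_forall fun z => by finiteness), ← integral_complex_ofReal]
      refine integral_congr_ae (Eventually.of_forall fun z => ?_)
      have e1 : (fun ξ => W (ξ, z.2) * Complex.exp ((-θ / 2 : ℝ) * α ξ) *
          Complex.exp (θ / 2 * α ξ)) = fun ξ => W (ξ, z.2) := by
        ext ξ
        rw [mul_assoc, ← Complex.exp_add]
        have : ((-θ / 2 : ℝ) : ℂ) * α ξ + θ / 2 * α ξ = 0 := by push_cast; ring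
        rw [this, Complex.exp_zero, mul_one]
      have e2 : Complex.exp (θ / 2 * σ z.1) * A z = (starRingEnd ℂ) (h z) := by
        simp only [hh, map_mul, Complex.conj_conj, ← Complex.exp_conj, Complex.conj_ofReal]
        rw [mul_comm]; push_cast; rfl
      simp only [e1]
      rw [e2, Complex.mul_conj, Complex.normSq_eq_norm_sq]
      simp
    rw [hfθ, Complex.norm_real, Real.norm_of_nonneg ENNReal.toReal_nonneg, ENNReal.toReal_mul,
      ENNReal.toReal_mul, ENNReal.toReal_mul] at key
    have hq : 0 < Q.toReal := ENNReal.toReal_pos hQ0 hQf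
    have hψ : 0 ≤ Ψ.toReal := ENNReal.toReal_nonneg
    have hfin : Q.toReal ≤ 2 * Ψ.toReal ^ (1 + θ) := by
      simp only [ENNReal.toReal_mul, ENNReal.toReal_ofNat] at key
      set q := Q.toReal
      set ψ := Ψ.toReal
      have hsq := pow_le_pow_left₀ hq.le key 2
      have hroot : ∀ a t : ℝ, 0 ≤ a → (√a ^ t) ^ 2 = a ^ t := fun a t ha => by
        rw [← Real.rpow_natCast, ← Real.rpow_mul (Real.sqrt_nonneg a), mul_comm,
          Real.rpow_mul (Real.sqrt_nonneg a), Real.rpow_natCast, Real.sq_sqrt ha]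
      rw [mul_pow, hroot _ _ (by positivity), hroot _ _ (by positivity),
        Real.mul_rpow (x := q * ψ) (y := 2 * ψ) (by positivity) (by positivity), ← mul_assoc,
        ← Real.rpow_add_of_nonneg (by positivity) (by linarith [hθ.2]) hθ.1, sub_add_cancel,
        Real.rpow_one, sq, mul_assoc] at hsq
      have h3 := le_of_mul_le_mul_left hsq hq
      refine h3.trans ?_
      rw [Real.mul_rpow (by positivity) hψ, Real.rpow_add_of_nonneg hψ zero_le_one hθ.1,
        Real.rpow_one]
      have h4 : (2 : ℝ) ^ θ ≤ 2 := by
        calc (2 : ℝ) ^ θ ≤ 2 ^ (1 : ℝ) := Real.rpow_le_rpow_of_exponent_le (by norm_num) hθ.2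
          _ = 2 := Real.rpow_one 2
      calc ψ * (2 ^ θ * ψ ^ θ) = 2 ^ θ * (ψ * ψ ^ θ) := by ring
        _ ≤ _ := by gcongr
    rw [← ENNReal.ofReal_toReal hQf, ← ENNReal.ofReal_toReal hΨf,
      ENNReal.ofReal_rpow_of_nonneg hψ (by linarith [hθ.1]),
      show (2 : ℝ≥0∞) = ENNReal.ofReal 2 by simp, ← ENNReal.ofReal_mul (by norm_num)]
    exact ENNReal.ofReal_le_ofReal hfin
  · intro y
    apply Real.le_sqrt_of_sq_le
    have := ENNReal.toReal_mono (by finiteness) (h0 y)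
    simpa using this
  · intro y
    apply Real.le_sqrt_of_sq_le
    have := ENNReal.toReal_mono (by finiteness) (h1 y)
    simpa using this

/-- The real exponential as an extended nonnegative real. -/
noncomputable def EX (s : ℝ) : ℝ≥0∞ := ENNReal.ofReal (Real.exp s)

theorem EX_add (s t : ℝ) : EX (s + t) = EX s * EX t := by
  rw [EX, Real.exp_add, ENNReal.ofReal_mul (Real.exp_pos _).le]; rfl

theorem EX_ne_top (s : ℝ) : EX s ≠ ⊤ := ENNReal.ofReal_ne_top

theorem EX_ne_zero (s : ℝ) : EX s ≠ 0 := by simp [EX, Real.exp_pos]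

@[simp] theorem EX_zero : EX 0 = 1 := by simp [EX]

theorem EX_rpow (s t : ℝ) : EX s ^ t = EX (s * t) := by
  rw [EX, ENNReal.ofReal_rpow_of_pos (Real.exp_pos _), ← Real.exp_mul]; rfl

theorem EX_pow (s : ℝ) (n : ℕ) : EX s ^ n = EX (n * s) := by
  rw [← ENNReal.rpow_natCast, EX_rpow, mul_comm]

theorem measurable_EX : Measurable EX := Real.measurable_exp.ennreal_ofReal

@[fun_prop] theorem Measurable.EX {X : Type*} [MeasurableSpace X] {f : X → ℝ} (hf : Measurable f) :
    Measurable fun x => EX (f x) := measurable_EX.comp hf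

theorem EX_mul_neg (s : ℝ) : EX s * EX (-s) = 1 := by rw [← EX_add]; simp

theorem lintegral_le_of_forall_closedBall {E : Type*} [MeasurableSpace E] [NormedAddCommGroup E]
    [OpensMeasurableSpace E] {μ : Measure E} {f : E → ℝ≥0∞} (hf : AEMeasurable f μ) {c : ℝ≥0∞}
    (h : ∀ T : ℝ, 0 < T → ∫⁻ z in Metric.closedBall 0 T, f z ∂μ ≤ c) : ∫⁻ z, f z ∂μ ≤ c := by
  have hc : AECover μ atTop fun n : ℕ => Metric.closedBall (0 : E) ((n : ℝ) + 1) :=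
    aecover_closedBall (tendsto_atTop_add_const_right _ _ tendsto_natCast_atTop_atTop)
  exact le_of_tendsto' (hc.lintegral_tendsto_of_countably_generated hf) fun n => h _ (by positivity)

/-- Hausdorff–Young inequality with a weight. -/
theorem weighted_hausdorff_young {θ : ℝ} (hθ : θ ∈ Icc (0 : ℝ) 1) {I : Set ℝ}
    (hI : MeasurableSet I) (hIb : Bornology.IsBounded I) {α ρ : ℝ → ℝ} (hα : Measurable α)
    (hρ : Measurable ρ) {B : ℝ} (hαB : ∀ x, |α x| ≤ B) (hρ0 : ∀ x, 0 ≤ ρ x) {D : ℝ}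
    (hρD : ∀ x, ρ x ≤ D) (hρ1 : ∫⁻ x, ENNReal.ofReal (ρ x) ≤ 1)
    {W : ℝ × ℝ → ℂ} (hW : Measurable W) {M : ℝ} (hM : ∀ x, ‖W x‖ ≤ M)
    (hW2 : ∀ ξ, ∫⁻ y, ‖W (ξ, y)‖ₑ ^ 2 ≤ EX ((1 + θ) * α ξ)) :
    ∫⁻ z : ℝ × ℝ, ‖Fi (I.indicator fun ξ => W (ξ, z.2)) z.1‖ₑ ^ 2 * ENNReal.ofReal (ρ z.1) ^ θ ≤
      2 * (∫⁻ ξ in I, EX (α ξ)) ^ (1 + θ) := by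
  have hm : Measurable fun z : ℝ × ℝ => Fi (I.indicator fun ξ => W (ξ, z.2)) z.1 :=
    measurable_Fi_indicator hI (W := fun (z : ℝ × ℝ) ξ => W (ξ, z.2)) (hW.comp (by fun_prop))
      measurable_fst
  refine lintegral_le_of_forall_closedBall ((hm.enorm.pow_const 2).mul
    (((hρ.comp measurable_fst).ennreal_ofReal).pow_const θ)).aemeasurable fun T hT => ?_
  set κ : ℝ := 1 / (2 * T)
  have hκ : 0 < κ := by positivity
  have hpos : ∀ x, 0 < ρ x + κ := fun x => by linarith [hρ0 x]
  have hw := weighted_hausdorff_young_box hθ hI hIb hα (σ := fun x => Real.log (ρ x + κ))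
    (Real.measurable_log.comp (hρ.add_const κ)) (B := max B (max |Real.log κ| |Real.log (D + κ)|))
    (fun x => (hαB x).trans (le_max_left _ _)) (fun x => le_max_of_le_right (abs_le_max_abs_abs
      (Real.log_le_log hκ (by linarith [hρ0 x]))
      (Real.log_le_log (hpos x) (by linarith [hρD x])))) (T := T) ?_ hW hM hW2
  · refine le_trans (lintegral_mono fun z => ?_) hw
    refine mul_le_mul_of_nonneg_left ?_ zero_le
    rw [mul_comm θ, Real.exp_mul, Real.exp_log (hpos _),
      ← ENNReal.ofReal_rpow_of_nonneg (hpos _).le hθ.1]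
    exact ENNReal.rpow_le_rpow (ENNReal.ofReal_le_ofReal
      (le_add_of_nonneg_right hκ.le)) hθ.1
  · calc _ = (∫⁻ x in Metric.closedBall 0 T, (ENNReal.ofReal (ρ x) + ENNReal.ofReal κ)) := by
          refine lintegral_congr fun x => ?_
          rw [Real.exp_log (hpos x), ENNReal.ofReal_add (hρ0 x) hκ.le]
      _ = (∫⁻ x in Metric.closedBall 0 T, ENNReal.ofReal (ρ x)) +
          ∫⁻ x in Metric.closedBall (0 : ℝ) T, ENNReal.ofReal κ :=
        lintegral_add_right _ measurable_const
      _ ≤ 1 + 1 := by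
        refine add_le_add ((lintegral_mono' Measure.restrict_le_self le_rfl).trans hρ1) ?_
        rw [setLIntegral_const, Real.volume_closedBall, ← ENNReal.ofReal_mul hκ.le]
        simp only [κ]
        rw [one_div_mul_cancel (by positivity), ENNReal.ofReal_one]
      _ = 2 := one_add_one_eq_two

theorem sq_sum_mul_le {ι : Type*} (s : Finset ι) (f g : ι → ℝ≥0∞) :
    (∑ i ∈ s, f i * g i) ^ 2 ≤ (∑ i ∈ s, f i ^ 2) * ∑ i ∈ s, g i ^ 2 := by
  have h := ENNReal.inner_le_Lp_mul_Lq s f g Real.HolderConjugate.two_two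
  have e : ∀ a : ℝ≥0∞, (a ^ (1 / 2 : ℝ)) ^ 2 = a := fun a => by
    rw [← ENNReal.rpow_natCast, ← ENNReal.rpow_mul]; norm_num
  calc _ ≤ _ := pow_le_pow_left' h 2
    _ = _ := by rw [mul_pow, e, e]; norm_num

/-- Cauchy–Schwarz for sums of quantities controlled by geometric means. -/
theorem sq_sum_le_of_sq_le {ι : Type*} (s : Finset ι) {t X Y : ι → ℝ≥0∞}
    (h : ∀ i ∈ s, t i ^ 2 ≤ X i * Y i) : (∑ i ∈ s, t i) ^ 2 ≤ (∑ i ∈ s, X i) * ∑ i ∈ s, Y i := by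
  have e : ∀ a : ℝ≥0∞, (a ^ (1 / 2 : ℝ)) ^ 2 = a := fun a => by
    rw [← ENNReal.rpow_natCast, ← ENNReal.rpow_mul]; norm_num
  have h2 := sq_sum_mul_le s (fun i => X i ^ (1 / 2 : ℝ)) (fun i => Y i ^ (1 / 2 : ℝ))
  simp_rw [e] at h2
  refine le_trans (pow_le_pow_left' (Finset.sum_le_sum fun i hi => ?_) 2) h2
  refine (ENNReal.pow_le_pow_left_iff two_ne_zero).1 ?_
  rw [mul_pow, e, e]
  exact h i hi

section
variable {J : Set ℝ} {F : ℝ × ℝ → ℂ}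

theorem measurable_PJ (hJ : MeasurableSet J) (hb : Bornology.IsBounded J) (hF : BS F) :
    Measurable fun p : ℝ × ℝ => PJ J (fun u => F (p.1, u)) p.2 := by
  have e : (fun p : ℝ × ℝ => PJ J (fun u => F (p.1, u)) p.2) =
      fun p => ∫ u, kr J (p.2 - u) * F (p.1, u) := by
    ext p; exact PJ_eq_kernel hJ hb (hF.section_snd p.1) p.2
  rw [e]
  have : Measurable fun q : (ℝ × ℝ) × ℝ => kr J (q.1.2 - q.2) * F (q.1.1, q.2) :=
    ((kr_continuous hJ hb).measurable.comp (by fun_prop)).mul (hF.1.comp (by fun_prop))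
  exact (this.stronglyMeasurable.integral_prod_right (ν := volume)).measurable

theorem PJ_bound (hJ : MeasurableSet J) (hb : Bornology.IsBounded J) (hF : BS F) :
    ∃ M, ∀ p : ℝ × ℝ, ‖PJ J (fun u => F (p.1, u)) p.2‖ ≤ M := by
  obtain ⟨M, hM⟩ := kr_bound J
  obtain ⟨M', h0, hM'⟩ := hF.bound
  obtain ⟨R, hR⟩ := hF.2.2
  refine ⟨∫ u in Metric.closedBall (0 : ℝ) R, M * M', fun p => ?_⟩
  rw [PJ_eq_kernel hJ hb (hF.section_snd p.1), ← integral_indicator measurableSet_closedBall]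
  have hi : IntegrableOn (fun _ : ℝ => M * M') (Metric.closedBall 0 R) :=
    integrableOn_const measure_closedBall_lt_top.ne
  refine norm_integral_le_of_norm_le (hi.integrable_indicator measurableSet_closedBall)
    (Eventually.of_forall fun u => ?_)
  by_cases hu : u ∈ Metric.closedBall (0 : ℝ) R
  · rw [indicator_of_mem hu, norm_mul]
    exact mul_le_mul (hM _) (hM' _) (norm_nonneg _) ((norm_nonneg _).trans (hM 0))
  · rw [indicator_of_notMem hu, hR]
    · simp
    · simp only [Metric.mem_closedBall, dist_zero_right, not_le] at hu
      exact hu.trans_le (by simp [Prod.norm_def])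

/-- Frequency restriction to `I` in the first variable, projection to `J` in the second one. -/
noncomputable def Aop (I J : Set ℝ) (F : ℝ × ℝ → ℂ) (x y : ℝ) : ℂ :=
  Fi (I.indicator fun ξ => PJ J (fun u => F (ξ, u)) y) x

variable {I : Set ℝ}

theorem measurable_Aop (hI : MeasurableSet I) (hJ : MeasurableSet J) (hb : Bornology.IsBounded J)
    (hF : BS F) : Measurable fun z : ℝ × ℝ => Aop I J F z.1 z.2 :=
  measurable_Fi_indicator hI (W := fun (z : ℝ × ℝ) ξ => PJ J (fun u => F (ξ, u)) z.2)
    ((measurable_PJ hJ hb hF).comp (by fun_prop : Measurable fun p : (ℝ × ℝ) × ℝ => (p.2, p.1.2)))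
    measurable_fst

theorem enorm_Aop_le (hI : MeasurableSet I) (x y : ℝ) :
    ‖Aop I J F x y‖ₑ ≤ ∫⁻ ξ in I, ‖PJ J (fun u => F (ξ, u)) y‖ₑ := by
  rw [Aop, Fi_indicator hI]
  refine (enorm_integral_le_lintegral_enorm _).trans_eq (lintegral_congr fun ξ => ?_)
  rw [enorm_mul, enorm_ex, one_mul]

theorem plancherel_Aop (hI : MeasurableSet I) (hIb : Bornology.IsBounded I) (hJ : MeasurableSet J)
    (hb : Bornology.IsBounded J) (hF : BS F) :
    ∫⁻ z : ℝ × ℝ, ‖Aop I J F z.1 z.2‖ₑ ^ 2 =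
      ∫⁻ ξ in I, ∫⁻ y, ‖PJ J (fun u => F (ξ, u)) y‖ₑ ^ 2 := by
  obtain ⟨M, hM⟩ := PJ_bound hJ hb hF
  have hm := measurable_PJ hJ hb hF
  have hA : AEMeasurable (fun z : ℝ × ℝ => ‖Aop I J F z.1 z.2‖ₑ ^ 2)
      ((volume : Measure ℝ).prod volume) :=
    ((measurable_Aop hI hJ hb hF).enorm.pow_const 2).aemeasurable
  have hP : AEMeasurable (Function.uncurry fun ξ y => ‖PJ J (fun u => F (ξ, u)) y‖ₑ ^ 2)
      ((volume.restrict I).prod volume) := (hm.enorm.pow_const 2).aemeasurable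
  calc ∫⁻ z : ℝ × ℝ, ‖Aop I J F z.1 z.2‖ₑ ^ 2 = ∫⁻ y, ∫⁻ x, ‖Aop I J F x y‖ₑ ^ 2 :=
        lintegral_prod_symm _ hA
    _ = ∫⁻ y, ∫⁻ ξ in I, ‖PJ J (fun u => F (ξ, u)) y‖ₑ ^ 2 := by
        refine lintegral_congr fun y => ?_
        have hy : Measurable fun ξ => PJ J (fun u => F (ξ, u)) y :=
          Measurable.comp (g := fun p : ℝ × ℝ => PJ J (fun u => F (p.1, u)) p.2)
            (f := fun ξ : ℝ => (ξ, y)) hm measurable_prodMk_right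
        have hb' : ∀ ξ, ‖PJ J (fun u => F (ξ, u)) y‖ ≤ M := fun ξ => hM (ξ, y)
        have := plancherel_indicator hI hIb hy hb'
        unfold Aop
        exact this
    _ = _ := (lintegral_lintegral_swap (μ := volume.restrict I)
        (f := fun ξ y => ‖PJ J (fun u => F (ξ, u)) y‖ₑ ^ 2) hP).symm

end

section
variable {κ : Type*} [Fintype κ] {J : κ → Set ℝ} {I : Set ℝ} {F : ℝ × ℝ → ℂ}

theorem sum_plancherel_Aop_le (hI : MeasurableSet I) (hIb : Bornology.IsBounded I)
    (hJ : ∀ j, MeasurableSet (J j)) (hb : ∀ j, Bornology.IsBounded (J j))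
    (hd : Pairwise fun i j => Disjoint (J i) (J j)) (hF : BS F) :
    ∑ j, ∫⁻ z : ℝ × ℝ, ‖Aop I (J j) F z.1 z.2‖ₑ ^ 2 ≤ ∫⁻ ξ in I, ∫⁻ u, ‖F (ξ, u)‖ₑ ^ 2 := by
  simp_rw [fun j => plancherel_Aop hI hIb (hJ j) (hb j) hF]
  rw [← lintegral_finsetSum]
  · exact lintegral_mono fun ξ => bessel hJ hb hd (hF.section_snd ξ)
  · exact fun j _ => ((measurable_PJ (hJ j) (hb j) hF).enorm.pow_const 2).lintegral_prod_right'

theorem sum_sum_plancherel_Aop_le {ι : Type*} [Fintype ι] {I : ι → Set ℝ}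
    (hI : ∀ i, MeasurableSet (I i)) (hIb : ∀ i, Bornology.IsBounded (I i))
    (hId : Pairwise fun i j => Disjoint (I i) (I j))
    (hJ : ∀ j, MeasurableSet (J j)) (hb : ∀ j, Bornology.IsBounded (J j))
    (hd : Pairwise fun i j => Disjoint (J i) (J j)) (hF : BS F) :
    ∑ i, ∑ j, ∫⁻ z : ℝ × ℝ, ‖Aop (I i) (J j) F z.1 z.2‖ₑ ^ 2 ≤
      ∫⁻ ξ, ∫⁻ u, ‖F (ξ, u)‖ₑ ^ 2 := by
  refine (Finset.sum_le_sum fun i _ => sum_plancherel_Aop_le (hI i) (hIb i) hJ hb hd hF).trans ?_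
  rw [← lintegral_biUnion_finset₀]
  · exact lintegral_mono' Measure.restrict_le_self le_rfl
  · intro i _ j _ hij
    exact (hId hij).aedisjoint
  · exact fun i _ => (hI i).nullMeasurableSet

/-- Majorant of `Aop` that is independent of the outer variable. -/
noncomputable def Maj (I J : Set ℝ) (F : ℝ × ℝ → ℂ) (y : ℝ) : ℝ≥0∞ :=
  ∫⁻ ξ in I, ‖PJ J (fun u => F (ξ, u)) y‖ₑ

theorem measurable_Maj {J : Set ℝ} (hJ : MeasurableSet J) (hb : Bornology.IsBounded J) (hF : BS F) :
    Measurable (Maj I J F) :=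
  Measurable.lintegral_prod_left' (measurable_PJ hJ hb hF).enorm

theorem sum_Maj_sq_le (hJ : ∀ j, MeasurableSet (J j))
    (hb : ∀ j, Bornology.IsBounded (J j)) (hd : Pairwise fun i j => Disjoint (J i) (J j))
    (hF : BS F) {α : ℝ → ℝ} (hα : Measurable α)
    (h : ∀ ξ, ∫⁻ u, ‖F (ξ, u)‖ₑ ^ 2 ≤ EX (2 * α ξ)) :
    ∑ j, ∫⁻ y, Maj I (J j) F y ^ 2 ≤ (∫⁻ ξ in I, EX (α ξ)) ^ 2 := by
  have hm := fun j => measurable_PJ (hJ j) (hb j) hF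
  have h1 : ∀ j y, Maj I (J j) F y ^ 2 ≤ (∫⁻ ξ in I, EX (α ξ)) *
      ∫⁻ ξ in I, EX (- α ξ) * ‖PJ (J j) (fun u => F (ξ, u)) y‖ₑ ^ 2 := fun j y => by
    have := sq_lintegral_mul_le (μ := volume.restrict I) (f := fun ξ => EX (α ξ / 2))
      (g := fun ξ => EX (-(α ξ / 2)) * ‖PJ (J j) (fun u => F (ξ, u)) y‖ₑ)
      (by fun_prop) ((by fun_prop : Measurable fun ξ => EX (-(α ξ / 2))).mul
        ((hm j).comp (by fun_prop : Measurable fun ξ => (ξ, y))).enorm).aemeasurable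
    simp_rw [mul_pow, ← mul_assoc, EX_mul_neg, one_mul, EX_pow] at this
    refine this.trans_eq ?_
    congr 1
    · refine lintegral_congr fun ξ => ?_
      congr 1; push_cast; ring
    · refine lintegral_congr fun ξ => ?_
      congr 2; push_cast; ring
  have hm2 : ∀ j, Measurable fun p : ℝ × ℝ => EX (- α p.1) *
      ‖PJ (J j) (fun u => F (p.1, u)) p.2‖ₑ ^ 2 := fun j =>
    (by fun_prop : Measurable fun p : ℝ × ℝ => EX (- α p.1)).mul ((hm j).enorm.pow_const 2)
  calc _ ≤ ∑ j, (∫⁻ ξ in I, EX (α ξ)) * ∫⁻ ξ in I, ∫⁻ y, EX (- α ξ) *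
        ‖PJ (J j) (fun u => F (ξ, u)) y‖ₑ ^ 2 := by
        refine Finset.sum_le_sum fun j _ => (lintegral_mono (h1 j)).trans_eq ?_
        rw [lintegral_const_mul _ (hm2 j).lintegral_prod_left', lintegral_lintegral_swap]
        exact ((hm2 j).comp measurable_swap).aemeasurable
    _ = (∫⁻ ξ in I, EX (α ξ)) * ∫⁻ ξ in I, EX (- α ξ) * ∑ j, ∫⁻ y,
        ‖PJ (J j) (fun u => F (ξ, u)) y‖ₑ ^ 2 := by
        rw [← Finset.mul_sum, ← lintegral_finsetSum]
        · congr 1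
          refine lintegral_congr fun ξ => ?_
          rw [Finset.mul_sum]
          refine Finset.sum_congr rfl fun j _ => ?_
          rw [lintegral_const_mul' _ _ (EX_ne_top _)]
        · exact fun j _ => (hm2 j).lintegral_prod_right'
    _ ≤ (∫⁻ ξ in I, EX (α ξ)) * ∫⁻ ξ in I, EX (- α ξ) * EX (2 * α ξ) := by
        gcongr with ξ
        exact (bessel hJ hb hd (hF.section_snd ξ)).trans (h ξ)
    _ = _ := by
        rw [sq]; congr 1
        refine lintegral_congr fun ξ => ?_
        rw [← EX_add]; congr 1; ring
end

/-- A finite system of pairs of intervals, with disjoint left intervals, disjoint right intervals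
and disjoint sumsets. -/
structure Sys {ι : Type*} (Il Ir : ι → Set ℝ) : Prop where
  cl : ∀ i, (Il i).OrdConnected
  cr : ∀ i, (Ir i).OrdConnected
  bl : ∀ i, Bornology.IsBounded (Il i)
  br : ∀ i, Bornology.IsBounded (Ir i)
  dl : Pairwise fun i j => Disjoint (Il i) (Il j)
  dr : Pairwise fun i j => Disjoint (Ir i) (Ir j)
  ds : Pairwise fun i j => ∀ a ∈ Il i, ∀ b ∈ Ir i, ∀ c ∈ Il j, ∀ d ∈ Ir j, a + b ≠ c + d

namespace Sys
variable {ι : Type*} {Il Ir : ι → Set ℝ}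

theorem ml (h : Sys Il Ir) (i : ι) : MeasurableSet (Il i) := (h.cl i).measurableSet
theorem mr (h : Sys Il Ir) (i : ι) : MeasurableSet (Ir i) := (h.cr i).measurableSet

theorem symm (h : Sys Il Ir) : Sys Ir Il where
  cl := h.cr
  cr := h.cl
  bl := h.br
  br := h.bl
  dl := h.dr
  dr := h.dl
  ds := fun i j hij a ha b hb c hc d hd => by
    rw [add_comm a, add_comm c]; exact h.ds hij b hb a ha d hd c hc

end Sys

theorem sum_sq_le_of_sum_le_one {ι : Type*} [Fintype ι] {x : ι → ℝ≥0∞} {t : ℝ≥0∞}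
    (hx : ∀ i, x i ≤ t) (hx1 : ∑ i, x i ≤ 1) : ∑ i, x i ^ 2 ≤ t :=
  calc ∑ i, x i ^ 2 ≤ ∑ i, t * x i := by
        refine Finset.sum_le_sum fun i _ => ?_
        rw [sq]; gcongr; exact hx i
    _ = t * ∑ i, x i := by rw [Finset.mul_sum]
    _ ≤ t * 1 := by gcongr
    _ = t := mul_one t

section
variable {ι κ : Type*} [Fintype ι] [Fintype κ] {Il Ir : ι → Set ℝ} {Jl Jr : κ → Set ℝ}
  {F₁ F₂ : ℝ × ℝ → ℂ}

/-- The two-parameter model operator. -/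
noncomputable def bil (Il Ir : ι → Set ℝ) (Jl Jr : κ → Set ℝ) (F₁ F₂ : ℝ × ℝ → ℂ)
    (z : ℝ × ℝ) : ℂ :=
  ∑ i, ∑ j, Aop (Il i) (Jl j) F₁ z.1 z.2 * Aop (Jr j) (Ir i) F₂ z.2 z.1

theorem bil_swap (z : ℝ × ℝ) : bil Jr Jl Ir Il F₂ F₁ z.swap = bil Il Ir Jl Jr F₁ F₂ z := by
  simp only [bil, Prod.fst_swap, Prod.snd_swap]
  rw [Finset.sum_comm]
  simp only [mul_comm]

theorem lintegral_bil_swap (H : ℝ × ℝ → ℝ≥0∞) :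
    ∫⁻ z, H z.swap * ‖bil Jr Jl Ir Il F₂ F₁ z‖ₑ = ∫⁻ z, H z * ‖bil Il Ir Jl Jr F₁ F₂ z‖ₑ := by
  have := (Measure.measurePreserving_swap (μ := (volume : Measure ℝ))
    (ν := (volume : Measure ℝ))).lintegral_comp_emb MeasurableEquiv.prodComm.measurableEmbedding
    (fun z => H z.swap * ‖bil Jr Jl Ir Il F₂ F₁ z‖ₑ)
  simp only [Prod.swap_swap, bil_swap] at this
  exact this.symm

theorem measurable_Aop_swap {I J : Set ℝ} {F : ℝ × ℝ → ℂ} (hI : MeasurableSet I)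
    (hJ : MeasurableSet J) (hb : Bornology.IsBounded J) (hF : BS F) :
    Measurable fun z : ℝ × ℝ => Aop I J F z.2 z.1 :=
  Measurable.comp (g := fun z : ℝ × ℝ => Aop I J F z.1 z.2) (f := fun z : ℝ × ℝ => z.swap)
    (measurable_Aop hI hJ hb hF) measurable_swap

theorem measurable_bil (hI : Sys Il Ir) (hJ : Sys Jl Jr) (h₁ : BS F₁) (h₂ : BS F₂) :
    Measurable (bil Il Ir Jl Jr F₁ F₂) :=
  Finset.measurable_fun_sum _ fun i _ => Finset.measurable_fun_sum _ fun j _ =>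
    (measurable_Aop (hI.ml i) (hJ.ml j) (hJ.bl j) h₁).mul
      (measurable_Aop_swap (hJ.mr j) (hI.mr i) (hI.br i) h₂)

theorem sq_lintegral_bil_le (hI : Sys Il Ir) (hJ : Sys Jl Jr) (h₁ : BS F₁) (h₂ : BS F₂)
    {H : ℝ × ℝ → ℝ≥0∞} (hH : Measurable H) {X Y : ι → κ → ℝ≥0∞} {a b : ℝ≥0∞}
    (h : ∀ i j, (∫⁻ z, H z * (‖Aop (Il i) (Jl j) F₁ z.1 z.2‖ₑ *
      ‖Aop (Jr j) (Ir i) F₂ z.2 z.1‖ₑ)) ^ 2 ≤ X i j * Y i j)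
    (hX : ∑ i, ∑ j, X i j ≤ a) (hY : ∑ i, ∑ j, Y i j ≤ b) :
    (∫⁻ z, H z * ‖bil Il Ir Jl Jr F₁ F₂ z‖ₑ) ^ 2 ≤ a * b := by
  have hm : ∀ i j, Measurable fun z : ℝ × ℝ => H z * (‖Aop (Il i) (Jl j) F₁ z.1 z.2‖ₑ *
      ‖Aop (Jr j) (Ir i) F₂ z.2 z.1‖ₑ) := fun i j =>
    hH.mul ((measurable_Aop (hI.ml i) (hJ.ml j) (hJ.bl j) h₁).enorm.mul
      (measurable_Aop_swap (hJ.mr j) (hI.mr i) (hI.br i) h₂).enorm)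
  have e : ∫⁻ z, H z * ‖bil Il Ir Jl Jr F₁ F₂ z‖ₑ ≤ ∑ p : ι × κ, ∫⁻ z, H z *
      (‖Aop (Il p.1) (Jl p.2) F₁ z.1 z.2‖ₑ * ‖Aop (Jr p.2) (Ir p.1) F₂ z.2 z.1‖ₑ) := by
    rw [← lintegral_finsetSum _ fun p _ => hm p.1 p.2]
    refine lintegral_mono fun z => ?_
    rw [← Finset.mul_sum, Fintype.sum_prod_type, bil]
    gcongr
    refine (enorm_sum_le _ _).trans (Finset.sum_le_sum fun i _ => (enorm_sum_le _ _).trans ?_)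
    simp [enorm_mul]
  refine (pow_le_pow_left' e 2).trans ((sq_sum_le_of_sq_le Finset.univ (X := fun p => X p.1 p.2)
    (Y := fun p => Y p.1 p.2) fun p _ => h p.1 p.2).trans ?_)
  rw [Fintype.sum_prod_type, Fintype.sum_prod_type]
  exact mul_le_mul' hX hY

/-- The bound with all the weights on the outer variables. -/
theorem lintegral_bil_le_outer (hI : Sys Il Ir) (hJ : Sys Jl Jr) (h₁ : BS F₁) (h₂ : BS F₂)
    {H : ℝ × ℝ → ℝ≥0∞} (hH : Measurable H) (hH2 : ∫⁻ z, H z ^ 2 ≤ 1) {α β : ℝ → ℝ}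
    (hα : Measurable α) (hβ : Measurable β)
    (hF₁ : ∀ ξ, ∫⁻ u, ‖F₁ (ξ, u)‖ₑ ^ 2 ≤ EX (2 * α ξ))
    (hF₂ : ∀ ξ, ∫⁻ u, ‖F₂ (ξ, u)‖ₑ ^ 2 ≤ EX (2 * β ξ))
    {μ ν : ℝ≥0∞} (hμ : ∀ i, ∫⁻ ξ in Il i, EX (α ξ) ≤ μ) (hν : ∀ j, ∫⁻ ξ in Jr j, EX (β ξ) ≤ ν)
    (hμ1 : ∑ i, ∫⁻ ξ in Il i, EX (α ξ) ≤ 1) (hν1 : ∑ j, ∫⁻ ξ in Jr j, EX (β ξ) ≤ 1) :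
    (∫⁻ z, H z * ‖bil Il Ir Jl Jr F₁ F₂ z‖ₑ) ^ 2 ≤ μ * ν := by
  refine sq_lintegral_bil_le hI hJ h₁ h₂ hH (X := fun i j => ∫⁻ y, Maj (Il i) (Jl j) F₁ y ^ 2)
    (Y := fun i j => ∫⁻ y, Maj (Jr j) (Ir i) F₂ y ^ 2) (fun i j => ?_) ?_ ?_
  · have m₁ := measurable_Maj (I := Il i) (hJ.ml j) (hJ.bl j) h₁
    have m₂ := measurable_Maj (I := Jr j) (hI.mr i) (hI.br i) h₂
    calc _ ≤ (∫⁻ z : ℝ × ℝ, H z * (Maj (Jr j) (Ir i) F₂ z.1 * Maj (Il i) (Jl j) F₁ z.2)) ^ 2 := by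
          refine pow_le_pow_left' (lintegral_mono fun z => mul_le_mul' le_rfl ?_) 2
          rw [mul_comm]
          exact mul_le_mul' (enorm_Aop_le (hJ.mr j) _ _) (enorm_Aop_le (hI.ml i) _ _)
      _ ≤ (∫⁻ z, H z ^ 2) *
          ∫⁻ z : ℝ × ℝ, (Maj (Jr j) (Ir i) F₂ z.1 * Maj (Il i) (Jl j) F₁ z.2) ^ 2 :=
        sq_lintegral_mul_le hH.aemeasurable
          ((m₂.comp measurable_fst).mul (m₁.comp measurable_snd)).aemeasurable
      _ ≤ 1 * ((∫⁻ y, Maj (Jr j) (Ir i) F₂ y ^ 2) * ∫⁻ y, Maj (Il i) (Jl j) F₁ y ^ 2) := by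
          gcongr
          rw [← lintegral_prod_mul (m₂.pow_const 2).aemeasurable (m₁.pow_const 2).aemeasurable]
          simp only [mul_pow, ← Measure.volume_eq_prod]; exact le_rfl
      _ = _ := by rw [one_mul, mul_comm]
  · exact (Finset.sum_le_sum fun i _ => sum_Maj_sq_le hJ.ml hJ.bl hJ.dl h₁ hα hF₁).trans
      (sum_sq_le_of_sum_le_one hμ hμ1)
  · rw [Finset.sum_comm]
    exact (Finset.sum_le_sum fun j _ => sum_Maj_sq_le hI.mr hI.br hI.dr h₂ hβ hF₂).trans
      (sum_sq_le_of_sum_le_one hν hν1)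

theorem lintegral_bil_le_sq (hI : Sys Il Ir) (hJ : Sys Jl Jr) (h₁ : BS F₁) (h₂ : BS F₂)
    {H : ℝ × ℝ → ℝ≥0∞} (hH : Measurable H) (hH1 : ∀ z, H z ≤ 1)
    (hF₁ : ∫⁻ ξ, ∫⁻ u, ‖F₁ (ξ, u)‖ₑ ^ 2 ≤ 1) (hF₂ : ∫⁻ ξ, ∫⁻ u, ‖F₂ (ξ, u)‖ₑ ^ 2 ≤ 1) :
    (∫⁻ z, H z * ‖bil Il Ir Jl Jr F₁ F₂ z‖ₑ) ^ 2 ≤ 1 := by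
  rw [← one_mul (1 : ℝ≥0∞)]
  refine sq_lintegral_bil_le hI hJ h₁ h₂ hH
    (X := fun i j => ∫⁻ z : ℝ × ℝ, ‖Aop (Il i) (Jl j) F₁ z.1 z.2‖ₑ ^ 2)
    (Y := fun i j => ∫⁻ z : ℝ × ℝ, ‖Aop (Jr j) (Ir i) F₂ z.2 z.1‖ₑ ^ 2) (fun i j => ?_) ?_ ?_
  · have m₁ := measurable_Aop (hI.ml i) (hJ.ml j) (hJ.bl j) h₁
    have m₂ := measurable_Aop_swap (hJ.mr j) (hI.mr i) (hI.br i) h₂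
    refine (pow_le_pow_left' (lintegral_mono fun z => ?_) 2).trans
      (sq_lintegral_mul_le m₁.enorm.aemeasurable m₂.enorm.aemeasurable)
    exact (mul_le_mul' (hH1 z) le_rfl).trans_eq (one_mul _)
  · exact (sum_sum_plancherel_Aop_le hI.ml hI.bl hI.dl hJ.ml hJ.bl hJ.dl h₁).trans hF₁
  · rw [Finset.sum_comm]
    refine le_trans (le_of_eq ?_)
      ((sum_sum_plancherel_Aop_le hJ.mr hJ.br hJ.dr hI.mr hI.br hI.dr h₂).trans hF₂)
    refine Finset.sum_congr rfl fun j _ => Finset.sum_congr rfl fun i _ => ?_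
    exact (Measure.measurePreserving_swap (μ := (volume : Measure ℝ))
      (ν := (volume : Measure ℝ))).lintegral_comp_emb MeasurableEquiv.prodComm.measurableEmbedding
      (fun z => ‖Aop (Jr j) (Ir i) F₂ z.1 z.2‖ₑ ^ 2)

theorem lintegral_bil_le_mixed (hI : Sys Il Ir) (hJ : Sys Jl Jr) (h₁ : BS F₁) (h₂ : BS F₂)
    {H : ℝ × ℝ → ℝ≥0∞} (hH : Measurable H) (hH2 : ∀ x, ∫⁻ y, H (x, y) ^ 2 ≤ 1) {β : ℝ → ℝ}
    (hβ : Measurable β) (hF₁ : ∫⁻ ξ, ∫⁻ u, ‖F₁ (ξ, u)‖ₑ ^ 2 ≤ 1)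
    (hF₂ : ∀ ξ, ∫⁻ u, ‖F₂ (ξ, u)‖ₑ ^ 2 ≤ EX (2 * β ξ))
    (hν1 : ∑ j, ∫⁻ ξ in Jr j, EX (β ξ) ≤ 1) :
    (∫⁻ z, H z * ‖bil Il Ir Jl Jr F₁ F₂ z‖ₑ) ^ 2 ≤ 1 := by
  rw [← one_mul (1 : ℝ≥0∞)]
  refine sq_lintegral_bil_le hI hJ h₁ h₂ hH
    (X := fun i j => ∫⁻ z : ℝ × ℝ, ‖Aop (Il i) (Jl j) F₁ z.1 z.2‖ₑ ^ 2)
    (Y := fun i j => ∫⁻ y, Maj (Jr j) (Ir i) F₂ y ^ 2) (fun i j => ?_) ?_ ?_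
  · have m₁ := measurable_Aop (hI.ml i) (hJ.ml j) (hJ.bl j) h₁
    have m₂ := measurable_Maj (I := Jr j) (hI.mr i) (hI.br i) h₂
    have m : Measurable fun z : ℝ × ℝ => H z * Maj (Jr j) (Ir i) F₂ z.1 :=
      hH.mul (m₂.comp measurable_fst)
    calc _ ≤ (∫⁻ z : ℝ × ℝ, ‖Aop (Il i) (Jl j) F₁ z.1 z.2‖ₑ *
          (H z * Maj (Jr j) (Ir i) F₂ z.1)) ^ 2 := by
          refine pow_le_pow_left' (lintegral_mono fun z => ?_) 2
          rw [mul_left_comm]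
          refine mul_le_mul' le_rfl (mul_le_mul' le_rfl ?_)
          exact enorm_Aop_le (hJ.mr j) _ _
      _ ≤ (∫⁻ z : ℝ × ℝ, ‖Aop (Il i) (Jl j) F₁ z.1 z.2‖ₑ ^ 2) *
          ∫⁻ z : ℝ × ℝ, (H z * Maj (Jr j) (Ir i) F₂ z.1) ^ 2 :=
        sq_lintegral_mul_le m₁.enorm.aemeasurable m.aemeasurable
      _ ≤ _ := by
          gcongr
          rw [Measure.volume_eq_prod, lintegral_prod _ (m.pow_const 2).aemeasurable]
          refine lintegral_mono fun x => ?_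
          simp only [mul_pow]
          have hx : Measurable fun y => H (x, y) ^ 2 := (hH.comp measurable_prodMk_left).pow_const 2
          rw [lintegral_mul_const _ hx]
          exact (mul_le_mul' (hH2 x) le_rfl).trans_eq (one_mul _)
  · exact (sum_sum_plancherel_Aop_le hI.ml hI.bl hI.dl hJ.ml hJ.bl hJ.dl h₁).trans hF₁
  · rw [Finset.sum_comm]
    refine (Finset.sum_le_sum fun j _ => sum_Maj_sq_le hI.mr hI.br hI.dr h₂ hβ hF₂).trans ?_
    refine le_trans (Finset.sum_le_sum fun j _ => ?_) hν1
    rw [sq]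
    exact (mul_le_mul' ((Finset.single_le_sum (f := fun j => ∫⁻ ξ in Jr j, EX (β ξ))
      (fun _ _ => zero_le) (Finset.mem_univ j)).trans hν1) le_rfl).trans_eq (one_mul _)

end

theorem enorm_sum_sq_of_orthogonal {ι : Type*} [Fintype ι] {c : ι → ℂ}
    (h : Pairwise fun i j => c i = 0 ∨ c j = 0) : ‖∑ i, c i‖ₑ ^ 2 = ∑ i, ‖c i‖ₑ ^ 2 := by
  by_cases h0 : ∀ i, c i = 0
  · simp [h0]
  · push Not at h0
    obtain ⟨i, hi⟩ := h0
    have hj : ∀ j, j ≠ i → c j = 0 := fun j hj => (h hj).resolve_right hi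
    rw [Finset.sum_eq_single i (fun j _ => hj j) (by simp),
      Finset.sum_eq_single i (fun j _ hji => by simp [hj j hji]) (by simp)]

theorem lintegral_sum_Fi_mul_Fi_sq {ι : Type*} [Fintype ι] {Il Ir : ι → Set ℝ}
    (hs : Pairwise fun i j => ∀ a ∈ Il i, ∀ b ∈ Ir i, ∀ c ∈ Il j, ∀ d ∈ Ir j, a + b ≠ c + d)
    {u v : ι → ℝ → ℂ} (hu : ∀ i, BS (u i)) (hv : ∀ i, BS (v i))
    (hu0 : ∀ i, ∀ x ∉ Il i, u i x = 0) (hv0 : ∀ i, ∀ x ∉ Ir i, v i x = 0) :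
    ∫⁻ x, ‖∑ i, Fi (u i) x * Fi (v i) x‖ₑ ^ 2 = ∑ i, ∫⁻ x, ‖Fi (u i) x * Fi (v i) x‖ₑ ^ 2 := by
  have hc := fun i => (hu i).cv (hv i)
  simp only [fun i x => (Fi_cv (hu i) (hv i) x).symm]
  rw [Finset.sum_congr rfl fun i _ => plancherel (hc i)]
  rw [← lintegral_finsetSum _ fun i _ => (hc i).1.enorm.pow_const 2]
  have e : ∀ x, ∑ i, Fi (cv (u i) (v i)) x = Fi (fun ξ => ∑ i, cv (u i) (v i) ξ) x := fun x =>
    (Fi_sum Finset.univ (fun i _ => hc i) x).symm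
  simp_rw [e]
  rw [plancherel (BS.sum fun i _ => hc i)]
  refine lintegral_congr fun ξ => enorm_sum_sq_of_orthogonal fun i j hij => ?_
  by_contra! h
  have h1 : ∃ a ∈ Il i, ∃ b ∈ Ir i, a + b = ξ := by
    by_contra! h'; exact h.1 (cv_support (hu0 i) (hv0 i) h')
  have h2 : ∃ a ∈ Il j, ∃ b ∈ Ir j, a + b = ξ := by
    by_contra! h'; exact h.2 (cv_support (hu0 j) (hv0 j) h')
  obtain ⟨a, ha, b, hb, hab⟩ := h1
  obtain ⟨c, hc, d, hd, hcd⟩ := h2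
  exact hs hij a ha b hb c hc d hd (hab.trans hcd.symm)

theorem lintegral_PJ_sq_le {J : Set ℝ} (hJ : MeasurableSet J) (hb : Bornology.IsBounded J)
    {g : ℝ → ℂ} (hg : BS g) : ∫⁻ z, ‖PJ J g z‖ₑ ^ 2 ≤ ∫⁻ u, ‖g u‖ₑ ^ 2 := by
  rw [plancherel_PJ hJ hb hg, ← plancherel_neg hg]
  exact setLIntegral_le_lintegral _ _

/-- `C` bounds the `2k`-th power of the norm of all frequency projections on `L^{2k}`. -/
def RieszBd (k : ℕ) (C : ℝ≥0∞) : Prop := ∀ g : ℝ → ℂ, BS g →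
  ∀ J : Set ℝ, Bornology.IsBounded J → J.OrdConnected →
    ∫⁻ x, ‖PJ J g x‖ₑ ^ (2 * k) ≤ C * ∫⁻ x, ‖g x‖ₑ ^ (2 * k)

theorem lintegral_Aop_mul_sq_le {k : ℕ} {θ : ℝ} (hk : θ * k = 1)
    (hθ : θ ∈ Icc (0 : ℝ) 1) {C : ℝ≥0∞} (hC : RieszBd k C) (hC1 : 1 ≤ C)
    (hCt : C ≠ ⊤) {I J K : Set ℝ} (hI : MeasurableSet I) (hIb : Bornology.IsBounded I)
    (hJ : MeasurableSet J) (hJb : Bornology.IsBounded J) (hK : K.OrdConnected)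
    (hKb : Bornology.IsBounded K) {F : ℝ × ℝ → ℂ} (hF : BS F) {g : ℝ → ℂ} (hg : BS g)
    {α : ℝ → ℝ} (hα : Measurable α) {B : ℝ} (hαB : ∀ x, |α x| ≤ B) {b : ℝ}
    (hF2 : ∀ ξ, ∫⁻ u, ‖F (ξ, u)‖ₑ ^ 2 ≤ EX ((1 + θ) * α ξ))
    (hg2 : ∫⁻ u, ‖g u‖ₑ ^ (2 * k) ≤ EX (2 * k * b)) :
    ∫⁻ z : ℝ × ℝ, ‖Aop I J F z.1 z.2‖ₑ ^ 2 * ‖PJ K g z.1‖ₑ ^ 2 ≤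
      2 * (∫⁻ ξ in I, EX (α ξ)) ^ (1 + θ) * (C ^ θ * EX (2 * b)) := by
  have hθ0 := hθ.1
  have hCr : 0 < C.toReal := ENNReal.toReal_pos (by positivity) hCt
  obtain ⟨M, hM⟩ := PJ_bound hJ hJb hF
  obtain ⟨D, hD⟩ : ∃ D, ∀ x, ‖PJ K g x‖ ≤ D :=
    ⟨_, norm_Fi_le _⟩
  have hpm : Measurable (PJ K g) := (PJ_continuous hK.measurableSet hKb hg).measurable
  set c : ℝ := C.toReal * Real.exp (2 * k * b) with hc
  have hc0 : 0 < c := by positivity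
  have hce : ENNReal.ofReal c = C * EX (2 * k * b) := by
    rw [hc, ENNReal.ofReal_mul hCr.le, ENNReal.ofReal_toReal hCt]; rfl
  have hnorm : ∀ x, ENNReal.ofReal (‖PJ K g x‖ ^ (2 * k) / c) =
      ‖PJ K g x‖ₑ ^ (2 * k) / (C * EX (2 * k * b)) := fun x => by
    rw [ENNReal.ofReal_div_of_pos hc0, hce, ENNReal.ofReal_pow (norm_nonneg _), ofReal_norm]
  have hX0 : C * EX (2 * k * b) ≠ 0 := mul_ne_zero (by positivity) (EX_ne_zero _)
  have hXt : C * EX (2 * k * b) ≠ ⊤ := ENNReal.mul_ne_top hCt (EX_ne_top _)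
  have h := weighted_hausdorff_young (θ := θ) (I := I)
    hθ hI hIb hα
    (ρ := fun x => ‖PJ K g x‖ ^ (2 * k) / c) ((hpm.norm.pow_const _).div_const _) hαB
    (fun x => by positivity) (D := D ^ (2 * k) / c)
    (fun x => by gcongr; exact hD x) ?_ (measurable_PJ hJ hJb hF) hM ?_
  · have e : ∀ x, ENNReal.ofReal (‖PJ K g x‖ ^ (2 * k) / c) ^ θ =
        ‖PJ K g x‖ₑ ^ 2 / (C ^ θ * EX (2 * b)) := fun x => by
      rw [hnorm, ENNReal.div_rpow_of_nonneg _ _ (by positivity), ← ENNReal.rpow_natCast,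
        ← ENNReal.rpow_mul, ENNReal.mul_rpow_of_nonneg _ _ (by positivity), EX_rpow,
        ← ENNReal.rpow_natCast]
      have h1 : ((2 * k : ℕ) : ℝ) * θ = (2 : ℕ) := by push_cast; linear_combination 2 * hk
      have h2 : 2 * k * b * θ = 2 * b := by linear_combination 2 * b * hk
      rw [h1, h2]
    have hY0 : C ^ θ * EX (2 * b) ≠ 0 :=
      mul_ne_zero (ENNReal.rpow_pos (by positivity) hCt).ne' (EX_ne_zero _)
    have hYt : C ^ θ * EX (2 * b) ≠ ⊤ :=
      ENNReal.mul_ne_top (ENNReal.rpow_ne_top_of_nonneg (by positivity) hCt) (EX_ne_top _)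
    simp_rw [e, ← mul_div_assoc] at h
    simp only [div_eq_mul_inv] at h
    rw [lintegral_mul_const' _ _ (ENNReal.inv_ne_top.2 hY0), ← div_eq_mul_inv,
      ENNReal.div_le_iff hY0 hYt] at h
    exact h
  · simp_rw [hnorm, div_eq_mul_inv]
    rw [lintegral_mul_const' _ _ (ENNReal.inv_ne_top.2 hX0), ← div_eq_mul_inv,
      ENNReal.div_le_iff hX0 hXt, one_mul]
    exact (hC g hg K hKb hK).trans (by gcongr)
  · intro ξ
    exact (lintegral_PJ_sq_le hJ hJb (hF.section_snd ξ)).trans (hF2 ξ)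

section
variable {ι κ : Type*} [Fintype ι] [Fintype κ] {Il Ir : ι → Set ℝ} {Jl Jr : κ → Set ℝ}
  {F₁ F₂ : ℝ × ℝ → ℂ}

theorem lintegral_sum_Aop_mul_PJ_sq_le {k : ℕ} {θ : ℝ} (hk : θ * k = 1) (hθ : θ ∈ Icc (0 : ℝ) 1)
    {C : ℝ≥0∞} (hC : RieszBd k C) (hC1 : 1 ≤ C) (hCt : C ≠ ⊤) (hI : Sys Il Ir) {J : Set ℝ}
    (hJ : MeasurableSet J) (hJb : Bornology.IsBounded J) {F : ℝ × ℝ → ℂ} (hF : BS F)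
    {g : ℝ → ℂ} (hg : BS g)
    {α : ℝ → ℝ} (hα : Measurable α) {B : ℝ} (hαB : ∀ x, |α x| ≤ B) {b : ℝ}
    (hF2 : ∀ ξ, ∫⁻ u, ‖F (ξ, u)‖ₑ ^ 2 ≤ EX ((1 + θ) * α ξ))
    (hg2 : ∫⁻ u, ‖g u‖ₑ ^ (2 * k) ≤ EX (2 * k * b))
    (hμ : ∑ i, ∫⁻ ξ in Il i, EX (α ξ) ≤ 1) :
    ∫⁻ z : ℝ × ℝ, ‖∑ i, Aop (Il i) J F z.1 z.2 * PJ (Ir i) g z.1‖ₑ ^ 2 ≤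
      2 * (C ^ θ * EX (2 * b)) := by
  obtain ⟨M, hM⟩ := PJ_bound hJ hJb hF
  have hm := measurable_PJ hJ hJb hF
  have hA : ∀ i, Measurable fun z : ℝ × ℝ => Aop (Il i) J F z.1 z.2 * PJ (Ir i) g z.1 := fun i =>
    (measurable_Aop (hI.ml i) hJ hJb hF).mul
      ((PJ_continuous (hI.mr i) (hI.br i) hg).measurable.comp measurable_fst)
  have hS : Measurable fun z : ℝ × ℝ => ∑ i, Aop (Il i) J F z.1 z.2 * PJ (Ir i) g z.1 :=
    Finset.measurable_fun_sum _ fun i _ => hA i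
  calc _ = ∫⁻ y, ∫⁻ x, ‖∑ i, Aop (Il i) J F x y * PJ (Ir i) g x‖ₑ ^ 2 :=
        lintegral_prod_symm (μ := (volume : Measure ℝ)) (ν := (volume : Measure ℝ)) _
          (hS.enorm.pow_const 2).aemeasurable
    _ = ∫⁻ y, ∑ i, ∫⁻ x, ‖Aop (Il i) J F x y * PJ (Ir i) g x‖ₑ ^ 2 := by
        refine lintegral_congr fun y => ?_
        have hy : Measurable fun ξ => PJ J (fun u => F (ξ, u)) y :=
          Measurable.comp (g := fun p : ℝ × ℝ => PJ J (fun u => F (p.1, u)) p.2)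
            (f := fun ξ : ℝ => (ξ, y)) hm measurable_prodMk_right
        have hb' : ∀ ξ, ‖PJ J (fun u => F (ξ, u)) y‖ ≤ M := fun ξ => hM (ξ, y)
        unfold Aop PJ Mu
        refine lintegral_sum_Fi_mul_Fi_sq hI.ds
          (fun i => BS.indicator_of_bdd (hI.ml i) (hI.bl i) hy hb')
          (fun i => (BS.indicator_one (hI.mr i) (hI.br i)).mul_Fi hg)
          (fun i x hx => indicator_of_notMem hx _)
          (fun i x hx => by rw [indicator_of_notMem hx, zero_mul])
    _ = ∑ i, ∫⁻ y, ∫⁻ x, ‖Aop (Il i) J F x y * PJ (Ir i) g x‖ₑ ^ 2 := by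
        rw [lintegral_finsetSum _ fun i _ => ?_]
        exact ((hA i).enorm.pow_const 2).lintegral_prod_left'
    _ = ∑ i, ∫⁻ z : ℝ × ℝ, ‖Aop (Il i) J F z.1 z.2 * PJ (Ir i) g z.1‖ₑ ^ 2 :=
        Finset.sum_congr rfl fun i _ => (lintegral_prod_symm (μ := (volume : Measure ℝ))
          (ν := (volume : Measure ℝ)) _ ((hA i).enorm.pow_const 2).aemeasurable).symm
    _ ≤ ∑ i, 2 * (∫⁻ ξ in Il i, EX (α ξ)) ^ (1 + θ) * (C ^ θ * EX (2 * b)) := by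
        refine Finset.sum_le_sum fun i _ => ?_
        simp only [enorm_mul, mul_pow]
        exact lintegral_Aop_mul_sq_le hk hθ hC hC1 hCt (hI.ml i) (hI.bl i) hJ hJb (hI.cr i)
          (hI.br i) hF hg hα hαB hF2 hg2
    _ ≤ ∑ i, 2 * (∫⁻ ξ in Il i, EX (α ξ)) * (C ^ θ * EX (2 * b)) := by
        refine Finset.sum_le_sum fun i _ => ?_
        gcongr
        have h1 : ∫⁻ ξ in Il i, EX (α ξ) ≤ 1 := (Finset.single_le_sum
          (f := fun j => ∫⁻ ξ in Il j, EX (α ξ)) (fun _ _ => zero_le) (Finset.mem_univ i)).trans hμ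
        exact (ENNReal.rpow_le_rpow_of_exponent_ge h1 (by linarith [hθ.1])).trans_eq
          (ENNReal.rpow_one _)
    _ = 2 * (∑ i, ∫⁻ ξ in Il i, EX (α ξ)) * (C ^ θ * EX (2 * b)) := by
        rw [Finset.mul_sum, Finset.sum_mul]
    _ ≤ 2 * 1 * (C ^ θ * EX (2 * b)) := by gcongr
    _ = _ := by rw [mul_one]


theorem sq_lintegral_le_weighted {X : Type*} [MeasurableSpace X] {μ : Measure X} {α : X → ℝ}
    {f : X → ℝ≥0∞} (hα : Measurable α) (hf : AEMeasurable f μ) :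
    (∫⁻ x, f x ∂μ) ^ 2 ≤ (∫⁻ x, EX (α x) ∂μ) * ∫⁻ x, EX (- α x) * f x ^ 2 ∂μ := by
  have := sq_lintegral_mul_le (μ := μ) (f := fun ξ => EX (α ξ / 2))
    (g := fun ξ => EX (-(α ξ / 2)) * f ξ)
    (by fun_prop) ((by fun_prop : Measurable fun ξ => EX (-(α ξ / 2))).aemeasurable.mul hf)
  simp_rw [mul_pow, ← mul_assoc, EX_mul_neg, one_mul, EX_pow] at this
  refine this.trans_eq ?_
  congr 1
  · refine lintegral_congr fun ξ => ?_
    congr 1; push_cast; ring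
  · refine lintegral_congr fun ξ => ?_
    congr 2; push_cast; ring

theorem enorm_sum_mul_Aop_le {I : Set ℝ} (hI : MeasurableSet I) (hIb : Bornology.IsBounded I)
    {J : ι → Set ℝ} (hJ : ∀ i, MeasurableSet (J i)) (hJb : ∀ i, Bornology.IsBounded (J i))
    {F : ℝ × ℝ → ℂ} (hF : BS F) (c : ι → ℂ) (x y : ℝ) :
    ‖∑ i, c i * Aop I (J i) F x y‖ₑ ≤ ∫⁻ ξ in I, ‖∑ i, c i * PJ (J i) (fun u => F (ξ, u)) y‖ₑ := by
  have e : ∑ i, c i * Aop I (J i) F x y =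
      ∫ ξ in I, ex (ξ * x) * ∑ i, c i * PJ (J i) (fun u => F (ξ, u)) y := by
    simp only [Aop, Fi_indicator hI, Finset.mul_sum]
    rw [integral_finsetSum]
    · refine Finset.sum_congr rfl fun i _ => ?_
      rw [← integral_const_mul]
      congr 1; ext ξ; ring
    · intro i _
      obtain ⟨M, hM⟩ := PJ_bound (hJ i) (hJb i) hF
      have hm : Measurable fun ξ => PJ (J i) (fun u => F (ξ, u)) y :=
        Measurable.comp (g := fun p : ℝ × ℝ => PJ (J i) (fun u => F (p.1, u)) p.2)
          (f := fun ξ : ℝ => (ξ, y)) (measurable_PJ (hJ i) (hJb i) hF) measurable_prodMk_right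
      refine Measure.integrableOn_of_bounded (M := ‖c i‖ * M) hIb.measure_lt_top.ne
        (by fun_prop) (Eventually.of_forall fun ξ => ?_)
      rw [norm_mul, norm_mul, norm_ex, one_mul]
      gcongr
      exact hM (ξ, y)
  rw [e]
  refine (enorm_integral_le_lintegral_enorm _).trans_eq (lintegral_congr fun ξ => ?_)
  rw [enorm_mul, enorm_ex, one_mul]

/-- The bound near the corner with one square-integrable function and one high exponent. -/
theorem lintegral_bil_le_half {k : ℕ} {θ : ℝ} (hk : θ * k = 1) (hθ : θ ∈ Icc (0 : ℝ) 1)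
    {C : ℝ≥0∞} (hC : RieszBd k C) (hC1 : 1 ≤ C) (hCt : C ≠ ⊤) (hI : Sys Il Ir) (hJ : Sys Jl Jr)
    (h₁ : BS F₁) (h₂ : BS F₂) {H : ℝ × ℝ → ℝ≥0∞} (hH : Measurable H) (hH2 : ∫⁻ z, H z ^ 2 ≤ 1)
    {α β : ℝ → ℝ} (hα : Measurable α) {B : ℝ} (hαB : ∀ x, |α x| ≤ B) (hβ : Measurable β)
    (hF₁ : ∀ ξ, ∫⁻ u, ‖F₁ (ξ, u)‖ₑ ^ 2 ≤ EX ((1 + θ) * α ξ))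
    (hF₂ : ∀ ξ, ∫⁻ u, ‖F₂ (ξ, u)‖ₑ ^ (2 * k) ≤ EX (2 * k * β ξ))
    (hμ1 : ∑ i, ∫⁻ ξ in Il i, EX (α ξ) ≤ 1) (hν1 : ∑ j, ∫⁻ ξ in Jr j, EX (β ξ) ≤ 1) :
    (∫⁻ z, H z * ‖bil Il Ir Jl Jr F₁ F₂ z‖ₑ) ^ 2 ≤ 2 * C ^ θ := by
  set X : κ → ℝ → ℝ × ℝ → ℝ≥0∞ := fun j η z =>
    ‖∑ i, Aop (Il i) (Jl j) F₁ z.1 z.2 * PJ (Ir i) (fun v => F₂ (η, v)) z.1‖ₑ with hX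
  have hXm : ∀ j, Measurable fun p : ℝ × (ℝ × ℝ) => X j p.1 p.2 := fun j =>
    (Finset.measurable_fun_sum _ fun i _ => Measurable.mul
      (Measurable.comp (g := fun z : ℝ × ℝ => Aop (Il i) (Jl j) F₁ z.1 z.2)
        (f := fun p : ℝ × (ℝ × ℝ) => p.2)
        (measurable_Aop (hI.ml i) (hJ.ml j) (hJ.bl j) h₁) measurable_snd)
      (Measurable.comp (g := fun q : ℝ × ℝ => PJ (Ir i) (fun v => F₂ (q.1, v)) q.2)
        (f := fun p : ℝ × (ℝ × ℝ) => (p.1, p.2.1))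
        (measurable_PJ (hI.mr i) (hI.br i) h₂) (by fun_prop))).enorm
  have hXz : ∀ j z, Measurable fun η => X j η z := fun j z =>
    Measurable.comp (g := fun p : ℝ × (ℝ × ℝ) => X j p.1 p.2) (f := fun η => (η, z)) (hXm j)
      measurable_prodMk_right
  have hYm : ∀ j, Measurable fun p : ℝ × (ℝ × ℝ) => EX (- β p.1) * X j p.1 p.2 ^ 2 := fun j =>
    (by fun_prop : Measurable fun p : ℝ × (ℝ × ℝ) => EX (- β p.1)).mul ((hXm j).pow_const 2)
  have hb : ∀ z, ‖bil Il Ir Jl Jr F₁ F₂ z‖ₑ ≤ ∑ j, ∫⁻ η in Jr j, X j η z := fun z => by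
    rw [bil, Finset.sum_comm]
    exact (enorm_sum_le _ _).trans (Finset.sum_le_sum fun j _ =>
      enorm_sum_mul_Aop_le (hJ.mr j) (hJ.br j) hI.mr hI.br h₂ _ _ _)
  have hb2 : ∀ z, ‖bil Il Ir Jl Jr F₁ F₂ z‖ₑ ^ 2 ≤
      ∑ j, ∫⁻ η in Jr j, EX (- β η) * X j η z ^ 2 := fun z =>
    calc _ ≤ (∑ j, ∫⁻ η in Jr j, X j η z) ^ 2 := pow_le_pow_left' (hb z) 2
      _ ≤ (∑ j, ∫⁻ η in Jr j, EX (β η)) * ∑ j, ∫⁻ η in Jr j, EX (- β η) * X j η z ^ 2 :=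
        sq_sum_le_of_sq_le _ fun j _ => sq_lintegral_le_weighted hβ (hXz j z).aemeasurable
      _ ≤ 1 * ∑ j, ∫⁻ η in Jr j, EX (- β η) * X j η z ^ 2 := by gcongr
      _ = _ := one_mul _
  calc _ ≤ (∫⁻ z, H z ^ 2) * ∫⁻ z, ‖bil Il Ir Jl Jr F₁ F₂ z‖ₑ ^ 2 :=
        sq_lintegral_mul_le hH.aemeasurable (measurable_bil hI hJ h₁ h₂).enorm.aemeasurable
    _ ≤ 1 * ∫⁻ z, ∑ j, ∫⁻ η in Jr j, EX (- β η) * X j η z ^ 2 := by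
        gcongr with z
        exact hb2 z
    _ = ∑ j, ∫⁻ z, ∫⁻ η in Jr j, EX (- β η) * X j η z ^ 2 := by
        rw [one_mul, lintegral_finsetSum]
        exact fun j _ => (hYm j).lintegral_prod_left'
    _ = ∑ j, ∫⁻ η in Jr j, ∫⁻ z, EX (- β η) * X j η z ^ 2 :=
        Finset.sum_congr rfl fun j _ => (lintegral_lintegral_swap (μ := volume.restrict (Jr j))
          (f := fun η z => EX (- β η) * X j η z ^ 2) (hYm j).aemeasurable).symm
    _ ≤ ∑ j, ∫⁻ η in Jr j, EX (β η) * (2 * C ^ θ) := by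
        refine Finset.sum_le_sum fun j _ => lintegral_mono fun η => ?_
        rw [lintegral_const_mul' _ _ (EX_ne_top _)]
        calc _ ≤ EX (- β η) * (2 * (C ^ θ * EX (2 * β η))) := by
              gcongr
              exact lintegral_sum_Aop_mul_PJ_sq_le hk hθ hC hC1 hCt hI (hJ.ml j) (hJ.bl j) h₁
                (h₂.section_snd η) hα hαB hF₁ (hF₂ η) hμ1
          _ = (EX (- β η) * EX (2 * β η)) * (2 * C ^ θ) := by ring
          _ = _ := by rw [← EX_add]; ring_nf
    _ = (∑ j, ∫⁻ η in Jr j, EX (β η)) * (2 * C ^ θ) := by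
        rw [Finset.sum_mul]
        exact Finset.sum_congr rfl fun j _ => lintegral_mul_const _ (by fun_prop)
    _ ≤ 1 * (2 * C ^ θ) := by gcongr
    _ = _ := one_mul _

end

/-- Dual form of the `L^{1/b}` boundedness of the frequency projections. -/
def DualBd (b : ℝ) (D : ℝ≥0∞) : Prop := ∀ κ : ℝ → ℝ≥0∞, Measurable κ → ∀ g : ℝ → ℂ, BS g →
  ∀ J : Set ℝ, Bornology.IsBounded J → J.OrdConnected →
    ∫⁻ x, κ x * ‖PJ J g x‖ₑ ≤
      D * ((∫⁻ x, κ x ^ (1 / (1 - b))) ^ (1 - b) * (∫⁻ x, ‖g x‖ₑ ^ (1 / b)) ^ b)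

theorem holderConjugate_inv {b : ℝ} (h0 : 0 < b) (h1 : b < 1) :
    (1 / (1 - b)).HolderConjugate (1 / b) := by
  refine (Real.holderConjugate_iff).2 ⟨?_, ?_⟩
  · rw [one_div]; exact (one_lt_inv₀ (by linarith)).2 (by linarith)
  · simp

theorem dualBd_high {k : ℕ} {C : ℝ≥0∞} (hC : RieszBd k C) {δ : ℝ} (hδ : δ * (2 * k) = 1)
    (h0 : 0 < δ) (h1 : δ < 1) : DualBd δ (C ^ δ) := by
  intro κ hκ g hg J hJb hJ
  have hm : Measurable fun x => ‖PJ J g x‖ₑ :=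
    (PJ_continuous hJ.measurableSet hJb hg).measurable.enorm
  have he : 1 / δ = (2 * k : ℕ) := by push_cast; rw [eq_comm, eq_div_iff h0.ne', mul_comm, hδ]
  have := ENNReal.lintegral_mul_le_Lp_mul_Lq volume (holderConjugate_inv h0 h1) hκ.aemeasurable
    hm.aemeasurable
  rw [one_div_one_div, one_div_one_div] at this
  refine this.trans ?_
  calc _ ≤ (∫⁻ x, κ x ^ (1 / (1 - δ))) ^ (1 - δ) * (C * ∫⁻ x, ‖g x‖ₑ ^ (1 / δ)) ^ δ := by
        gcongr
        simp only [he, ENNReal.rpow_natCast]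
        exact hC g hg J hJb hJ
    _ = _ := by rw [ENNReal.mul_rpow_of_nonneg _ _ h0.le]; ring

theorem dualBd_of_bdd {k : ℕ} {C : ℝ≥0∞} (hC : RieszBd k C) {δ : ℝ} (hδ : δ * (2 * k) = 1)
    (h0 : 0 < δ) (h1 : δ < 1) {κ : ℝ → ℝ} (hκ : Measurable κ) (hκ0 : ∀ x, 0 ≤ κ x) {M R : ℝ}
    (hM : ∀ x, κ x ≤ M) (hR : ∀ x, R < ‖x‖ → κ x = 0) {g : ℝ → ℂ} (hg : BS g) {J : Set ℝ}
    (hJb : Bornology.IsBounded J) (hJ : J.OrdConnected) :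
    ∫⁻ x, ENNReal.ofReal (κ x) * ‖PJ J g x‖ₑ ≤
      C ^ δ * ((∫⁻ x, ENNReal.ofReal (κ x) ^ (1 / δ)) ^ δ *
        (∫⁻ x, ‖g x‖ₑ ^ (1 / (1 - δ))) ^ (1 - δ)) := by
  have hp : Continuous (PJ J g) := PJ_continuous hJ.measurableSet hJb hg
  set w : ℝ → ℂ := fun x => κ x * ((starRingEnd ℂ) (PJ J g x) / (‖PJ J g x‖ : ℂ)) with hw
  have hκn : ∀ x, ‖(κ x : ℂ)‖ = κ x := fun x => by simp [abs_of_nonneg (hκ0 x)]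
  have hwn : ∀ x, ‖w x‖ ≤ κ x := fun x => by
    rw [hw]
    simp only [norm_mul, norm_div, hκn, RCLike.norm_conj, norm_real, norm_norm]
    exact mul_le_of_le_one_right (hκ0 x) (div_self_le_one _)
  have hwm : Measurable w := (Complex.measurable_ofReal.comp hκ).mul
    ((Complex.continuous_conj.measurable.comp hp.measurable).div
      (Complex.measurable_ofReal.comp hp.measurable.norm))
  have hwB : BS w := ⟨hwm, ⟨M, fun x => (hwn x).trans (hM x)⟩, R, fun x hx => by
    simp [hw, hR x hx]⟩
  have hwp : ∀ x, w x * PJ J g x = ((κ x * ‖PJ J g x‖ : ℝ) : ℂ) := fun x => by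
    by_cases h : PJ J g x = 0
    · simp [h]
    · have h' : (‖PJ J g x‖ : ℂ) ≠ 0 := by simpa using h
      simp only [hw, Complex.ofReal_mul]
      rw [mul_assoc, div_mul_eq_mul_div, mul_comm _ (PJ J g x), Complex.mul_conj,
        Complex.normSq_eq_norm_sq]
      push_cast
      field_simp
  have h_int : Integrable fun x => κ x * ‖PJ J g x‖ := by
    have : Integrable fun x => w x * PJ J g x := by
      have := hwB.mul_bdd (G := PJ J g) hp.measurable fun x => norm_Fi_le _ x
      simpa only [mul_comm] using this.integrable
    simp only [hwp] at this
    simpa using this.re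
  have e1 : ∫⁻ x, ENNReal.ofReal (κ x) * ‖PJ J g x‖ₑ = ‖∫ x, w x * PJ J g x‖ₑ := by
    simp only [hwp]
    rw [integral_complex_ofReal, ← ofReal_norm, Complex.norm_real,
      Real.norm_of_nonneg (integral_nonneg fun x => mul_nonneg (hκ0 x) (norm_nonneg _)),
      ofReal_integral_eq_lintegral_ofReal h_int
        (Eventually.of_forall fun x => mul_nonneg (hκ0 x) (norm_nonneg _))]
    refine lintegral_congr fun x => ?_
    rw [ENNReal.ofReal_mul (hκ0 x), ofReal_norm]
  have hJn : (-J).OrdConnected := by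
    have := hJ.preimage_anti (f := fun x : ℝ => -x) (fun _ _ h => neg_le_neg h)
    exact this
  rw [e1, integral_PJ_mul hJ.measurableSet hJb hg hwB]
  calc _ ≤ ∫⁻ x, ‖g x‖ₑ * ‖PJ (-J) w x‖ₑ := by
        refine (enorm_integral_le_lintegral_enorm _).trans_eq (lintegral_congr fun x => ?_)
        rw [enorm_mul]
    _ = ∫⁻ x, ‖PJ (-J) w x‖ₑ * ‖g x‖ₑ := lintegral_congr fun x => mul_comm _ _
    _ ≤ (∫⁻ x, ‖PJ (-J) w x‖ₑ ^ (1 / δ)) ^ δ * (∫⁻ x, ‖g x‖ₑ ^ (1 / (1 - δ))) ^ (1 - δ) := by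
        have := ENNReal.lintegral_mul_le_Lp_mul_Lq volume (holderConjugate_inv h0 h1).symm
          (PJ_continuous hJn.measurableSet hJb.neg hwB).measurable.enorm.aemeasurable
          hg.1.enorm.aemeasurable
        rw [one_div_one_div, one_div_one_div] at this
        exact this
    _ ≤ (C * ∫⁻ x, ENNReal.ofReal (κ x) ^ (1 / δ)) ^ δ *
          (∫⁻ x, ‖g x‖ₑ ^ (1 / (1 - δ))) ^ (1 - δ) := by
        have he : 1 / δ = (2 * k : ℕ) := by
          push_cast; rw [eq_comm, eq_div_iff h0.ne', mul_comm, hδ]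
        gcongr
        simp only [he, ENNReal.rpow_natCast]
        refine (hC w hwB _ hJb.neg hJn).trans ?_
        gcongr with x
        rw [← ofReal_norm]
        exact ENNReal.ofReal_le_ofReal (hwn x)
    _ = _ := by rw [ENNReal.mul_rpow_of_nonneg _ _ h0.le]; ring

theorem dualBd_low {k : ℕ} {C : ℝ≥0∞} (hC : RieszBd k C) {δ : ℝ} (hδ : δ * (2 * k) = 1)
    (h0 : 0 < δ) (h1 : δ < 1) : DualBd (1 - δ) (C ^ δ) := by
  intro κ hκ g hg J hJb hJ
  have hm : Measurable fun x => ‖PJ J g x‖ₑ :=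
    (PJ_continuous hJ.measurableSet hJb hg).measurable.enorm
  rw [sub_sub_cancel]
  refine lintegral_le_of_forall_closedBall (hκ.mul hm).aemeasurable fun T hT => ?_
  have hlim : Tendsto (fun n : ℕ => ∫⁻ x in Metric.closedBall 0 T, min (κ x) n * ‖PJ J g x‖ₑ) atTop
      (𝓝 (∫⁻ x in Metric.closedBall 0 T, κ x * ‖PJ J g x‖ₑ)) := by
    refine lintegral_tendsto_of_tendsto_of_monotone
      (fun n => ((hκ.min measurable_const).mul hm).aemeasurable)
      (Eventually.of_forall fun x m n hmn => ?_) (Eventually.of_forall fun x => ?_)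
    · dsimp only
      gcongr
    · refine ENNReal.Tendsto.mul_const ?_ (Or.inr (by simp))
      have := (tendsto_const_nhds (x := κ x)).min ENNReal.tendsto_nat_nhds_top
      simpa using this
  refine le_of_tendsto' hlim fun n => ?_
  have h := dualBd_of_bdd hC hδ h0 h1
    (κ := (Metric.closedBall (0 : ℝ) T).indicator fun x => (min (κ x) n).toReal)
    ((hκ.min measurable_const).ennreal_toReal.indicator measurableSet_closedBall)
    (fun x => indicator_nonneg (fun _ _ => ENNReal.toReal_nonneg) x) (M := n) (R := T)
    (fun x => ?_) (fun x hx => ?_) hg hJb hJ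
  · have e : ∀ x, ENNReal.ofReal ((Metric.closedBall (0 : ℝ) T).indicator
        (fun x => (min (κ x) n).toReal) x) =
        (Metric.closedBall (0 : ℝ) T).indicator (fun x => min (κ x) n) x := fun x => by
      by_cases hx : x ∈ Metric.closedBall (0 : ℝ) T
      · rw [indicator_of_mem hx, indicator_of_mem hx, ENNReal.ofReal_toReal]
        exact ne_top_of_le_ne_top (ENNReal.natCast_ne_top n) (min_le_right _ _)
      · rw [indicator_of_notMem hx, indicator_of_notMem hx, ENNReal.ofReal_zero]
    simp only [e] at h
    rw [← lintegral_indicator measurableSet_closedBall]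
    refine le_trans (le_of_eq (lintegral_congr fun x => ?_)) (h.trans ?_)
    · by_cases hx : x ∈ Metric.closedBall (0 : ℝ) T <;> simp [hx]
    · gcongr with x
      exact (indicator_le_self _ _ x).trans (min_le_left _ _)
  · by_cases hx : x ∈ Metric.closedBall (0 : ℝ) T
    · rw [indicator_of_mem hx]
      refine ENNReal.toReal_le_of_le_ofReal (by positivity) ?_
      simp
    · rw [indicator_of_notMem hx]
      positivity
  · exact indicator_of_notMem (by simpa using hx) _

section
variable {ι κ : Type*} [Fintype ι] [Fintype κ] {Il Ir : ι → Set ℝ} {Jl Jr : κ → Set ℝ}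
  {F₁ F₂ : ℝ × ℝ → ℂ}

theorem lintegral_mul_Maj_le {b : ℝ} {D : ℝ≥0∞} (hD : DualBd b D) {I J : Set ℝ}
    (hJ : J.OrdConnected) (hJb : Bornology.IsBounded J) {F : ℝ × ℝ → ℂ} (hF : BS F)
    {α : ℝ → ℝ} (hα : Measurable α) (hFb : ∀ ξ, (∫⁻ u, ‖F (ξ, u)‖ₑ ^ (1 / b)) ^ b ≤ EX (α ξ))
    {w : ℝ → ℝ≥0∞} (hw : Measurable w) :
    ∫⁻ y, w y * Maj I J F y ≤
      D * (∫⁻ y, w y ^ (1 / (1 - b))) ^ (1 - b) * ∫⁻ ξ in I, EX (α ξ) := by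
  have hm := measurable_PJ hJ.measurableSet hJb hF
  have hm' : Measurable fun p : ℝ × ℝ => w p.2 * ‖PJ J (fun u => F (p.1, u)) p.2‖ₑ :=
    (hw.comp measurable_snd).mul hm.enorm
  calc _ = ∫⁻ y, ∫⁻ ξ in I, w y * ‖PJ J (fun u => F (ξ, u)) y‖ₑ := by
        refine lintegral_congr fun y => ?_
        have hy : Measurable fun ξ => ‖PJ J (fun u => F (ξ, u)) y‖ₑ :=
          (Measurable.comp (g := fun p : ℝ × ℝ => PJ J (fun u => F (p.1, u)) p.2)
            (f := fun ξ : ℝ => (ξ, y)) hm measurable_prodMk_right).enorm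
        rw [lintegral_const_mul _ hy, Maj]
    _ = ∫⁻ ξ in I, ∫⁻ y, w y * ‖PJ J (fun u => F (ξ, u)) y‖ₑ :=
        (lintegral_lintegral_swap (μ := volume.restrict I)
          (f := fun ξ y => w y * ‖PJ J (fun u => F (ξ, u)) y‖ₑ) hm'.aemeasurable).symm
    _ ≤ ∫⁻ ξ in I, D * (∫⁻ y, w y ^ (1 / (1 - b))) ^ (1 - b) * EX (α ξ) := by
        refine lintegral_mono fun ξ => (hD w hw _ (hF.section_snd ξ) J hJb hJ).trans ?_
        rw [← mul_assoc]
        gcongr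
        exact hFb ξ
    _ = _ := lintegral_const_mul _ (by fun_prop)

/-- The bound with inner exponents near the endpoints and outer weights integrable. -/
theorem lintegral_bil_le_dual {b d : ℝ} (hd1 : d < 1) {D₁ D₂ : ℝ≥0∞}
    (hD₁ : DualBd b D₁) (hD₂ : DualBd d D₂)
    (hI : Sys Il Ir) (hJ : Sys Jl Jr) (h₁ : BS F₁) (h₂ : BS F₂) {H : ℝ × ℝ → ℝ≥0∞}
    (hH : Measurable H)
    (hHb : ∫⁻ x, (∫⁻ y, H (x, y) ^ (1 / (1 - b))) ^ ((1 - b) / (1 - d)) ≤ 1)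
    {α β : ℝ → ℝ} (hα : Measurable α) (hβ : Measurable β)
    (hF₁ : ∀ ξ, (∫⁻ u, ‖F₁ (ξ, u)‖ₑ ^ (1 / b)) ^ b ≤ EX (α ξ))
    (hF₂ : ∀ ξ, (∫⁻ u, ‖F₂ (ξ, u)‖ₑ ^ (1 / d)) ^ d ≤ EX (β ξ))
    (hμ1 : ∑ i, ∫⁻ ξ in Il i, EX (α ξ) ≤ 1) (hν1 : ∑ j, ∫⁻ ξ in Jr j, EX (β ξ) ≤ 1) :
    ∫⁻ z, H z * ‖bil Il Ir Jl Jr F₁ F₂ z‖ₑ ≤ D₁ * D₂ := by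
  have mA := fun i j => (measurable_Aop (hI.ml i) (hJ.ml j) (hJ.bl j) h₁).enorm
  have mB := fun i j => (measurable_Aop_swap (hJ.mr j) (hI.mr i) (hI.br i) h₂).enorm
  have m₁ := fun i j => measurable_Maj (I := Il i) (hJ.ml j) (hJ.bl j) h₁
  have m₂ := fun i j => measurable_Maj (I := Jr j) (hI.mr i) (hI.br i) h₂
  have single : ∀ i j, ∫⁻ z : ℝ × ℝ, H z * (‖Aop (Il i) (Jl j) F₁ z.1 z.2‖ₑ *
      ‖Aop (Jr j) (Ir i) F₂ z.2 z.1‖ₑ) ≤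
      D₁ * D₂ * ((∫⁻ ξ in Il i, EX (α ξ)) * ∫⁻ ξ in Jr j, EX (β ξ)) := fun i j => by
    set w : ℝ → ℝ≥0∞ := fun x => (∫⁻ y, H (x, y) ^ (1 / (1 - b))) ^ (1 - b) with hw
    have hwm : Measurable w :=
      (Measurable.lintegral_prod_right' (hH.pow_const _)).pow_const _
    have hww : ∫⁻ x, w x ^ (1 / (1 - d)) ≤ 1 := by
      simp only [hw, ← ENNReal.rpow_mul]
      simpa only [mul_one_div] using hHb
    have mH : Measurable fun z : ℝ × ℝ =>
        H z * (Maj (Il i) (Jl j) F₁ z.2 * Maj (Jr j) (Ir i) F₂ z.1) :=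
      hH.mul (((m₁ i j).comp measurable_snd).mul ((m₂ i j).comp measurable_fst))
    calc _ ≤ ∫⁻ z : ℝ × ℝ, H z * (Maj (Il i) (Jl j) F₁ z.2 * Maj (Jr j) (Ir i) F₂ z.1) :=
          lintegral_mono fun z => mul_le_mul' le_rfl
            (mul_le_mul' (enorm_Aop_le (hI.ml i) _ _) (enorm_Aop_le (hJ.mr j) _ _))
      _ = ∫⁻ x, ∫⁻ y, H (x, y) * (Maj (Il i) (Jl j) F₁ y * Maj (Jr j) (Ir i) F₂ x) :=
          lintegral_prod (μ := (volume : Measure ℝ)) (ν := (volume : Measure ℝ)) _ mH.aemeasurable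
      _ ≤ ∫⁻ x, D₁ * (∫⁻ ξ in Il i, EX (α ξ)) * (w x * Maj (Jr j) (Ir i) F₂ x) := by
          refine lintegral_mono fun x => ?_
          have hx : Measurable fun y => H (x, y) := hH.comp measurable_prodMk_left
          simp only [← mul_assoc]
          have hx' : Measurable fun y => H (x, y) * Maj (Il i) (Jl j) F₁ y := hx.mul (m₁ i j)
          rw [lintegral_mul_const _ hx']
          refine mul_le_mul' ?_ le_rfl
          refine (lintegral_mul_Maj_le hD₁ (hJ.cl j) (hJ.bl j) h₁ hα hF₁ hx).trans_eq ?_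
          rw [hw]; ring
      _ = D₁ * (∫⁻ ξ in Il i, EX (α ξ)) * ∫⁻ x, w x * Maj (Jr j) (Ir i) F₂ x :=
          lintegral_const_mul _ (hwm.mul (m₂ i j))
      _ ≤ D₁ * (∫⁻ ξ in Il i, EX (α ξ)) * (D₂ * 1 * ∫⁻ ξ in Jr j, EX (β ξ)) := by
          gcongr
          refine (lintegral_mul_Maj_le hD₂ (hI.cr i) (hI.br i) h₂ hβ hF₂ hwm).trans ?_
          gcongr
          exact (ENNReal.rpow_le_rpow hww (by linarith)).trans_eq (ENNReal.one_rpow _)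
      _ = _ := by ring
  have hm : ∀ i j, Measurable fun z : ℝ × ℝ => H z * (‖Aop (Il i) (Jl j) F₁ z.1 z.2‖ₑ *
      ‖Aop (Jr j) (Ir i) F₂ z.2 z.1‖ₑ) := fun i j => hH.mul ((mA i j).mul (mB i j))
  calc _ ≤ ∑ p : ι × κ, ∫⁻ z, H z *
      (‖Aop (Il p.1) (Jl p.2) F₁ z.1 z.2‖ₑ * ‖Aop (Jr p.2) (Ir p.1) F₂ z.2 z.1‖ₑ) := by
        rw [← lintegral_finsetSum _ fun p _ => hm p.1 p.2]
        refine lintegral_mono fun z => ?_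
        rw [← Finset.mul_sum, Fintype.sum_prod_type, bil]
        gcongr
        refine (enorm_sum_le _ _).trans (Finset.sum_le_sum fun i _ => (enorm_sum_le _ _).trans ?_)
        simp [enorm_mul]
    _ ≤ ∑ p : ι × κ, D₁ * D₂ * ((∫⁻ ξ in Il p.1, EX (α ξ)) * ∫⁻ ξ in Jr p.2, EX (β ξ)) :=
        Finset.sum_le_sum fun p _ => single p.1 p.2
    _ = D₁ * D₂ * ((∑ i, ∫⁻ ξ in Il i, EX (α ξ)) * ∑ j, ∫⁻ ξ in Jr j, EX (β ξ)) := by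
        rw [← Finset.mul_sum, Fintype.sum_prod_type, Finset.sum_mul_sum]
    _ ≤ D₁ * D₂ * (1 * 1) := by gcongr
    _ = _ := by ring

end

/-- The trilinear form with kernel `K`. -/
noncomputable def Tri (K : (ℝ × ℝ) × (ℝ × ℝ) × (ℝ × ℝ) → ℂ) (h F₁ F₂ : ℝ × ℝ → ℂ) : ℂ :=
  ∫ x, K x * (h x.1 * (F₁ x.2.1 * F₂ x.2.2))

/-- Measurable functions bounded by the indicator of `Q`. -/
def Adm (Q : Set (ℝ × ℝ)) (u : ℝ × ℝ → ℂ) : Prop :=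
  Measurable u ∧ (∀ p, ‖u p‖ ≤ 1) ∧ ∀ p ∉ Q, u p = 0

/-- The weight exponent `s A + t B`. -/
def wgt (s t : ℝ) (A : ℝ → ℝ) (B : ℝ × ℝ → ℝ) (p : ℝ × ℝ) : ℝ := s * A p.1 + t * B p

/-- Multiplication by a real exponential. -/
noncomputable def tw (u : ℝ × ℝ → ℂ) (l : ℝ × ℝ → ℝ) (p : ℝ × ℝ) : ℂ :=
  u p * Complex.exp ((l p : ℝ) : ℂ)

theorem BS.prodMul {E F : Type*} [MeasurableSpace E] [NormedAddCommGroup E]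
    [MeasurableSpace F] [NormedAddCommGroup F] {f : E → ℂ} {g : F → ℂ} (hf : BS f) (hg : BS g) :
    BS fun x : E × F => f x.1 * g x.2 := by
  obtain ⟨hm, ⟨M, hM⟩, R, hR⟩ := hf
  obtain ⟨hm', ⟨M', hM'⟩, R', hR'⟩ := hg
  refine ⟨(hm.comp measurable_fst).mul (hm'.comp measurable_snd), ⟨M * M', fun x => ?_⟩,
    max R R', fun x hx => ?_⟩
  · rw [norm_mul]
    exact mul_le_mul (hM _) (hM' _) (norm_nonneg _) ((norm_nonneg _).trans (hM x.1))
  · rw [Prod.norm_def] at hx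
    dsimp only
    rcases le_total ‖x.1‖ ‖x.2‖ with h | h
    · rw [max_eq_right h] at hx
      rw [hR' _ ((le_max_right _ _).trans_lt hx), mul_zero]
    · rw [max_eq_left h] at hx
      rw [hR _ ((le_max_left _ _).trans_lt hx), zero_mul]

theorem measurable_wgt (s t : ℝ) {A : ℝ → ℝ} {B : ℝ × ℝ → ℝ} (hA : Measurable A)
    (hB : Measurable B) : Measurable (wgt s t A B) :=
  ((hA.comp measurable_fst).const_mul s).add (hB.const_mul t)

theorem abs_wgt_le (s t : ℝ) {A : ℝ → ℝ} {B : ℝ × ℝ → ℝ} {M : ℝ} (hA : ∀ x, |A x| ≤ M)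
    (hB : ∀ p, |B p| ≤ M) (p : ℝ × ℝ) : |wgt s t A B p| ≤ (|s| + |t|) * M := by
  refine (abs_add_le _ _).trans ?_
  rw [abs_mul, abs_mul, add_mul]
  exact add_le_add (mul_le_mul_of_nonneg_left (hA _) (abs_nonneg _))
    (mul_le_mul_of_nonneg_left (hB _) (abs_nonneg _))

theorem Adm.bs {Q : Set (ℝ × ℝ)} (hQ : Bornology.IsBounded Q) {u : ℝ × ℝ → ℂ} (hu : Adm Q u) :
    BS u := by
  obtain ⟨R, hR⟩ := hQ.exists_norm_le
  exact ⟨hu.1, ⟨1, hu.2.1⟩, R, fun x hx => hu.2.2 x fun h => absurd (hR x h) (not_le.2 hx)⟩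

theorem BS.tw {u : ℝ × ℝ → ℂ} (hu : BS u) {l : ℝ × ℝ → ℝ} (hl : Measurable l) {M : ℝ}
    (hM : ∀ p, |l p| ≤ M) : BS (tw u l) := by
  have := hu.mul_bdd (G := fun p => Complex.exp ((l p : ℝ) : ℂ)) (by fun_prop) (M := Real.exp M)
    fun p => by
      rw [Complex.norm_exp, Complex.ofReal_re]
      exact Real.exp_le_exp.2 ((le_abs_self _).trans (hM p))
  have e : _root_.tw u l = fun p => Complex.exp ((l p : ℝ) : ℂ) * u p :=
    funext fun p => mul_comm _ _
  rwa [e]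

theorem Adm.mul_unimodular {Q : Set (ℝ × ℝ)} {u : ℝ × ℝ → ℂ} (hu : Adm Q u) {l : ℝ × ℝ → ℝ}
    (hl : Measurable l) : Adm Q fun p => u p * Complex.exp ((l p : ℝ) * I) := by
  refine ⟨hu.1.mul (by fun_prop), fun p => ?_, fun p hp => by simp [hu.2.2 p hp]⟩
  rw [norm_mul, Complex.norm_exp_ofReal_mul_I, mul_one]
  exact hu.2.1 p

/-- The restricted estimate at the exponent `(a, b, c, d)`. -/
def Est (K : (ℝ × ℝ) × (ℝ × ℝ) × (ℝ × ℝ) → ℂ) (Q Q₃ : Set (ℝ × ℝ)) (A₁ A₂ A₃ : ℝ → ℝ)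
    (B₁ B₂ B₃ : ℝ × ℝ → ℝ) (C : ℝ) (x : ℝ × ℝ × ℝ × ℝ) : Prop :=
  ∀ u₁ u₂ u₃, Adm Q u₁ → Adm Q u₂ → Adm Q₃ u₃ →
    ‖Tri K (tw u₃ (wgt (1 - x.1 - x.2.2.2) (1 - x.2.1 - x.2.2.1) A₃ B₃))
      (tw u₁ (wgt (1 - x.1) x.2.1 A₁ B₁)) (tw u₂ (wgt (1 - x.2.2.1) x.2.2.2 A₂ B₂))‖ ≤ C

theorem Est.interp {K : (ℝ × ℝ) × (ℝ × ℝ) × (ℝ × ℝ) → ℂ} (hK : Measurable K) {MK : ℝ}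
    (hKM : ∀ x, ‖K x‖ ≤ MK) {Q Q₃ : Set (ℝ × ℝ)} (hQ : Bornology.IsBounded Q)
    (hQ₃ : Bornology.IsBounded Q₃) {A₁ A₂ A₃ : ℝ → ℝ} {B₁ B₂ B₃ : ℝ × ℝ → ℝ}
    (hA₁ : Measurable A₁) (hA₂ : Measurable A₂) (hA₃ : Measurable A₃)
    (hB₁ : Measurable B₁) (hB₂ : Measurable B₂) (hB₃ : Measurable B₃) {M : ℝ}
    (bA₁ : ∀ x, |A₁ x| ≤ M) (bA₂ : ∀ x, |A₂ x| ≤ M) (bA₃ : ∀ x, |A₃ x| ≤ M)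
    (bB₁ : ∀ x, |B₁ x| ≤ M) (bB₂ : ∀ x, |B₂ x| ≤ M) (bB₃ : ∀ x, |B₃ x| ≤ M)
    {C₀ C₁ : ℝ} {x y : ℝ × ℝ × ℝ × ℝ}
    (h₀ : Est K Q Q₃ A₁ A₂ A₃ B₁ B₂ B₃ C₀ x) (h₁ : Est K Q Q₃ A₁ A₂ A₃ B₁ B₂ B₃ C₁ y) {t : ℝ}
    (ht : t ∈ Icc (0 : ℝ) 1) :
    Est K Q Q₃ A₁ A₂ A₃ B₁ B₂ B₃ (C₀ ^ (1 - t) * C₁ ^ t) ((1 - t) • x + t • y) := by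
  intro u₁ u₂ u₃ hu₁ hu₂ hu₃
  obtain ⟨a, b, c, d⟩ := x
  obtain ⟨a', b', c', d'⟩ := y
  set l₁ := wgt (a - a') (b' - b) A₁ B₁ with hl₁
  set l₂ := wgt (c - c') (d' - d) A₂ B₂ with hl₂
  set l₃ := wgt (a + d - a' - d') (b + c - b' - c') A₃ B₃ with hl₃
  have m₁ : Measurable l₁ := measurable_wgt _ _ hA₁ hB₁
  have m₂ : Measurable l₂ := measurable_wgt _ _ hA₂ hB₂
  have m₃ : Measurable l₃ := measurable_wgt _ _ hA₃ hB₃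
  set G : (ℝ × ℝ) × (ℝ × ℝ) × (ℝ × ℝ) → ℂ := fun x =>
    K x * (tw u₃ (wgt (1 - a - d) (1 - b - c) A₃ B₃) x.1 *
      (tw u₁ (wgt (1 - a) b A₁ B₁) x.2.1 * tw u₂ (wgt (1 - c) d A₂ B₂) x.2.2)) with hG
  set L : (ℝ × ℝ) × (ℝ × ℝ) × (ℝ × ℝ) → ℝ := fun x => l₃ x.1 + (l₁ x.2.1 + l₂ x.2.2) with hL
  have hGi : Integrable G := by
    refine BS.integrable ((BS.prodMul ((hu₃.bs hQ₃).tw (measurable_wgt _ _ hA₃ hB₃)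
      (abs_wgt_le _ _ bA₃ bB₃)) (BS.prodMul ((hu₁.bs hQ).tw (measurable_wgt _ _ hA₁ hB₁)
      (abs_wgt_le _ _ bA₁ bB₁)) ((hu₂.bs hQ).tw (measurable_wgt _ _ hA₂ hB₂)
      (abs_wgt_le _ _ bA₂ bB₂)))).mul_bdd hK hKM)
  have hLm : Measurable L := (m₃.comp measurable_fst).add
    ((m₁.comp (measurable_fst.comp measurable_snd)).add
      (m₂.comp (measurable_snd.comp measurable_snd)))
  have hLb : ∀ x, |L x| ≤ (|a + d - a' - d'| + |b + c - b' - c'|) * M +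
      ((|a - a'| + |b' - b|) * M + (|c - c'| + |d' - d|) * M) := fun x =>
    (abs_add_le _ _).trans (add_le_add (abs_wgt_le _ _ bA₃ bB₃ _) ((abs_add_le _ _).trans
      (add_le_add (abs_wgt_le _ _ bA₁ bB₁ _) (abs_wgt_le _ _ bA₂ bB₂ _))))
  have key := norm_integral_mul_exp_le hGi hLm hLb (C₀ := C₀) (C₁ := C₁) (fun y => ?_)
    (fun y => ?_) ht
  · refine le_trans (le_of_eq ?_) key
    rw [Tri]
    congr 2
    funext x
    simp only [hG, hL, tw, mul_assoc]
    have : ∀ k u v w e₁ e₂ e₃ e e₁' e₂' e₃' : ℂ, e₁' * e₂' * e₃' = e₁ * e₂ * e₃ * e →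
      k * (u * (e₁' * (v * (e₂' * (w * e₃'))))) =
      k * (u * (e₁ * (v * (e₂ * (w * (e₃ * e)))))) := fun k u v w e₁ e₂ e₃ e e₁' e₂' e₃' h => by
        linear_combination k * u * v * w * h
    refine this _ _ _ _ _ _ _ _ _ _ _ ?_
    simp only [← Complex.exp_add]
    congr 1
    simp only [hl₁, hl₂, hl₃, wgt, Prod.fst_add, Prod.snd_add, Prod.smul_fst, Prod.smul_snd,
      smul_eq_mul]
    push_cast
    ring
  · refine le_trans (le_of_eq ?_) (h₀ _ _ _ (hu₁.mul_unimodular (m₁.const_mul y))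
      (hu₂.mul_unimodular (m₂.const_mul y)) (hu₃.mul_unimodular (m₃.const_mul y)))
    rw [Tri]
    congr 2
    funext x
    simp only [hG, hL, tw, mul_assoc]
    have : ∀ k u v w e₁ e₂ e₃ e f₁ f₂ f₃ : ℂ, e = f₁ * f₂ * f₃ →
      k * (u * (e₁ * (v * (e₂ * (w * (e₃ * e)))))) =
      k * (u * (f₁ * (e₁ * (v * (f₂ * (e₂ * (w * (f₃ * e₃)))))))) :=
        fun k u v w e₁ e₂ e₃ e f₁ f₂ f₃ h => by
        linear_combination k * u * v * w * e₁ * e₂ * e₃ * h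
    refine this _ _ _ _ _ _ _ _ _ _ _ ?_
    simp only [← Complex.exp_add]
    congr 1
    push_cast
    ring
  · refine le_trans (le_of_eq ?_) (h₁ _ _ _ (hu₁.mul_unimodular (m₁.const_mul y))
      (hu₂.mul_unimodular (m₂.const_mul y)) (hu₃.mul_unimodular (m₃.const_mul y)))
    rw [Tri]
    congr 2
    funext x
    simp only [hG, hL, tw, mul_assoc]
    have : ∀ k u v w e₁ e₂ e₃ e f₁ f₂ f₃ e₁' e₂' e₃' : ℂ,
      e₁ * e₂ * e₃ * e = f₁ * f₂ * f₃ * (e₁' * e₂' * e₃') →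
      k * (u * (e₁ * (v * (e₂ * (w * (e₃ * e)))))) =
      k * (u * (f₁ * (e₁' * (v * (f₂ * (e₂' * (w * (f₃ * e₃')))))))) :=
        fun k u v w e₁ e₂ e₃ e f₁ f₂ f₃ e₁' e₂' e₃' h => by
        linear_combination k * u * v * w * h
    refine this _ _ _ _ _ _ _ _ _ _ _ _ _ _ ?_
    simp only [← Complex.exp_add]
    congr 1
    simp only [hl₁, hl₂, hl₃, wgt]
    push_cast
    ring

/-- The kernel of `Aop`. -/
noncomputable def kA (I J : Set ℝ) (x y : ℝ) (p : ℝ × ℝ) : ℂ :=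
  I.indicator (fun _ => 1) p.1 * (ex (p.1 * x) * kr J (y - p.2))

theorem Aop_eq_integral {I J : Set ℝ} (hI : MeasurableSet I) (hJ : MeasurableSet J)
    (hb : Bornology.IsBounded J) {F : ℝ × ℝ → ℂ} (hF : BS F) (x y : ℝ) :
    Aop I J F x y = ∫ p, kA I J x y p * F p := by
  obtain ⟨M, hM⟩ := kr_bound J
  have hm : Measurable (kA I J x y) := ((measurable_const.indicator hI).comp measurable_fst).mul
    ((measurable_ex.comp (by fun_prop)).mul
      ((kr_continuous hJ hb).measurable.comp (by fun_prop)))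
  have hB : BS fun p => kA I J x y p * F p := hF.mul_bdd hm (M := 1 * (1 * M)) fun p => by
    rw [kA, norm_mul, norm_mul, norm_ex]
    have h1 : ‖I.indicator (fun _ => (1 : ℂ)) p.1‖ ≤ 1 :=
      (norm_indicator_le_norm_self _ _).trans (by simp)
    have := hM (y - p.2)
    gcongr
  rw [Measure.volume_eq_prod, integral_prod _ hB.integrable, Aop, Fi]
  refine integral_congr_ae (Eventually.of_forall fun ξ => ?_)
  simp only [kA]
  by_cases hξ : ξ ∈ I
  · simp only [indicator_of_mem hξ, one_mul, mul_assoc]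
    rw [integral_const_mul, PJ_eq_kernel hJ hb (hF.section_snd ξ)]
  · simp [indicator_of_notMem hξ]

section
variable {ι κ : Type*} [Fintype ι] [Fintype κ] {Il Ir : ι → Set ℝ} {Jl Jr : κ → Set ℝ}
  {F₁ F₂ : ℝ × ℝ → ℂ}

/-- The kernel of `bil`. -/
noncomputable def kB (Il Ir : ι → Set ℝ) (Jl Jr : κ → Set ℝ)
    (x : (ℝ × ℝ) × (ℝ × ℝ) × (ℝ × ℝ)) : ℂ :=
  ∑ i, ∑ j, kA (Il i) (Jl j) x.1.1 x.1.2 x.2.1 * kA (Jr j) (Ir i) x.1.2 x.1.1 x.2.2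

theorem measurable_kA {I J : Set ℝ} (hI : MeasurableSet I) (hJ : MeasurableSet J)
    (hb : Bornology.IsBounded J) :
    Measurable fun w : (ℝ × ℝ) × (ℝ × ℝ) => kA I J w.1.1 w.1.2 w.2 :=
  ((measurable_const.indicator hI).comp (by fun_prop)).mul
    ((measurable_ex.comp (by fun_prop)).mul
      ((kr_continuous hJ hb).measurable.comp (by fun_prop)))

theorem exists_norm_kA_le (I J : Set ℝ) :
    ∃ M, ∀ x y p, ‖kA I J x y p‖ ≤ M := by
  obtain ⟨M, hM⟩ := kr_bound J
  refine ⟨1 * (1 * M), fun x y p => ?_⟩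
  rw [kA, norm_mul, norm_mul, norm_ex]
  have h1 : ‖I.indicator (fun _ => (1 : ℂ)) p.1‖ ≤ 1 :=
    (norm_indicator_le_norm_self _ _).trans (by simp)
  have := hM (y - p.2)
  gcongr

theorem measurable_kB (hI : Sys Il Ir) (hJ : Sys Jl Jr) : Measurable (kB Il Ir Jl Jr) :=
  Finset.measurable_fun_sum _ fun i _ => Finset.measurable_fun_sum _ fun j _ =>
    ((measurable_kA (hI.ml i) (hJ.ml j) (hJ.bl j)).comp
      (by fun_prop : Measurable fun x : (ℝ × ℝ) × (ℝ × ℝ) × (ℝ × ℝ) => (x.1, x.2.1))).mul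
    ((measurable_kA (hJ.mr j) (hI.mr i) (hI.br i)).comp
      (by fun_prop : Measurable fun x : (ℝ × ℝ) × (ℝ × ℝ) × (ℝ × ℝ) => ((x.1.2, x.1.1), x.2.2)))

theorem exists_norm_kB_le (Il Ir : ι → Set ℝ) (Jl Jr : κ → Set ℝ) :
    ∃ M, ∀ x, ‖kB Il Ir Jl Jr x‖ ≤ M := by
  choose M₁ hM₁ using fun i j => exists_norm_kA_le (Il i) (Jl j)
  choose M₂ hM₂ using fun i j => exists_norm_kA_le (Jr j) (Ir i)
  refine ⟨∑ i, ∑ j, M₁ i j * M₂ i j, fun x => (norm_sum_le _ _).trans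
    (Finset.sum_le_sum fun i _ => (norm_sum_le _ _).trans (Finset.sum_le_sum fun j _ => ?_))⟩
  rw [norm_mul]
  exact mul_le_mul (hM₁ _ _ _ _ _) (hM₂ _ _ _ _ _) (norm_nonneg _)
    ((norm_nonneg _).trans (hM₁ i j x.1.1 x.1.2 x.2.1))

theorem Tri_kB (hI : Sys Il Ir) (hJ : Sys Jl Jr) (h₁ : BS F₁) (h₂ : BS F₂) {h : ℝ × ℝ → ℂ}
    (hh : BS h) : Tri (kB Il Ir Jl Jr) h F₁ F₂ = ∫ z, h z * bil Il Ir Jl Jr F₁ F₂ z := by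
  obtain ⟨M, hM⟩ := exists_norm_kB_le Il Ir Jl Jr
  have hB := (BS.prodMul hh (BS.prodMul h₁ h₂)).mul_bdd (measurable_kB hI hJ) hM
  rw [Tri, Measure.volume_eq_prod, integral_prod _ hB.integrable]
  refine integral_congr_ae (Eventually.of_forall fun z => ?_)
  have hp : ∀ {I J : Set ℝ} (_ : MeasurableSet I) (_ : MeasurableSet J) (_ : Bornology.IsBounded J)
      {F : ℝ × ℝ → ℂ} (_ : BS F) (x y : ℝ), BS fun p => kA I J x y p * F p :=
    fun {I J} hI hJ hb {F} hF x y => by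
      obtain ⟨M, hM⟩ := exists_norm_kA_le I J
      exact hF.mul_bdd ((measurable_kA hI hJ hb).comp
        (by fun_prop : Measurable fun p : ℝ × ℝ => ((x, y), p))) (hM x y)
  have e : ∀ w : (ℝ × ℝ) × (ℝ × ℝ), kB Il Ir Jl Jr (z, w) * (h z * (F₁ w.1 * F₂ w.2)) =
      h z * ∑ i, ∑ j, (kA (Il i) (Jl j) z.1 z.2 w.1 * F₁ w.1) *
        (kA (Jr j) (Ir i) z.2 z.1 w.2 * F₂ w.2) := fun w => by
    simp only [kB, Finset.mul_sum, Finset.sum_mul]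
    refine Finset.sum_congr rfl fun i _ => Finset.sum_congr rfl fun j _ => ?_
    ring
  simp only [e]
  rw [integral_const_mul, bil, integral_finsetSum]
  · congr 1
    refine Finset.sum_congr rfl fun i _ => ?_
    rw [integral_finsetSum]
    · refine Finset.sum_congr rfl fun j _ => ?_
      rw [Aop_eq_integral (hI.ml i) (hJ.ml j) (hJ.bl j) h₁,
        Aop_eq_integral (hJ.mr j) (hI.mr i) (hI.br i) h₂, Measure.volume_eq_prod (ℝ × ℝ) (ℝ × ℝ)]
      exact integral_prod_mul (fun p => kA (Il i) (Jl j) z.1 z.2 p * F₁ p)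
        (fun p => kA (Jr j) (Ir i) z.2 z.1 p * F₂ p)
    · intro j _
      exact (BS.prodMul (hp (hI.ml i) (hJ.ml j) (hJ.bl j) h₁ _ _)
        (hp (hJ.mr j) (hI.mr i) (hI.br i) h₂ _ _)).integrable
  · intro i _
    refine integrable_finsetSum _ fun j _ => ?_
    exact (BS.prodMul (hp (hI.ml i) (hJ.ml j) (hJ.bl j) h₁ _ _)
        (hp (hJ.mr j) (hI.mr i) (hI.br i) h₂ _ _)).integrable

end

theorem enorm_tw (u : ℝ × ℝ → ℂ) (l : ℝ × ℝ → ℝ) (p : ℝ × ℝ) :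
    ‖tw u l p‖ₑ = ‖u p‖ₑ * EX (l p) := by
  rw [tw, enorm_mul, EX, ← ofReal_norm (Complex.exp _), Complex.norm_exp, Complex.ofReal_re]

theorem lintegral_tw_rpow_le {X Y : Set ℝ} (hY : MeasurableSet Y) {u : ℝ × ℝ → ℂ}
    (hu : Adm (X ×ˢ Y) u) {A : ℝ → ℝ} {B : ℝ × ℝ → ℝ} (hB : Measurable B)
    (hB1 : ∀ ξ, ∫⁻ y in Y, EX (B (ξ, y)) ≤ 1) (s : ℝ) {b : ℝ} (hb : 0 < b) (ξ : ℝ) :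
    ∫⁻ y, ‖tw u (wgt s b A B) (ξ, y)‖ₑ ^ (1 / b) ≤
      X.indicator (fun ξ => EX (s / b * A ξ)) ξ := by
  by_cases hξ : ξ ∈ X
  · rw [indicator_of_mem hξ]
    calc _ ≤ ∫⁻ y, Y.indicator (fun y => EX (s / b * A ξ) * EX (B (ξ, y))) y := by
          refine lintegral_mono fun y => ?_
          by_cases hy : y ∈ Y
          · simp only [indicator_of_mem hy, enorm_tw, wgt]
            rw [ENNReal.mul_rpow_of_nonneg _ _ (by positivity), EX_rpow, ← EX_add]
            have h1 : ‖u (ξ, y)‖ₑ ^ (1 / b) ≤ 1 := by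
              refine ENNReal.rpow_le_one ?_ (by positivity)
              rw [← ofReal_norm, ENNReal.ofReal_le_one]
              exact hu.2.1 _
            refine (mul_le_mul' h1 le_rfl).trans_eq ?_
            rw [one_mul]
            congr 1
            field_simp
          · rw [tw, hu.2.2 _ (by simp [hy])]
            simp [hb]
      _ = EX (s / b * A ξ) * ∫⁻ y in Y, EX (B (ξ, y)) := by
          rw [lintegral_indicator hY, lintegral_const_mul _ (by fun_prop)]
      _ ≤ EX (s / b * A ξ) * 1 := by gcongr; exact hB1 ξ
      _ = _ := mul_one _
  · rw [indicator_of_notMem hξ]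
    refine le_of_eq ?_
    rw [lintegral_eq_zero_of_ae_eq_zero]
    refine Eventually.of_forall fun y => ?_
    dsimp only
    rw [tw, hu.2.2 _ (by simp [hξ])]
    simp [hb]

theorem lintegral_tw_rpow_le' {X Y : Set ℝ} (hY : MeasurableSet Y) {u : ℝ × ℝ → ℂ}
    (hu : Adm (X ×ˢ Y) u) {A : ℝ → ℝ} {B : ℝ × ℝ → ℝ} (hB : Measurable B)
    (hB1 : ∀ ξ, ∫⁻ y in Y, EX (B (ξ, y)) ≤ 1) (s : ℝ) {b : ℝ} (hb : 0 < b) (ξ : ℝ) :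
    ∫⁻ y, ‖tw u (wgt s b A B) (ξ, y)‖ₑ ^ (1 / b) ≤ EX (s / b * A ξ) :=
  (lintegral_tw_rpow_le hY hu hB hB1 s hb ξ).trans (indicator_le_self _ _ _)

theorem lintegral_tw_pow_le {X Y : Set ℝ} (hY : MeasurableSet Y) {u : ℝ × ℝ → ℂ}
    (hu : Adm (X ×ˢ Y) u) {A : ℝ → ℝ} {B : ℝ × ℝ → ℝ} (hB : Measurable B)
    (hB1 : ∀ ξ, ∫⁻ y in Y, EX (B (ξ, y)) ≤ 1) (s : ℝ) {b : ℝ} {n : ℕ} (hn : b * n = 1) (ξ : ℝ) :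
    ∫⁻ y, ‖tw u (wgt s b A B) (ξ, y)‖ₑ ^ n ≤ EX (n * s * A ξ) := by
  have hn0 : n ≠ 0 := by rintro rfl; simp at hn
  have hb : b = 1 / n := by field_simp; exact hn
  have h := lintegral_tw_rpow_le' hY hu (A := A) hB hB1 s (b := b) (by rw [hb]; positivity) ξ
  have e : 1 / b = n := by rw [hb, one_div_one_div]
  rw [div_eq_mul_one_div s b] at h
  simp only [e, ENNReal.rpow_natCast] at h
  refine h.trans_eq ?_
  rw [mul_comm s]

theorem lintegral_lintegral_tw_sq_le {X Y : Set ℝ} (hX : MeasurableSet X) (hY : MeasurableSet Y)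
    {u : ℝ × ℝ → ℂ}
    (hu : Adm (X ×ˢ Y) u) {A : ℝ → ℝ} {B : ℝ × ℝ → ℝ} (hB : Measurable B)
    (hA1 : ∫⁻ ξ in X, EX (A ξ) ≤ 1)
    (hB1 : ∀ ξ, ∫⁻ y in Y, EX (B (ξ, y)) ≤ 1) :
    ∫⁻ ξ, ∫⁻ y, ‖tw u (wgt (1 / 2) (1 / 2) A B) (ξ, y)‖ₑ ^ 2 ≤ 1 := by
  refine (lintegral_mono (g := X.indicator fun ξ => EX (A ξ)) fun ξ => ?_).trans
    ((lintegral_indicator hX _).trans_le hA1)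
  have h := lintegral_tw_rpow_le hY hu (A := A) hB hB1 (1 / 2) (b := 1 / 2) (by norm_num) ξ
  rw [one_div_one_div] at h
  simpa using h

/-- Normalised systems of weights. -/
structure Wts (X Y Z : Set ℝ) (A₁ A₂ A₃ : ℝ → ℝ) (B₁ B₂ B₃ : ℝ × ℝ → ℝ) (M : ℝ) : Prop where
  mX : MeasurableSet X
  mY : MeasurableSet Y
  mZ : MeasurableSet Z
  bX : Bornology.IsBounded X
  bY : Bornology.IsBounded Y
  bZ : Bornology.IsBounded Z
  mA₁ : Measurable A₁
  mA₂ : Measurable A₂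
  mA₃ : Measurable A₃
  mB₁ : Measurable B₁
  mB₂ : Measurable B₂
  mB₃ : Measurable B₃
  bA₁ : ∀ x, |A₁ x| ≤ M
  bA₂ : ∀ x, |A₂ x| ≤ M
  bA₃ : ∀ x, |A₃ x| ≤ M
  bB₁ : ∀ x, |B₁ x| ≤ M
  bB₂ : ∀ x, |B₂ x| ≤ M
  bB₃ : ∀ x, |B₃ x| ≤ M
  iA₁ : ∫⁻ x in X, EX (A₁ x) ≤ 1
  iA₂ : ∫⁻ x in X, EX (A₂ x) ≤ 1
  iA₃ : ∫⁻ x in Z, EX (A₃ x) ≤ 1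
  iB₁ : ∀ x, ∫⁻ y in Y, EX (B₁ (x, y)) ≤ 1
  iB₂ : ∀ x, ∫⁻ y in Y, EX (B₂ (x, y)) ≤ 1
  iB₃ : ∀ x, ∫⁻ y in Z, EX (B₃ (x, y)) ≤ 1

section
variable {ι κ : Type*} [Fintype ι] [Fintype κ] {Il Ir : ι → Set ℝ} {Jl Jr : κ → Set ℝ}
  {X Y Z : Set ℝ} {A₁ A₂ A₃ : ℝ → ℝ} {B₁ B₂ B₃ : ℝ × ℝ → ℝ} {M : ℝ}

theorem Wts.bQ (W : Wts X Y Z A₁ A₂ A₃ B₁ B₂ B₃ M) : Bornology.IsBounded (X ×ˢ Y) := W.bX.prod W.bY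

theorem Wts.bQ₃ (W : Wts X Y Z A₁ A₂ A₃ B₁ B₂ B₃ M) : Bornology.IsBounded (Z ×ˢ Z) := W.bZ.prod W.bZ

theorem Wts.bs₁ (W : Wts X Y Z A₁ A₂ A₃ B₁ B₂ B₃ M) {u : ℝ × ℝ → ℂ} (hu : Adm (X ×ˢ Y) u)
    (s t : ℝ) : BS (tw u (wgt s t A₁ B₁)) :=
  (hu.bs W.bQ).tw (measurable_wgt _ _ W.mA₁ W.mB₁) (abs_wgt_le _ _ W.bA₁ W.bB₁)

theorem Wts.bs₂ (W : Wts X Y Z A₁ A₂ A₃ B₁ B₂ B₃ M) {u : ℝ × ℝ → ℂ} (hu : Adm (X ×ˢ Y) u)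
    (s t : ℝ) : BS (tw u (wgt s t A₂ B₂)) :=
  (hu.bs W.bQ).tw (measurable_wgt _ _ W.mA₂ W.mB₂) (abs_wgt_le _ _ W.bA₂ W.bB₂)

theorem Wts.bs₃ (W : Wts X Y Z A₁ A₂ A₃ B₁ B₂ B₃ M) {u : ℝ × ℝ → ℂ} (hu : Adm (Z ×ˢ Z) u)
    (s t : ℝ) : BS (tw u (wgt s t A₃ B₃)) :=
  (hu.bs W.bQ₃).tw (measurable_wgt _ _ W.mA₃ W.mB₃) (abs_wgt_le _ _ W.bA₃ W.bB₃)

theorem Wts.est_of_lintegral (W : Wts X Y Z A₁ A₂ A₃ B₁ B₂ B₃ M) (hI : Sys Il Ir) (hJ : Sys Jl Jr)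
    {C : ℝ} (hC : 0 ≤ C) (a b c d : ℝ)
    (h : ∀ u₁ u₂ u₃, Adm (X ×ˢ Y) u₁ → Adm (X ×ˢ Y) u₂ → Adm (Z ×ˢ Z) u₃ →
      ∫⁻ z, ‖tw u₃ (wgt (1 - a - d) (1 - b - c) A₃ B₃) z‖ₑ *
        ‖bil Il Ir Jl Jr (tw u₁ (wgt (1 - a) b A₁ B₁)) (tw u₂ (wgt (1 - c) d A₂ B₂)) z‖ₑ ≤
        ENNReal.ofReal C) :
    Est (kB Il Ir Jl Jr) (X ×ˢ Y) (Z ×ˢ Z) A₁ A₂ A₃ B₁ B₂ B₃ C (a, b, c, d) := by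
  intro u₁ u₂ u₃ h₁ h₂ h₃
  rw [Tri_kB hI hJ (W.bs₁ h₁ _ _) (W.bs₂ h₂ _ _) (W.bs₃ h₃ _ _)]
  rw [← ENNReal.ofReal_le_ofReal_iff hC, ofReal_norm]
  refine (enorm_integral_le_lintegral_enorm _).trans (le_trans (le_of_eq ?_) (h u₁ u₂ u₃ h₁ h₂ h₃))
  exact lintegral_congr fun z => enorm_mul _ _

theorem ofReal_le_of_sq_le {x : ℝ≥0∞} {C : ℝ} (hC : 0 ≤ C) (h : x ^ 2 ≤ ENNReal.ofReal (C ^ 2)) :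
    x ≤ ENNReal.ofReal C := by
  rwa [ENNReal.ofReal_pow hC, ENNReal.pow_le_pow_left_iff two_ne_zero] at h

theorem sum_lintegral_EX_le {A : ℝ → ℝ} {J : ι → Set ℝ} (hm : ∀ i, MeasurableSet (J i))
    (hd : Pairwise fun i j => Disjoint (J i) (J j)) (hJ : ∀ i, J i ⊆ X)
    (hA : ∫⁻ x in X, EX (A x) ≤ 1) : ∑ i, ∫⁻ x in J i, EX (A x) ≤ 1 := by
  rw [← tsum_fintype (L := SummationFilter.unconditional ι), ← lintegral_iUnion hm hd]
  exact (lintegral_mono_set (iUnion_subset hJ)).trans hA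

theorem lintegral_tw_eq (hY : MeasurableSet Y) (hX : MeasurableSet X) {u : ℝ × ℝ → ℂ}
    {A : ℝ → ℝ} {B : ℝ × ℝ → ℝ} (hu : Adm (X ×ˢ Y) u)
    (hA : Measurable A) (hB : Measurable B) (hA1 : ∫⁻ ξ in X, EX (A ξ) ≤ 1)
    (hB1 : ∀ ξ, ∫⁻ y in Y, EX (B (ξ, y)) ≤ 1) :
    ∫⁻ z, ‖tw u (wgt (1 / 2) (1 / 2) A B) z‖ₑ ^ 2 ≤ 1 := by
  have hm : Measurable fun z => ‖tw u (wgt (1 / 2) (1 / 2) A B) z‖ₑ ^ 2 := by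
    refine (Measurable.enorm ?_).pow_const 2
    have := measurable_wgt (1 / 2) (1 / 2) hA hB
    exact hu.1.mul (by fun_prop)
  rw [Measure.volume_eq_prod, lintegral_prod _ hm.aemeasurable]
  exact lintegral_lintegral_tw_sq_le hX hY hu hB hA1 hB1

theorem Wts.est_outer (W : Wts X Y Z A₁ A₂ A₃ B₁ B₂ B₃ M) (hI : Sys Il Ir) (hJ : Sys Jl Jr)
    (hIX : ∀ i, Il i ⊆ X) (hJX : ∀ j, Jr j ⊆ X) {C : ℝ} (hC : 0 ≤ C) {μ ν : ℝ}
    (hμν : μ * ν ≤ C ^ 2) (hν0 : 0 ≤ ν)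
    (hμ : ∀ i, ∫⁻ ξ in Il i, EX (A₁ ξ) ≤ ENNReal.ofReal μ)
    (hν : ∀ j, ∫⁻ ξ in Jr j, EX (A₂ ξ) ≤ ENNReal.ofReal ν) :
    Est (kB Il Ir Jl Jr) (X ×ˢ Y) (Z ×ˢ Z) A₁ A₂ A₃ B₁ B₂ B₃ C (0, 1 / 2, 0, 1 / 2) := by
  refine W.est_of_lintegral hI hJ hC _ _ _ _ fun u₁ u₂ u₃ h₁ h₂ h₃ => ofReal_le_of_sq_le hC ?_
  refine (lintegral_bil_le_outer hI hJ (W.bs₁ h₁ _ _) (W.bs₂ h₂ _ _)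
    (W.bs₃ h₃ _ _).1.enorm ?_ W.mA₁ W.mA₂ (fun ξ => ?_) (fun ξ => ?_) hμ hν
    (sum_lintegral_EX_le hI.ml hI.dl hIX W.iA₁) (sum_lintegral_EX_le hJ.mr hJ.dr hJX W.iA₂)).trans ?_
  · convert lintegral_tw_eq W.mZ W.mZ h₃ W.mA₃ W.mB₃ W.iA₃ W.iB₃ using 5; norm_num
  · refine (lintegral_tw_pow_le W.mY h₁ W.mB₁ W.iB₁ _ (by norm_num) ξ).trans_eq ?_
    norm_num
  · refine (lintegral_tw_pow_le W.mY h₂ W.mB₂ W.iB₂ _ (by norm_num) ξ).trans_eq ?_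
    norm_num
  · rw [← ENNReal.ofReal_mul' hν0]
    exact ENNReal.ofReal_le_ofReal hμν

theorem Wts.est_sq (W : Wts X Y Z A₁ A₂ A₃ B₁ B₂ B₃ M) (hI : Sys Il Ir) (hJ : Sys Jl Jr)
    {C : ℝ} (hC : 1 ≤ C) :
    Est (kB Il Ir Jl Jr) (X ×ˢ Y) (Z ×ˢ Z) A₁ A₂ A₃ B₁ B₂ B₃ C (1 / 2, 1 / 2, 1 / 2, 1 / 2) := by
  have hC0 : 0 ≤ C := by linarith
  refine W.est_of_lintegral hI hJ hC0 _ _ _ _ fun u₁ u₂ u₃ h₁ h₂ h₃ => ofReal_le_of_sq_le hC0 ?_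
  refine (lintegral_bil_le_sq hI hJ (W.bs₁ h₁ _ _) (W.bs₂ h₂ _ _)
    (W.bs₃ h₃ _ _).1.enorm (fun z => ?_) ?_ ?_).trans (ENNReal.one_le_ofReal.2 (one_le_pow₀ hC))
  · rw [enorm_tw, wgt]
    norm_num
    rw [← ofReal_norm, ENNReal.ofReal_le_one]
    exact h₃.2.1 _
  · convert lintegral_lintegral_tw_sq_le W.mX W.mY h₁ W.mB₁ W.iA₁ W.iB₁ using 7; norm_num
  · convert lintegral_lintegral_tw_sq_le W.mX W.mY h₂ W.mB₂ W.iA₂ W.iB₂ using 7; norm_num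

theorem Wts.est_mixed (W : Wts X Y Z A₁ A₂ A₃ B₁ B₂ B₃ M) (hI : Sys Il Ir) (hJ : Sys Jl Jr)
    (hJX : ∀ j, Jr j ⊆ X)
    {C : ℝ} (hC : 1 ≤ C) :
    Est (kB Il Ir Jl Jr) (X ×ˢ Y) (Z ×ˢ Z) A₁ A₂ A₃ B₁ B₂ B₃ C (1 / 2, 1 / 2, 0, 1 / 2) := by
  have hC0 : 0 ≤ C := by linarith
  refine W.est_of_lintegral hI hJ hC0 _ _ _ _ fun u₁ u₂ u₃ h₁ h₂ h₃ => ofReal_le_of_sq_le hC0 ?_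
  refine (lintegral_bil_le_mixed hI hJ (W.bs₁ h₁ _ _) (W.bs₂ h₂ _ _)
    (W.bs₃ h₃ _ _).1.enorm (fun x => ?_) W.mA₂ ?_ (fun ξ => ?_)
    (sum_lintegral_EX_le hJ.mr hJ.dr hJX W.iA₂)).trans (ENNReal.one_le_ofReal.2 (one_le_pow₀ hC))
  · refine (lintegral_tw_pow_le W.mZ h₃ W.mB₃ W.iB₃ _ (by norm_num) x).trans_eq ?_
    norm_num
  · convert lintegral_lintegral_tw_sq_le W.mX W.mY h₁ W.mB₁ W.iA₁ W.iB₁ using 7; norm_num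
  · refine (lintegral_tw_pow_le W.mY h₂ W.mB₂ W.iB₂ _ (by norm_num) ξ).trans_eq ?_
    norm_num

theorem Wts.est_mixed' (W : Wts X Y Z A₁ A₂ A₃ B₁ B₂ B₃ M) (hI : Sys Il Ir) (hJ : Sys Jl Jr)
    (hIX : ∀ j, Il j ⊆ X)
    {C : ℝ} (hC : 1 ≤ C) :
    Est (kB Il Ir Jl Jr) (X ×ˢ Y) (Z ×ˢ Z) A₁ A₂ A₃ B₁ B₂ B₃ C (0, 1 / 2, 1 / 2, 1 / 2) := by
  have hC0 : 0 ≤ C := by linarith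
  refine W.est_of_lintegral hI hJ hC0 _ _ _ _ fun u₁ u₂ u₃ h₁ h₂ h₃ => ofReal_le_of_sq_le hC0 ?_
  have m₃ := (W.bs₃ h₃ (1 - 0 - 1 / 2) (1 - 1 / 2 - 1 / 2)).1.enorm
  have m : Measurable fun z : ℝ × ℝ =>
      ‖tw u₃ (wgt (1 - 0 - 1 / 2) (1 - 1 / 2 - 1 / 2) A₃ B₃) z.swap‖ₑ := m₃.comp measurable_swap
  rw [← lintegral_bil_swap]
  refine (lintegral_bil_le_mixed hJ.symm hI.symm (W.bs₂ h₂ _ _) (W.bs₁ h₁ _ _)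
    m (fun x => ?_) W.mA₁ ?_ (fun ξ => ?_)
    (sum_lintegral_EX_le hI.ml hI.dl hIX W.iA₁)).trans (ENNReal.one_le_ofReal.2 (one_le_pow₀ hC))
  · calc _ ≤ ∫⁻ y, Z.indicator (fun y => EX (A₃ y)) y := by
          refine lintegral_mono fun y => ?_
          rw [Prod.swap_prod_mk]
          by_cases hy : y ∈ Z
          · rw [indicator_of_mem hy, enorm_tw, wgt, mul_pow, EX_pow]
            have h1 : ‖u₃ (y, x)‖ₑ ^ 2 ≤ 1 := by
              refine pow_le_one₀ zero_le ?_
              rw [← ofReal_norm, ENNReal.ofReal_le_one]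
              exact h₃.2.1 _
            refine (mul_le_mul' h1 le_rfl).trans_eq ?_
            norm_num
            congr 1
            ring
          · rw [tw, h₃.2.2 _ (by simp [hy])]
            simp
      _ ≤ 1 := by rw [lintegral_indicator W.mZ]; exact W.iA₃
  · convert lintegral_lintegral_tw_sq_le W.mX W.mY h₂ W.mB₂ W.iA₂ W.iB₂ using 7; norm_num
  · refine (lintegral_tw_pow_le W.mY h₁ W.mB₁ W.iB₁ _ (by norm_num) ξ).trans_eq ?_
    norm_num

theorem Wts.est_half (W : Wts X Y Z A₁ A₂ A₃ B₁ B₂ B₃ M) (hI : Sys Il Ir) (hJ : Sys Jl Jr)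
    (hIX : ∀ i, Il i ⊆ X) (hJX : ∀ j, Jr j ⊆ X) {k : ℕ} {δ : ℝ} (hk : δ * (2 * k) = 1)
    (h0 : 0 < δ) (hδ : δ ≤ 1 / 2) {R : ℝ} (hR : RieszBd k (ENNReal.ofReal R)) (hR1 : 1 ≤ R) {C : ℝ}
    (hC0 : 0 ≤ C) (hC : 2 * R ^ (2 * δ) ≤ C ^ 2) :
    Est (kB Il Ir Jl Jr) (X ×ˢ Y) (Z ×ˢ Z) A₁ A₂ A₃ B₁ B₂ B₃ C (1 / 2 - δ, 1 / 2, 0, δ) := by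
  refine W.est_of_lintegral hI hJ hC0 _ _ _ _ fun u₁ u₂ u₃ h₁ h₂ h₃ => ofReal_le_of_sq_le hC0 ?_
  refine (lintegral_bil_le_half (θ := 2 * δ) (by linarith) ⟨by linarith, by linarith⟩ hR
    (by simpa using hR1) ENNReal.ofReal_ne_top hI hJ (W.bs₁ h₁ _ _) (W.bs₂ h₂ _ _)
    (W.bs₃ h₃ _ _).1.enorm ?_ W.mA₁ W.bA₁ W.mA₂ (fun ξ => ?_) (fun ξ => ?_)
    (sum_lintegral_EX_le hI.ml hI.dl hIX W.iA₁) (sum_lintegral_EX_le hJ.mr hJ.dr hJX W.iA₂)).trans ?_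
  · convert lintegral_tw_eq W.mZ W.mZ h₃ W.mA₃ W.mB₃ W.iA₃ W.iB₃ using 5; ring_nf
  · refine (lintegral_tw_pow_le W.mY h₁ W.mB₁ W.iB₁ _ (by norm_num) ξ).trans_eq ?_
    congr 1
    push_cast
    ring
  · refine (lintegral_tw_pow_le W.mY h₂ W.mB₂ W.iB₂ _ (by push_cast; exact hk) ξ).trans_eq ?_
    congr 1
    push_cast
    ring
  · rw [ENNReal.ofReal_rpow_of_pos (by linarith)]
    refine le_trans (le_of_eq ?_) (ENNReal.ofReal_le_ofReal hC)
    rw [ENNReal.ofReal_mul zero_le_two, ENNReal.ofReal_ofNat]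

theorem Wts.est_half' (W : Wts X Y Z A₁ A₂ A₃ B₁ B₂ B₃ M) (hI : Sys Il Ir) (hJ : Sys Jl Jr)
    (hIX : ∀ i, Il i ⊆ X) (hJX : ∀ j, Jr j ⊆ X) {k : ℕ} {δ : ℝ} (hk : δ * (2 * k) = 1)
    (h0 : 0 < δ) (hδ : δ ≤ 1 / 2) {R : ℝ} (hR : RieszBd k (ENNReal.ofReal R)) (hR1 : 1 ≤ R) {C : ℝ}
    (hC0 : 0 ≤ C) (hC : 2 * R ^ (2 * δ) ≤ C ^ 2) :
    Est (kB Il Ir Jl Jr) (X ×ˢ Y) (Z ×ˢ Z) A₁ A₂ A₃ B₁ B₂ B₃ C (0, δ, 1 / 2 - δ, 1 / 2) := by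
  refine W.est_of_lintegral hI hJ hC0 _ _ _ _ fun u₁ u₂ u₃ h₁ h₂ h₃ => ofReal_le_of_sq_le hC0 ?_
  have m₃ := (W.bs₃ h₃ (1 - 0 - 1 / 2) (1 - δ - (1 / 2 - δ))).1.enorm
  have m : Measurable fun z : ℝ × ℝ =>
      ‖tw u₃ (wgt (1 - 0 - 1 / 2) (1 - δ - (1 / 2 - δ)) A₃ B₃) z.swap‖ₑ := m₃.comp measurable_swap
  rw [← lintegral_bil_swap]
  refine (lintegral_bil_le_half (θ := 2 * δ) (by linarith) ⟨by linarith, by linarith⟩ hR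
    (by simpa using hR1) ENNReal.ofReal_ne_top hJ.symm hI.symm (W.bs₂ h₂ _ _) (W.bs₁ h₁ _ _)
    m ?_ W.mA₂ W.bA₂ W.mA₁ (fun ξ => ?_) (fun ξ => ?_)
    (sum_lintegral_EX_le hJ.mr hJ.dr hJX W.iA₂) (sum_lintegral_EX_le hI.ml hI.dl hIX W.iA₁)).trans ?_
  · have e := (Measure.measurePreserving_swap (μ := (volume : Measure ℝ))
      (ν := (volume : Measure ℝ))).lintegral_comp (m₃.pow_const 2)
    rw [Measure.volume_eq_prod]
    refine e.trans_le ?_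
    rw [show (1 : ℝ) - 0 - 1 / 2 = 1 / 2 by norm_num, show 1 - δ - (1 / 2 - δ) = 1 / 2 by ring]
    exact lintegral_tw_eq W.mZ W.mZ h₃ W.mA₃ W.mB₃ W.iA₃ W.iB₃
  · refine (lintegral_tw_pow_le W.mY h₂ W.mB₂ W.iB₂ _ (by norm_num) ξ).trans_eq ?_
    congr 1
    push_cast
    ring
  · refine (lintegral_tw_pow_le W.mY h₁ W.mB₁ W.iB₁ _ (by push_cast; exact hk) ξ).trans_eq ?_
    congr 1
    push_cast
    ring
  · rw [ENNReal.ofReal_rpow_of_pos (by linarith)]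
    refine le_trans (le_of_eq ?_) (ENNReal.ofReal_le_ofReal hC)
    rw [ENNReal.ofReal_mul zero_le_two, ENNReal.ofReal_ofNat]

theorem Wts.est_dual (W : Wts X Y Z A₁ A₂ A₃ B₁ B₂ B₃ M) (hI : Sys Il Ir) (hJ : Sys Jl Jr)
    (hIX : ∀ i, Il i ⊆ X) (hJX : ∀ j, Jr j ⊆ X) {b d : ℝ} (hb0 : 0 < b) (hb1 : b < 1)
    (hd0 : 0 < d) (hd1 : d < 1) {D₁ D₂ C : ℝ} (hD₁ : DualBd b (ENNReal.ofReal D₁))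
    (hD₂ : DualBd d (ENNReal.ofReal D₂)) (hD : 0 ≤ D₂) (hC : D₁ * D₂ ≤ C) (hC0 : 0 ≤ C) :
    Est (kB Il Ir Jl Jr) (X ×ˢ Y) (Z ×ˢ Z) A₁ A₂ A₃ B₁ B₂ B₃ C (0, b, 0, d) := by
  refine W.est_of_lintegral hI hJ hC0 _ _ _ _ fun u₁ u₂ u₃ h₁ h₂ h₃ => ?_
  refine (lintegral_bil_le_dual hd1 hD₁ hD₂ hI hJ (W.bs₁ h₁ _ _) (W.bs₂ h₂ _ _)
    (W.bs₃ h₃ _ _).1.enorm ?_ W.mA₁ W.mA₂ (fun ξ => ?_) (fun ξ => ?_)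
    (sum_lintegral_EX_le hI.ml hI.dl hIX W.iA₁) (sum_lintegral_EX_le hJ.mr hJ.dr hJX W.iA₂)).trans ?_
  · refine (lintegral_mono (g := Z.indicator fun x => EX (A₃ x)) fun x => ?_).trans
      ((lintegral_indicator W.mZ _).trans_le W.iA₃)
    have hb' : 0 < 1 - b := by linarith
    have hd' : 0 < 1 - d := by linarith
    have h := lintegral_tw_rpow_le W.mZ h₃ (A := A₃) W.mB₃ W.iB₃ (1 - 0 - d) hb' x
    rw [sub_zero (1 - b)]
    refine (ENNReal.rpow_le_rpow h (by positivity)).trans_eq ?_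
    by_cases hx : x ∈ Z
    · rw [indicator_of_mem hx, indicator_of_mem hx, EX_rpow]
      congr 1
      field_simp
      ring
    · rw [indicator_of_notMem hx, indicator_of_notMem hx, ENNReal.zero_rpow_of_pos (by positivity)]
  · refine (ENNReal.rpow_le_rpow (lintegral_tw_rpow_le' W.mY h₁ W.mB₁ W.iB₁ _ hb0 ξ) hb0.le).trans_eq ?_
    rw [EX_rpow]
    congr 1
    field_simp
    ring
  · refine (ENNReal.rpow_le_rpow (lintegral_tw_rpow_le' W.mY h₂ W.mB₂ W.iB₂ _ hd0 ξ) hd0.le).trans_eq ?_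
    rw [EX_rpow]
    congr 1
    field_simp
    ring
  · rw [← ENNReal.ofReal_mul' hD]
    exact ENNReal.ofReal_le_ofReal hC

end

theorem exists_interpolation_weights {a b c d : ℝ} (ha : 0 < a) (hc : 0 < c)
    (hab : a < b) (hb : a + b < 1) (hcd : c < d) (hd : c + d < 1)
    (had : a + d < 1) (hbc : b + c < 1) :
    ∃ w lam mu : ℝ, 0 < w ∧ w < 2 * a ∧ w < 2 * c ∧ 0 < 1 + w - 2 * a - 2 * c ∧ 0 < lam ∧ lam < 1 ∧
      0 < mu ∧ mu < 1 ∧ b = a + lam * (1 - 2 * a - c + w / 2) ∧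
      d = c + mu * (1 - a - 2 * c + w / 2) := by
  obtain ⟨w, hw1, hw2⟩ := exists_between (show max (max 0 (2 * a + 2 * c - 1))
    (max (2 * (a + b + c - 1)) (2 * (a + c + d - 1))) < min (2 * a) (2 * c) by
      simp only [max_lt_iff, lt_min_iff]
      refine ⟨⟨⟨?_, ?_⟩, ?_, ?_⟩, ⟨?_, ?_⟩, ?_, ?_⟩ <;> linarith)
  simp only [max_lt_iff, lt_min_iff] at hw1 hw2
  obtain ⟨⟨h1, h2⟩, h3, h4⟩ := hw1
  have e1 : 0 < 1 - 2 * a - c + w / 2 := by linarith [hw2.2]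
  have e2 : 0 < 1 - a - 2 * c + w / 2 := by linarith [hw2.1]
  refine ⟨w, (b - a) / (1 - 2 * a - c + w / 2), (d - c) / (1 - a - 2 * c + w / 2), h1, hw2.1, hw2.2,
    by linarith, div_pos (by linarith) e1, (div_lt_one e1).2 (by linarith),
    div_pos (by linarith) e2, (div_lt_one e2).2 (by linarith), ?_, ?_⟩
  · rw [div_mul_cancel₀ _ e1.ne']; ring
  · rw [div_mul_cancel₀ _ e2.ne']; ring

theorem convex_combination_mem {w s r u v O ε b d δ : ℝ} (hw : 0 ≤ w) (hs : 0 ≤ s) (hr : 0 ≤ r)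
    (hu : 0 ≤ u) (hv : 0 ≤ v) (hO : 0 < O) (hO1 : O < 1) (hsum : w + s + r + u + v + O = 1)
    (_ : 0 < ε) (hε1 : ε < 1) (hδ2 : δ < 1 / 2) (hb1 : δ ≤ b)
    (hb2 : b ≤ 1 - δ) (hd1 : δ ≤ d) (hd2 : d ≤ 1 - δ) :
    ∃ y : ℝ × ℝ × ℝ × ℝ, ((w + s) / 2 + (1 / 2 - δ) * u,
      (O * ε + w + s + u + r) / 2 + δ * v + (1 - ε) * O * b,
      (w + r) / 2 + (1 / 2 - δ) * v, (O * ε + w + s + r + v) / 2 + δ * u + (1 - ε) * O * d) =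
      (1 - O * ε) • y + (O * ε) • ((0 : ℝ), (1 / 2 : ℝ), (0 : ℝ), (1 / 2 : ℝ)) ∧
      ∀ S : Set (ℝ × ℝ × ℝ × ℝ), Convex ℝ S → (1 / 2, 1 / 2, 1 / 2, 1 / 2) ∈ S →
        (1 / 2, 1 / 2, 0, 1 / 2) ∈ S → (0, 1 / 2, 1 / 2, 1 / 2) ∈ S →
        (1 / 2 - δ, 1 / 2, 0, δ) ∈ S → (0, δ, 1 / 2 - δ, 1 / 2) ∈ S →
        (∀ b d, (b = δ ∨ b = 1 - δ) → (d = δ ∨ d = 1 - δ) → (0, b, 0, d) ∈ S) → y ∈ S := by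
  obtain ⟨D, hD⟩ : ∃ D, D = 1 - O * ε := ⟨_, rfl⟩
  have hD0 : 0 < D := by nlinarith
  have hε' : 0 < 1 - ε := by linarith
  have hOε : 0 ≤ O * (1 - ε) := by positivity
  obtain ⟨Z, hZ⟩ : ∃ Z : Fin 6 → ℝ × ℝ × ℝ × ℝ, Z = ![(1 / 2, 1 / 2, 1 / 2, 1 / 2),
    (1 / 2, 1 / 2, 0, 1 / 2), (0, 1 / 2, 1 / 2, 1 / 2), (1 / 2 - δ, 1 / 2, 0, δ),
    (0, δ, 1 / 2 - δ, 1 / 2), (0, b, 0, d)] := ⟨_, rfl⟩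
  obtain ⟨W, hW⟩ : ∃ W : Fin 6 → ℝ, W = ![w / D, s / D, r / D, u / D, v / D, O * (1 - ε) / D] :=
    ⟨_, rfl⟩
  refine ⟨∑ i, W i • Z i, ?_, ?_⟩
  · have hs : ∀ i, (1 - O * ε) • (W i • Z i) = (D * W i) • Z i := fun i => by
      rw [smul_smul, hD]
    have hDW : ∀ x, D * (x / D) = x := fun x => by field_simp
    rw [Finset.smul_sum]
    simp only [hs]
    simp only [Fin.sum_univ_six, hW, hZ, Matrix.cons_val, hDW, Prod.smul_mk, Prod.mk_add_mk,
      smul_eq_mul, Prod.mk.injEq]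
    refine ⟨?_, ?_, ?_, ?_⟩ <;> ring
  · intro S hS h1 h2 h3 h4 h5 h6
    have hne : 0 < 1 - 2 * δ := by linarith
    have hne' := hne.ne'
    have hone : ∀ t, (1 - δ - t) / (1 - 2 * δ) + (t - δ) / (1 - 2 * δ) = 1 := fun t => by
      rw [← add_div, div_eq_one_iff_eq hne']; ring
    have hcomb : ∀ t, t = (1 - δ - t) / (1 - 2 * δ) * δ + (t - δ) / (1 - 2 * δ) * (1 - δ) := fun t => by
      rw [div_mul_eq_mul_div, div_mul_eq_mul_div, ← add_div, eq_div_iff hne']; ring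
    have hsame : ∀ t x, x = (1 - δ - t) / (1 - 2 * δ) * x + (t - δ) / (1 - 2 * δ) * x := fun t x => by
      rw [← add_mul, hone, one_mul]
    have h7 : ∀ b₀, (b₀ = δ ∨ b₀ = 1 - δ) → ((0 : ℝ), b₀, (0 : ℝ), d) ∈ S := fun b₀ hb₀ => by
      have := hS (h6 b₀ δ hb₀ (Or.inl rfl)) (h6 b₀ (1 - δ) hb₀ (Or.inr rfl))
        (a := (1 - δ - d) / (1 - 2 * δ)) (b := (d - δ) / (1 - 2 * δ))
        (div_nonneg (by linarith) hne.le) (div_nonneg (by linarith) hne.le)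
        (hone _)
      convert this using 1
      simp only [Prod.smul_mk, Prod.mk_add_mk, smul_eq_mul, Prod.mk.injEq]
      exact ⟨hsame _ _, hsame _ _, hsame _ _, hcomb _⟩
    have h8 : ((0 : ℝ), b, (0 : ℝ), d) ∈ S := by
      have := hS (h7 δ (Or.inl rfl)) (h7 (1 - δ) (Or.inr rfl))
        (a := (1 - δ - b) / (1 - 2 * δ)) (b := (b - δ) / (1 - 2 * δ))
        (div_nonneg (by linarith) hne.le) (div_nonneg (by linarith) hne.le)
        (hone _)
      convert this using 1
      simp only [Prod.smul_mk, Prod.mk_add_mk, smul_eq_mul, Prod.mk.injEq]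
      exact ⟨hsame _ _, hcomb _, hsame _ _, hsame _ _⟩
    refine hS.sum_mem (fun i _ => ?_) ?_ (fun i _ => ?_)
    · rw [hW]
      fin_cases i <;> simp only [Fin.zero_eta, Fin.mk_one, Fin.reduceFinMk, Matrix.cons_val] <;>
        positivity
    · simp only [Fin.sum_univ_six, hW, Matrix.cons_val]
      field_simp
      rw [hD]
      linear_combination hsum
    · rw [hZ]
      fin_cases i <;> simp only [Fin.zero_eta, Fin.mk_one, Fin.reduceFinMk, Matrix.cons_val] <;>
        assumption

set_option maxHeartbeats 1000000 in
theorem exists_convex_decomposition {a b c d : ℝ} (ha : 0 < a) (hc : 0 < c)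
    (hab : a < b) (hb : a + b < 1) (hcd : c < d) (hd : c + d < 1)
    (had : a + d < 1) (hbc : b + c < 1) :
    ∃ (k : ℕ) (δ : ℝ), k ≠ 0 ∧ δ * (2 * k) = 1 ∧ 0 < δ ∧ δ < 1 / 2 ∧ ∃ τ : ℝ, 0 < τ ∧ τ < 1 ∧
      ∃ y : ℝ × ℝ × ℝ × ℝ, (a, b, c, d) = (1 - τ) • y + τ • ((0 : ℝ), (1 / 2 : ℝ), (0 : ℝ), (1 / 2 : ℝ)) ∧
      ∀ S : Set (ℝ × ℝ × ℝ × ℝ), Convex ℝ S → (1 / 2, 1 / 2, 1 / 2, 1 / 2) ∈ S →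
        (1 / 2, 1 / 2, 0, 1 / 2) ∈ S → (0, 1 / 2, 1 / 2, 1 / 2) ∈ S →
        (1 / 2 - δ, 1 / 2, 0, δ) ∈ S → (0, δ, 1 / 2 - δ, 1 / 2) ∈ S →
        (∀ b d, (b = δ ∨ b = 1 - δ) → (d = δ ∨ d = 1 - δ) → (0, b, 0, d) ∈ S) → y ∈ S := by
  obtain ⟨w, lam, mu, hw0, hwa, hwc, h00, hl0, hl1, hm0, hm1, hbe, hde⟩ :=
    exists_interpolation_weights ha hc hab hb hcd hd had hbc
  obtain ⟨u, hu⟩ : ∃ u : ℝ, u = (1 - mu) * (2 * a - w) := ⟨_, rfl⟩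
  obtain ⟨v, hv⟩ : ∃ v : ℝ, v = (1 - lam) * (2 * c - w) := ⟨_, rfl⟩
  have hu0 : 0 < u := hu ▸ mul_pos (by linarith) (by linarith)
  have hv0 : 0 < v := hv ▸ mul_pos (by linarith) (by linarith)
  obtain ⟨s, hs⟩ : ∃ s : ℝ → ℝ, ∀ δ, s δ = 2 * a - w - (1 - 2 * δ) * u :=
    ⟨_, fun _ => rfl⟩
  obtain ⟨r, hr⟩ : ∃ r : ℝ → ℝ, ∀ δ, r δ = 2 * c - w - (1 - 2 * δ) * v :=
    ⟨_, fun _ => rfl⟩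
  obtain ⟨o, ho⟩ : ∃ o : ℝ → ℝ, ∀ δ, o δ = 1 - w - s δ - u - r δ - v :=
    ⟨_, fun _ => rfl⟩
  obtain ⟨β, hβ⟩ : ∃ β : ℝ → ℝ, ∀ δ, β δ = b - (w + s δ + u + r δ) / 2 - δ * v :=
    ⟨_, fun _ => rfl⟩
  obtain ⟨γ, hγ⟩ : ∃ γ : ℝ → ℝ, ∀ δ, γ δ = d - (w + s δ + r δ + v) / 2 - δ * u :=
    ⟨_, fun _ => rfl⟩
  have o0 : o 0 = 1 + w - 2 * a - 2 * c := by simp only [ho, hs, hr]; ring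
  have β0 : β 0 = lam * (1 + w - 2 * a - 2 * c) := by
    simp only [hβ, hs, hr, hu, hv, hbe]; ring
  have γ0 : γ 0 = mu * (1 + w - 2 * a - 2 * c) := by
    simp only [hγ, hs, hr, hu, hv, hde]; ring
  have cs : Continuous s := by rw [funext hs]; fun_prop
  have cr : Continuous r := by rw [funext hr]; fun_prop
  have co : Continuous o := by rw [funext ho]; fun_prop
  have cβ : Continuous β := by rw [funext hβ]; fun_prop
  have cγ : Continuous γ := by rw [funext hγ]; fun_prop
  have ev : ∀ᶠ δ in 𝓝 (0 : ℝ), 0 < o δ ∧ (δ * o δ < β δ ∧ β δ < (1 - δ) * o δ) ∧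
      (δ * o δ < γ δ ∧ γ δ < (1 - δ) * o δ) ∧ δ < 1 / 2 := by
    have L : ∀ {f g : ℝ → ℝ}, Continuous f → Continuous g → f 0 < g 0 →
      ∀ᶠ δ in 𝓝 (0 : ℝ), f δ < g δ := fun hf hg h => hf.continuousAt.eventually_lt hg.continuousAt h
    refine (L continuous_const co ?_).and (((L ?_ cβ ?_).and (L cβ ?_ ?_)).and
      (((L ?_ cγ ?_).and (L cγ ?_ ?_)).and (L continuous_id continuous_const (by norm_num))))
    · rw [o0]; exact h00
    · fun_prop
    · rw [β0, zero_mul]; positivity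
    · fun_prop
    · rw [β0, o0]; nlinarith
    · fun_prop
    · rw [γ0, zero_mul]; positivity
    · fun_prop
    · rw [γ0, o0]; nlinarith
  have ht : Tendsto (fun n : ℕ => 1 / (2 * ((n : ℝ) + 1))) atTop (𝓝 0) := by
    have := (tendsto_one_div_add_atTop_nhds_zero_nat (𝕜 := ℝ)).const_mul (1 / 2)
    rw [mul_zero] at this
    refine this.congr fun n => ?_
    field_simp
  obtain ⟨n, hn⟩ := (ht.eventually ev).exists
  obtain ⟨δ, hδ⟩ : ∃ δ : ℝ, δ = 1 / (2 * ((n : ℝ) + 1)) := ⟨_, rfl⟩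
  rw [← hδ] at hn
  have hδ0 : 0 < δ := by rw [hδ]; positivity
  obtain ⟨ho0, ⟨hβ1, hβ2⟩, ⟨hγ1, hγ2⟩, hδ2⟩ := hn
  have ev2 : ∀ᶠ ε in 𝓝[>] (0 : ℝ), (δ * (1 - ε) * o δ < β δ - ε / 2 * o δ ∧
      β δ - ε / 2 * o δ < (1 - δ) * (1 - ε) * o δ) ∧ (δ * (1 - ε) * o δ < γ δ - ε / 2 * o δ ∧
      γ δ - ε / 2 * o δ < (1 - δ) * (1 - ε) * o δ) ∧ ε < 1 := by
    refine Filter.Eventually.filter_mono nhdsWithin_le_nhds ?_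
    have L : ∀ {f g : ℝ → ℝ}, Continuous f → Continuous g → f 0 < g 0 →
      ∀ᶠ δ in 𝓝 (0 : ℝ), f δ < g δ := fun hf hg h => hf.continuousAt.eventually_lt hg.continuousAt h
    refine ((L ?_ ?_ ?_).and (L ?_ ?_ ?_)).and
      (((L ?_ ?_ ?_).and (L ?_ ?_ ?_)).and (L continuous_id continuous_const (by norm_num)))
    all_goals first | fun_prop | (norm_num; linarith)
  obtain ⟨ε, hε, hε0⟩ := (ev2.and self_mem_nhdsWithin).exists
  obtain ⟨⟨p1, p2⟩, ⟨p3, p4⟩, hε1⟩ := hε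
  have hs0 : 0 ≤ s δ := by
    have : s δ = mu * (2 * a - w) + 2 * δ * u := by simp only [hs, hu]; ring
    rw [this]
    have : 0 < 2 * a - w := by linarith
    positivity
  have hr0 : 0 ≤ r δ := by
    have : r δ = lam * (2 * c - w) + 2 * δ * v := by simp only [hr, hv]; ring
    rw [this]
    have : 0 < 2 * c - w := by linarith
    positivity
  have e1 := hs δ
  have e2 := hr δ
  have e3 := ho δ
  have e4 := hβ δ
  have e5 := hγ δ
  have hO1 : o δ < 1 := by linarith
  have hε1' : 0 < 1 - ε := by linarith
  obtain ⟨y, hy, hS⟩ := convex_combination_mem hw0.le hs0 hr0 hu0.le hv0.le ho0 hO1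
    (by linarith) hε0 hε1 hδ2 (b := (β δ - ε / 2 * o δ) / ((1 - ε) * o δ))
    (d := (γ δ - ε / 2 * o δ) / ((1 - ε) * o δ))
    (by rw [le_div_iff₀ (by positivity)]; linarith) (by rw [div_le_iff₀ (by positivity)]; linarith)
    (by rw [le_div_iff₀ (by positivity)]; linarith) (by rw [div_le_iff₀ (by positivity)]; linarith)
  have hk : δ * (2 * ((n + 1 : ℕ) : ℝ)) = 1 := by
    rw [hδ, Nat.cast_add_one]
    exact one_div_mul_cancel (by positivity)
  have hτ : o δ * ε < 1 := mul_lt_one_of_nonneg_of_lt_one_left ho0.le hO1 hε1.le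
  refine ⟨n + 1, δ, n.succ_ne_zero, hk, hδ0, hδ2, o δ * ε, mul_pos ho0 hε0, hτ, y, ?_, hS⟩
  rw [← hy, mul_div_cancel₀ _ (by positivity), mul_div_cancel₀ _ (by positivity)]
  simp only [Prod.mk.injEq]
  refine ⟨?_, ?_, ?_, ?_⟩
  · linear_combination (-1 / 2 : ℝ) * e1
  · linear_combination - e4
  · linear_combination (-1 / 2 : ℝ) * e2
  · linear_combination - e5

section
variable {ι κ : Type*} [Fintype ι] [Fintype κ] {Il Ir : ι → Set ℝ} {Jl Jr : κ → Set ℝ}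
  {X Y Z : Set ℝ} {A₁ A₂ A₃ : ℝ → ℝ} {B₁ B₂ B₃ : ℝ × ℝ → ℝ} {M : ℝ}

theorem Wts.est_interp (W : Wts X Y Z A₁ A₂ A₃ B₁ B₂ B₃ M) (hI : Sys Il Ir) (hJ : Sys Jl Jr)
    {C₀ C₁ : ℝ} {x y : ℝ × ℝ × ℝ × ℝ}
    (h₀ : Est (kB Il Ir Jl Jr) (X ×ˢ Y) (Z ×ˢ Z) A₁ A₂ A₃ B₁ B₂ B₃ C₀ x)
    (h₁ : Est (kB Il Ir Jl Jr) (X ×ˢ Y) (Z ×ˢ Z) A₁ A₂ A₃ B₁ B₂ B₃ C₁ y) {t : ℝ}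
    (ht : t ∈ Icc (0 : ℝ) 1) :
    Est (kB Il Ir Jl Jr) (X ×ˢ Y) (Z ×ˢ Z) A₁ A₂ A₃ B₁ B₂ B₃ (C₀ ^ (1 - t) * C₁ ^ t)
      ((1 - t) • x + t • y) := by
  obtain ⟨K, hK⟩ := exists_norm_kB_le Il Ir Jl Jr
  exact Est.interp (measurable_kB hI hJ) hK W.bQ W.bQ₃ W.mA₁ W.mA₂ W.mA₃ W.mB₁ W.mB₂ W.mB₃
    W.bA₁ W.bA₂ W.bA₃ W.bB₁ W.bB₂ W.bB₃ h₀ h₁ ht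

theorem Wts.convex_est (W : Wts X Y Z A₁ A₂ A₃ B₁ B₂ B₃ M) (hI : Sys Il Ir) (hJ : Sys Jl Jr)
    {C : ℝ} (hC : 0 < C) :
    Convex ℝ {x | Est (kB Il Ir Jl Jr) (X ×ˢ Y) (Z ×ˢ Z) A₁ A₂ A₃ B₁ B₂ B₃ C x} := by
  rw [convex_iff_forall_pos]
  intro x hx y hy s t hs ht hst
  have := W.est_interp hI hJ hx hy (t := t) ⟨ht.le, by linarith⟩
  rw [← Real.rpow_add hC, sub_add_cancel, Real.rpow_one] at this
  rwa [show s = 1 - t by linarith]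

end

/-- Decay in the size of the intervals, for all admissible exponents. -/
theorem exists_est {a b c d : ℝ} (ha : 0 < a) (hc : 0 < c)
    (hab : a < b) (hb : a + b < 1) (hcd : c < d) (hd : c + d < 1)
    (had : a + d < 1) (hbc : b + c < 1) :
    ∃ C τ : ℝ, 0 < C ∧ 0 < τ ∧ ∀ {ι κ : Type} [Fintype ι] [Fintype κ] {Il Ir : ι → Set ℝ}
      {Jl Jr : κ → Set ℝ} {X Y Z : Set ℝ} {A₁ A₂ A₃ : ℝ → ℝ} {B₁ B₂ B₃ : ℝ × ℝ → ℝ} {M : ℝ},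
      Wts X Y Z A₁ A₂ A₃ B₁ B₂ B₃ M → Sys Il Ir → Sys Jl Jr → (∀ i, Il i ⊆ X) → (∀ j, Jr j ⊆ X) →
      ∀ {ν : ℝ}, 0 ≤ ν → ∀ {μ : ℝ}, 0 ≤ μ →
      (∀ i, ∫⁻ ξ in Il i, EX (A₁ ξ) ≤ ENNReal.ofReal (μ ^ 2)) →
      (∀ j, ∫⁻ ξ in Jr j, EX (A₂ ξ) ≤ ENNReal.ofReal (ν ^ 2)) →
      Est (kB Il Ir Jl Jr) (X ×ˢ Y) (Z ×ˢ Z) A₁ A₂ A₃ B₁ B₂ B₃ (C * (μ ^ τ * ν ^ τ)) (a, b, c, d) := by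
  obtain ⟨k, δ, hk0, hk, h0, hδ, τ, hτ0, hτ1, y, hy, hS⟩ :=
    exists_convex_decomposition ha hc hab hb hcd hd had hbc
  obtain ⟨C₀, hC₀, hR⟩ := riesz_PJ hk0
  obtain ⟨R, hRd⟩ : ∃ R, R = max 1 C₀.toReal := ⟨_, rfl⟩
  have hR1 : 1 ≤ R := hRd ▸ le_max_left _ _
  have hR0 : 0 < R := by linarith
  have hRie : RieszBd k (ENNReal.ofReal R) := fun g hg J hJb hJ => by
    refine (hR g hg J hJb hJ).trans ?_
    gcongr
    rw [← ENNReal.ofReal_toReal hC₀, hRd]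
    exact ENNReal.ofReal_le_ofReal (le_max_right _ _)
  have hRδ : ∀ t : ℝ, t ≤ 1 → R ^ t ≤ R := fun t ht => by
    conv_rhs => rw [← Real.rpow_one R]
    exact Real.rpow_le_rpow_of_exponent_le hR1 ht
  have hC2 : 2 * R ^ (2 * δ) ≤ (2 * R) ^ 2 := by
    have := hRδ (2 * δ) (by linarith)
    nlinarith
  have hCd : R ^ δ * R ^ δ ≤ 2 * R := by
    rw [← Real.rpow_add hR0]
    have := hRδ (δ + δ) (by linarith)
    linarith
  have hdual : ∀ t, (t = δ ∨ t = 1 - δ) → 0 < t ∧ t < 1 ∧ DualBd t (ENNReal.ofReal (R ^ δ)) := by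
    rw [← ENNReal.ofReal_rpow_of_pos hR0]
    rintro t (rfl | rfl)
    · exact ⟨h0, by linarith, dualBd_high hRie hk h0 (by linarith)⟩
    · exact ⟨by linarith, by linarith, dualBd_low hRie hk h0 (by linarith)⟩
  refine ⟨(2 * R) ^ (1 - τ), τ, by positivity, hτ0, ?_⟩
  intro ι κ _ _ Il Ir Jl Jr X Y Z A₁ A₂ A₃ B₁ B₂ B₃ M W hI hJ hIX hJX ν hν μ hμ h₁ h₂
  have hyS := hS _ (W.convex_est hI hJ (C := 2 * R) (by positivity))
    (W.est_sq hI hJ (by linarith)) (W.est_mixed hI hJ hJX (by linarith))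
    (W.est_mixed' hI hJ hIX (by linarith))
    (W.est_half hI hJ hIX hJX hk h0 hδ.le hRie hR1 (by linarith) hC2)
    (W.est_half' hI hJ hIX hJX hk h0 hδ.le hRie hR1 (by linarith) hC2)
    fun b d hb hd => by
      obtain ⟨b0, b1, hb⟩ := hdual b hb
      obtain ⟨d0, d1, hd⟩ := hdual d hd
      exact W.est_dual hI hJ hIX hJX b0 b1 d0 d1 hb hd (by positivity) hCd (by linarith)
  have hout := W.est_outer hI hJ hIX hJX (C := μ * ν) (by positivity) (by rw [mul_pow])
    (by positivity) h₁ h₂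
  rw [hy, ← Real.mul_rpow hμ hν]
  exact W.est_interp hI hJ hyS hout ⟨hτ0.le, hτ1.le⟩

/-- The generation-`n` dyadic index of a real number. -/
noncomputable def dy (n : ℕ) (g : ℝ) : ℕ := ⌊2 ^ n * g⌋₊

theorem dy_mono (n : ℕ) : Monotone (dy n) := fun _ _ h => by unfold dy; gcongr

theorem dy_succ_div_two (n : ℕ) (g : ℝ) : dy (n + 1) g / 2 = dy n g := by
  have := Nat.floor_div_natCast (2 ^ (n + 1) * g) 2
  rw [dy, dy, ← this]
  congr 1
  push_cast
  ring

theorem dy_lt {n : ℕ} {g : ℝ} (hg : g < 1) : dy n g < 2 ^ n := by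
  rw [dy, Nat.floor_lt' (by positivity)]
  push_cast
  have : (0 : ℝ) < 2 ^ n := by positivity
  nlinarith

theorem sum_dyadic_eq {g₁ g₂ : ℝ} (h₁ : g₁ < 1) (h₂ : g₂ < 1) (N : ℕ) :
    ∑ m ∈ Finset.range N, ∑ k : Fin (2 ^ m),
      (if dy (m + 1) g₁ = 2 * k ∧ dy (m + 1) g₂ = 2 * k + 1 then 1 else 0 : ℂ) =
    if dy N g₁ < dy N g₂ then 1 else 0 := by
  induction N with
  | zero =>
    have a₁ := dy_lt (n := 0) h₁
    have a₂ := dy_lt (n := 0) h₂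
    rw [Finset.sum_range_zero, if_neg (by simp only [pow_zero] at a₁ a₂; omega)]
  | succ N ih =>
    rw [Finset.sum_range_succ, ih]
    have e₁ := dy_succ_div_two N g₁
    have e₂ := dy_succ_div_two N g₂
    have l₁ := dy_lt (n := N) h₁
    by_cases h : dy N g₁ = dy N g₂ ∧ dy (N + 1) g₁ < dy (N + 1) g₂
    · rw [if_neg (by omega), if_pos h.2, zero_add,
        Finset.sum_eq_single_of_mem (⟨dy N g₁, l₁⟩ : Fin (2 ^ N)) (Finset.mem_univ _)]
      · rw [if_pos]
        constructor <;> simp only <;> omega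
      · intro k _ hk
        rw [if_neg]
        rintro ⟨h3, -⟩
        apply hk
        ext
        simp only
        omega
    · rw [Finset.sum_eq_zero, add_zero]
      · have : dy N g₁ < dy N g₂ ↔ dy (N + 1) g₁ < dy (N + 1) g₂ := by omega
        simp only [this]
      · intro k _
        rw [if_neg]
        rintro ⟨h3, h4⟩
        omega

theorem eventually_dy_lt {g₁ g₂ : ℝ} (h0 : 0 ≤ g₁) (h : g₁ < g₂) :
    ∀ᶠ N in atTop, dy N g₁ < dy N g₂ := by
  have : Tendsto (fun N : ℕ => (2 : ℝ) ^ N * (g₂ - g₁)) atTop atTop :=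
    (tendsto_pow_atTop_atTop_of_one_lt one_lt_two).atTop_mul_const (by linarith)
  filter_upwards [this.eventually_ge_atTop 1] with N hN
  rw [dy, dy, ← Nat.succ_le_iff, Nat.succ_eq_add_one,
    ← Nat.floor_add_one (by positivity)]
  exact Nat.floor_le_floor (by linarith)

theorem abs_sub_le_of_dy_eq {n : ℕ} {g₁ g₂ : ℝ} (h1 : 0 ≤ g₁) (h : dy n g₁ = dy n g₂) :
    g₂ - g₁ ≤ (1 / 2) ^ n := by
  have a₂ := Nat.lt_floor_add_one (2 ^ n * g₂)
  have a₁ := Nat.floor_le (a := 2 ^ n * g₁) (by positivity)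
  rw [dy, dy] at h
  rw [← h] at a₂
  have : (0 : ℝ) < 2 ^ n := by positivity
  rw [one_div, inv_pow, ← one_div, le_div_iff₀ this]
  nlinarith

/-- The left dyadic pieces of `X` with respect to `γ`. -/
def dyL (γ : ℝ → ℝ) (X : Set ℝ) (m : ℕ) (k : Fin (2 ^ m)) : Set ℝ :=
  X ∩ {x | dy (m + 1) (γ x) = 2 * k}

/-- The right dyadic pieces of `X` with respect to `γ`. -/
def dyR (γ : ℝ → ℝ) (X : Set ℝ) (m : ℕ) (k : Fin (2 ^ m)) : Set ℝ :=
  X ∩ {x | dy (m + 1) (γ x) = 2 * k + 1}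

theorem sys_dyadic {γ : ℝ → ℝ} (hγ : Monotone γ) {X : Set ℝ} (hX : X.OrdConnected)
    (hb : Bornology.IsBounded X) (m : ℕ) : Sys (dyL γ X m) (dyR γ X m) := by
  have hm : Monotone fun x => dy (m + 1) (γ x) := (dy_mono _).comp hγ
  have hoc : ∀ n, ({x | dy (m + 1) (γ x) = n} : Set ℝ).OrdConnected := fun n =>
    (ordConnected_singleton (a := n)).preimage_mono hm
  have hlt : ∀ {x y}, dy (m + 1) (γ x) < dy (m + 1) (γ y) → x < y := fun h => hm.reflect_lt h
  have key : ∀ i j : Fin (2 ^ m), i < j → ∀ a ∈ dyL γ X m i, ∀ b ∈ dyR γ X m i,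
      ∀ c ∈ dyL γ X m j, ∀ d ∈ dyR γ X m j, a + b < c + d := by
    intro i j hij a ha b hb c hc d hd
    have hij' : (i : ℕ) < j := hij
    have h1 : a < c := hlt (by rw [ha.2, hc.2]; omega)
    have h2 : b < d := hlt (by rw [hb.2, hd.2]; omega)
    linarith
  refine ⟨fun k => hX.inter (hoc _), fun k => hX.inter (hoc _), fun k => hb.subset inter_subset_left,
    fun k => hb.subset inter_subset_left, fun i j hij => ?_, fun i j hij => ?_, fun i j hij => ?_⟩
  · refine Set.disjoint_left.2 fun x hx hy => hij (Fin.ext ?_)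
    have := hx.2.symm.trans hy.2
    omega
  · refine Set.disjoint_left.2 fun x hx hy => hij (Fin.ext ?_)
    have := hx.2.symm.trans hy.2
    omega
  · intro a ha b hb c hc d hd
    rcases lt_or_gt_of_ne hij with h | h
    · exact (key i j h a ha b hb c hc d hd).ne
    · exact (key j i h c hc d hd a ha b hb).ne.symm

/-- Half the primitive of `exp ∘ A`. -/
noncomputable def prim (A : ℝ → ℝ) (R x : ℝ) : ℝ := (1 / 2) * ∫ t in (-R)..x, Real.exp (A t)

section
variable {A : ℝ → ℝ} {M : ℝ}

theorem intervalIntegrable_exp (hA : Measurable A) (hM : ∀ x, |A x| ≤ M) (a b : ℝ) :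
    IntervalIntegrable (fun t => Real.exp (A t)) volume a b := by
  refine (intervalIntegrable_const (c := Real.exp M)).mono_fun
    (by have := hA; fun_prop) (.of_forall fun x => ?_)
  change ‖Real.exp (A x)‖ ≤ ‖Real.exp M‖
  rw [Real.norm_of_nonneg (Real.exp_pos _).le, Real.norm_of_nonneg (Real.exp_pos _).le]
  exact Real.exp_le_exp.2 (abs_le.1 (hM x)).2

theorem prim_sub (hA : Measurable A) (hM : ∀ x, |A x| ≤ M) (R x y : ℝ) :
    prim A R y - prim A R x = (1 / 2) * ∫ t in x..y, Real.exp (A t) := by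
  rw [prim, prim, ← mul_sub, intervalIntegral.integral_interval_sub_left] <;>
    exact intervalIntegrable_exp hA hM _ _

theorem prim_strictMono (hA : Measurable A) (hM : ∀ x, |A x| ≤ M) (R : ℝ) :
    StrictMono (prim A R) := fun x y h => by
  rw [← sub_pos, prim_sub hA hM]
  have := intervalIntegral.intervalIntegral_pos_of_pos (intervalIntegrable_exp hA hM x y)
    (fun t => Real.exp_pos _) h
  positivity

theorem continuous_prim (hA : Measurable A) (hM : ∀ x, |A x| ≤ M) (R : ℝ) :
    Continuous (prim A R) :=
  continuous_const.mul (intervalIntegral.continuous_primitive (intervalIntegrable_exp hA hM) _)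

theorem lintegral_EX_Icc (hA : Measurable A) (hM : ∀ x, |A x| ≤ M) (R : ℝ) {x y : ℝ} (h : x ≤ y) :
    ∫⁻ t in Icc x y, EX (A t) = ENNReal.ofReal (2 * (prim A R y - prim A R x)) := by
  rw [prim_sub hA hM, intervalIntegral.integral_of_le h, ← integral_Icc_eq_integral_Ioc,
    ← mul_assoc, mul_one_div_cancel two_ne_zero, one_mul,
    ofReal_integral_eq_lintegral_ofReal _ (.of_forall fun t => (Real.exp_pos _).le)]
  · rfl
  · exact (integrableOn_Icc_iff_integrableOn_Ioc).2
      ((intervalIntegrable_iff_integrableOn_Ioc_of_le h).1 (intervalIntegrable_exp hA hM x y))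

theorem prim_mem {R : ℝ} (hA : Measurable A) (hM : ∀ x, |A x| ≤ M)
    (h1 : ∫⁻ t in Icc (-R) R, EX (A t) ≤ 1) {x : ℝ} (hx : x ∈ Icc (-R) R) :
    0 ≤ prim A R x ∧ prim A R x < 1 := by
  have h0 : prim A R (-R) = 0 := by simp [prim]
  have hm := (prim_strictMono hA hM R).monotone
  rw [lintegral_EX_Icc hA hM R (hx.1.trans hx.2), h0, ENNReal.ofReal_le_one] at h1
  have h2 := hm hx.1
  have h3 := hm hx.2
  constructor <;> linarith

theorem lintegral_EX_le_of_dy {R : ℝ} (hA : Measurable A) (hM : ∀ x, |A x| ≤ M)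
    {I : Set ℝ} (hI : I ⊆ Icc (-R) R) (n m : ℕ) (h : ∀ x ∈ I, dy (m + 1) (prim A R x) = n) :
    ∫⁻ t in I, EX (A t) ≤ ENNReal.ofReal ((1 / 2) ^ m) := by
  rcases I.eq_empty_or_nonempty with rfl | hne
  · simp
  have hb : BddBelow I := bddBelow_Icc.mono hI
  have ha : BddAbove I := bddAbove_Icc.mono hI
  have h0 : prim A R (-R) = 0 := by simp [prim]
  have hm := (prim_strictMono hA hM R).monotone
  have hcl : ∀ x ∈ closure I, ∀ y ∈ closure I, prim A R y - prim A R x ≤ (1 / 2) ^ (m + 1) := by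
    have hc : IsClosed {p : ℝ × ℝ | prim A R p.2 - prim A R p.1 ≤ (1 / 2) ^ (m + 1)} :=
      isClosed_le (by have := continuous_prim hA hM R; fun_prop) continuous_const
    have hs : I ×ˢ I ⊆ {p : ℝ × ℝ | prim A R p.2 - prim A R p.1 ≤ (1 / 2) ^ (m + 1)} := fun p hp =>
      abs_sub_le_of_dy_eq (h0.symm.le.trans (hm (hI hp.1).1)) ((h _ hp.1).trans (h _ hp.2).symm)
    intro x hx y hy
    have := closure_minimal hs hc
    rw [closure_prod_eq] at this
    exact this (show (x, y) ∈ closure I ×ˢ closure I from ⟨hx, hy⟩)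
  have hsub : I ⊆ Icc (sInf I) (sSup I) := subset_Icc_csInf_csSup hb ha
  refine (lintegral_mono_set hsub).trans ?_
  rw [lintegral_EX_Icc hA hM R ((hsub hne.some_mem).1.trans (hsub hne.some_mem).2)]
  refine ENNReal.ofReal_le_ofReal ?_
  have := hcl _ (csInf_mem_closure hne hb) _ (csSup_mem_closure hne ha)
  rw [pow_succ] at this
  linarith

end

/-- The kernel of the strict order on `X`. -/
noncomputable def ordK (X : Set ℝ) (x y : ℝ) : ℂ :=
  open Classical in if x ∈ X ∧ y ∈ X ∧ x < y then 1 else 0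

/-- The dyadic truncation of the kernel of the strict order on `X`. -/
noncomputable def dyK (γ : ℝ → ℝ) (X : Set ℝ) (N : ℕ) (x y : ℝ) : ℂ :=
  open Classical in if x ∈ X ∧ y ∈ X ∧ dy N (γ x) < dy N (γ y) then 1 else 0

section
variable {γ : ℝ → ℝ} {X : Set ℝ}

theorem sum_indicator_dyadic (h1 : ∀ x ∈ X, γ x < 1) (N : ℕ) (x y : ℝ) :
    ∑ m ∈ Finset.range N, ∑ k : Fin (2 ^ m),
      (dyL γ X m k).indicator (fun _ => (1 : ℂ)) x * (dyR γ X m k).indicator (fun _ => 1) y =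
    dyK γ X N x y := by
  classical
  by_cases hx : x ∈ X
  · by_cases hy : y ∈ X
    · have := sum_dyadic_eq (h1 x hx) (h1 y hy) N
      rw [dyK]
      simp only [hx, hy, true_and]
      rw [← this]
      refine Finset.sum_congr rfl fun m _ => Finset.sum_congr rfl fun k _ => ?_
      by_cases hk : dy (m + 1) (γ x) = 2 * k <;> by_cases hl : dy (m + 1) (γ y) = 2 * k + 1 <;>
        simp [Set.indicator, dyL, dyR, hx, hy, hk, hl]
    · simp [dyK, dyR, hy]
  · simp [dyK, dyL, hx]

theorem norm_dyK_le (N : ℕ) (x y : ℝ) :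
    ‖dyK γ X N x y‖ ≤ X.indicator (fun _ => (1 : ℝ)) x ∧
      ‖dyK γ X N x y‖ ≤ X.indicator (fun _ => (1 : ℝ)) y := by
  classical
  unfold dyK
  by_cases hx : x ∈ X <;> by_cases hy : y ∈ X <;> simp only [hx, hy, indicator_of_mem,
    indicator_of_notMem, not_false_eq_true, true_and, false_and, and_false, if_false, norm_zero] <;>
    (try split_ifs) <;> norm_num

theorem norm_ordK_le (x y : ℝ) :
    ‖ordK X x y‖ ≤ X.indicator (fun _ => (1 : ℝ)) x ∧
      ‖ordK X x y‖ ≤ X.indicator (fun _ => (1 : ℝ)) y := by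
  classical
  unfold ordK
  by_cases hx : x ∈ X <;> by_cases hy : y ∈ X <;> simp only [hx, hy, indicator_of_mem,
    indicator_of_notMem, not_false_eq_true, true_and, false_and, and_false, if_false, norm_zero] <;>
    (try split_ifs) <;> norm_num

theorem measurable_dyK (hγ : Measurable γ) (hX : MeasurableSet X) (N : ℕ) :
    Measurable fun p : ℝ × ℝ => dyK γ X N p.1 p.2 := by
  classical
  have hd : Measurable (dy N) := (dy_mono N).measurable
  refine Measurable.ite ?_ measurable_const measurable_const
  exact (measurable_fst hX).inter ((measurable_snd hX).inter
    (measurableSet_lt (hd.comp (hγ.comp measurable_fst)) (hd.comp (hγ.comp measurable_snd))))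

theorem measurable_ordK (hX : MeasurableSet X) : Measurable fun p : ℝ × ℝ => ordK X p.1 p.2 := by
  classical
  refine Measurable.ite ?_ measurable_const measurable_const
  exact (measurable_fst hX).inter ((measurable_snd hX).inter
    (measurableSet_lt measurable_fst measurable_snd))

theorem tendsto_dyK (hγ : StrictMono γ) (h0 : ∀ x ∈ X, 0 ≤ γ x) (x y : ℝ) :
    Tendsto (fun N => dyK γ X N x y) atTop (𝓝 (ordK X x y)) := by
  classical
  refine tendsto_const_nhds.congr' ?_
  by_cases h : x ∈ X ∧ y ∈ X ∧ x < y
  · filter_upwards [eventually_dy_lt (h0 x h.1) (hγ h.2.2)] with N hN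
    rw [ordK, dyK, if_pos h, if_pos ⟨h.1, h.2.1, hN⟩]
  · refine .of_forall fun N => ?_
    simp only [ordK, dyK]
    rw [if_neg h, if_neg]
    rintro ⟨hx, hy, hN⟩
    exact h ⟨hx, hy, ((dy_mono N).comp hγ.monotone).reflect_lt hN⟩

theorem tendsto_integral_ex_mul {T : ℕ → ℝ → ℂ} {T' : ℝ → ℂ} (hm : ∀ N, Measurable (T N))
    (hX : MeasurableSet X) (hb : Bornology.IsBounded X)
    (hT : ∀ N x, ‖T N x‖ ≤ X.indicator (fun _ => (1 : ℝ)) x)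
    (hl : ∀ x, Tendsto (fun N => T N x) atTop (𝓝 (T' x))) (s : ℝ) :
    Tendsto (fun N => ∫ x, ex (x * s) * T N x) atTop (𝓝 (∫ x, ex (x * s) * T' x)) := by
  refine tendsto_integral_of_dominated_convergence (X.indicator fun _ => (1 : ℝ)) (fun N => ?_) ?_
    (fun N => .of_forall fun x => ?_) (.of_forall fun x => (hl x).const_mul _)
  · have := hm N
    exact (by fun_prop : Measurable fun x => ex (x * s) * T N x).aestronglyMeasurable
  · exact (integrable_indicator_iff hX).2 (integrableOn_const hb.measure_lt_top.ne)
  · rw [norm_mul, norm_ex, one_mul]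
    exact hT N x

theorem norm_integral_ex_mul_le {T : ℝ → ℂ} (hX : MeasurableSet X) (hb : Bornology.IsBounded X)
    (hT : ∀ x, ‖T x‖ ≤ X.indicator (fun _ => (1 : ℝ)) x) (s : ℝ) :
    ‖∫ x, ex (x * s) * T x‖ ≤ volume.real X := by
  refine (norm_integral_le_of_norm_le (g := X.indicator fun _ => (1 : ℝ))
    ((integrable_indicator_iff hX).2 (integrableOn_const hb.measure_lt_top.ne))
    (.of_forall fun x => ?_)).trans ?_
  · rw [norm_mul, norm_ex, one_mul]
    exact hT x
  · rw [integral_indicator hX]; simp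

theorem integral_ex_sum {ι : Type*} (s : Finset ι) {κ : ι → Type*} [∀ i, Fintype (κ i)]
    (f : ∀ i, κ i → ℂ)
    (J : ∀ i, κ i → Set ℝ) (hJ : ∀ i k, MeasurableSet (J i k))
    (hb : ∀ i k, Bornology.IsBounded (J i k)) (t : ℝ) :
    ∑ m ∈ s, ∑ k, f m k * kr (J m k) t =
      ∫ x, ex (x * t) * ∑ m ∈ s, ∑ k, f m k * (J m k).indicator (fun _ => (1 : ℂ)) x := by
  have hi : ∀ m k, Integrable fun x => f m k * (ex (x * t) * (J m k).indicator (fun _ => (1 : ℂ)) x) :=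
    fun m k => (((BS.indicator_one (hJ m k) (hb m k)).mul_bdd (G := fun x => ex (x * t)) (M := 1)
      (by fun_prop) (fun x => (norm_ex _).le)).integrable).const_mul _
  simp only [kr, Fi, ← integral_const_mul, Finset.mul_sum, mul_left_comm (ex _)]
  rw [integral_finsetSum _ fun m _ => integrable_finsetSum _ fun k _ => hi m k]
  refine Finset.sum_congr rfl fun m _ => ?_
  rw [integral_finsetSum _ fun k _ => hi m k]

end

section
variable {ι κ : Type*} [Fintype ι] [Fintype κ]

theorem kB_eq (Il Ir : ι → Set ℝ) (Jl Jr : κ → Set ℝ) (x : (ℝ × ℝ) × (ℝ × ℝ) × (ℝ × ℝ)) :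
    kB Il Ir Jl Jr x = ex (x.2.1.1 * x.1.1) * ex (x.2.2.1 * x.1.2) *
      ((∑ i, (Il i).indicator (fun _ => 1) x.2.1.1 * kr (Ir i) (x.1.1 - x.2.2.2)) *
        ∑ j, (Jr j).indicator (fun _ => 1) x.2.2.1 * kr (Jl j) (x.1.2 - x.2.1.2)) := by
  rw [Finset.sum_mul_sum, Finset.mul_sum, kB]
  refine Finset.sum_congr rfl fun i _ => ?_
  rw [Finset.mul_sum]
  refine Finset.sum_congr rfl fun j _ => ?_
  rw [kA, kA]
  ring

end

/-- The kernel of the full operator, with frequencies in `X`. -/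
noncomputable def kF (X : Set ℝ) (x : (ℝ × ℝ) × (ℝ × ℝ) × (ℝ × ℝ)) : ℂ :=
  ex (x.2.1.1 * x.1.1) * ex (x.2.2.1 * x.1.2) *
    ((∫ t, ex (t * (x.1.1 - x.2.2.2)) * ordK X x.2.1.1 t) *
      ∫ t, ex (t * (x.1.2 - x.2.1.2)) * ordK X t x.2.2.1)

section
variable {γ γ' : ℝ → ℝ} {X : Set ℝ}

theorem sum_kB_eq (hγ : Monotone γ) (hγ' : Monotone γ') (hX : X.OrdConnected)
    (hb : Bornology.IsBounded X) (h1 : ∀ x ∈ X, γ x < 1) (h1' : ∀ x ∈ X, γ' x < 1) (N : ℕ)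
    (x : (ℝ × ℝ) × (ℝ × ℝ) × (ℝ × ℝ)) :
    ∑ m ∈ Finset.range N, ∑ n ∈ Finset.range N,
      kB (dyL γ X m) (dyR γ X m) (dyL γ' X n) (dyR γ' X n) x =
    ex (x.2.1.1 * x.1.1) * ex (x.2.2.1 * x.1.2) *
    ((∫ t, ex (t * (x.1.1 - x.2.2.2)) * dyK γ X N x.2.1.1 t) *
      ∫ t, ex (t * (x.1.2 - x.2.1.2)) * dyK γ' X N t x.2.2.1) := by
  have hs := fun m => sys_dyadic hγ hX hb m
  have hs' := fun m => sys_dyadic hγ' hX hb m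
  simp only [← sum_indicator_dyadic h1, ← sum_indicator_dyadic h1', kB_eq]
  simp only [mul_comm (indicator (dyL γ' X _ _) _ _)]
  rw [← integral_ex_sum _ _ _ (fun m k => (hs m).mr k) (fun m k => (hs m).br k),
    ← integral_ex_sum _ _ _ (fun m k => (hs' m).ml k) (fun m k => (hs' m).bl k),
    Finset.sum_mul_sum, Finset.mul_sum]
  refine Finset.sum_congr rfl fun i _ => ?_
  rw [Finset.mul_sum]

end

theorem Tri_finsetSum {α : Type*} (s : Finset α) {K : α → (ℝ × ℝ) × (ℝ × ℝ) × (ℝ × ℝ) → ℂ}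
    (hK : ∀ i ∈ s, Measurable (K i)) (hb : ∀ i ∈ s, ∃ M, ∀ x, ‖K i x‖ ≤ M) {h F₁ F₂ : ℝ × ℝ → ℂ}
    (hh : BS h) (h₁ : BS F₁) (h₂ : BS F₂) :
    Tri (fun x => ∑ i ∈ s, K i x) h F₁ F₂ = ∑ i ∈ s, Tri (K i) h F₁ F₂ := by
  simp only [Tri, Finset.sum_mul]
  refine integral_finsetSum _ fun i hi => ?_
  obtain ⟨M, hM⟩ := hb i hi
  exact ((hh.prodMul (h₁.prodMul h₂)).mul_bdd (hK i hi) hM).integrable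

theorem tendsto_Tri {K : ℕ → (ℝ × ℝ) × (ℝ × ℝ) × (ℝ × ℝ) → ℂ}
    {K' : (ℝ × ℝ) × (ℝ × ℝ) × (ℝ × ℝ) → ℂ} (hK : ∀ N, Measurable (K N)) {M : ℝ}
    (hM : ∀ N x, ‖K N x‖ ≤ M) (hl : ∀ x, Tendsto (fun N => K N x) atTop (𝓝 (K' x)))
    {h F₁ F₂ : ℝ × ℝ → ℂ} (hh : BS h) (h₁ : BS F₁) (h₂ : BS F₂) :
    Tendsto (fun N => Tri (K N) h F₁ F₂) atTop (𝓝 (Tri K' h F₁ F₂)) := by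
  have hB := hh.prodMul (h₁.prodMul h₂)
  refine tendsto_integral_of_dominated_convergence
    (fun x => M * ‖h x.1 * (F₁ x.2.1 * F₂ x.2.2)‖) (fun N => ?_) ?_
    (fun N => .of_forall fun x => ?_) (.of_forall fun x => (hl x).mul_const _)
  · exact ((hK N).mul hB.1).aestronglyMeasurable
  · exact hB.integrable.norm.const_mul M
  · rw [norm_mul]
    gcongr
    exact hM N x

/-- The weighted bound for the full kernel. -/
theorem exists_est_full {a b c d : ℝ} (ha : 0 < a) (hc : 0 < c)
    (hab : a < b) (hb : a + b < 1) (hcd : c < d) (hd : c + d < 1)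
    (had : a + d < 1) (hbc : b + c < 1) :
    ∃ C : ℝ, 0 < C ∧ ∀ {R : ℝ} {Y Z : Set ℝ} {A₁ A₂ A₃ : ℝ → ℝ} {B₁ B₂ B₃ : ℝ × ℝ → ℝ} {M : ℝ},
      Wts (Icc (-R) R) Y Z A₁ A₂ A₃ B₁ B₂ B₃ M →
      Est (kF (Icc (-R) R)) (Icc (-R) R ×ˢ Y) (Z ×ˢ Z) A₁ A₂ A₃ B₁ B₂ B₃ C (a, b, c, d) := by
  obtain ⟨C, τ, hC, hτ, H⟩ := exists_est ha hc hab hb hcd hd had hbc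
  obtain ⟨σ, hσ⟩ : ∃ σ : ℝ, σ = √(1 / 2) := ⟨_, rfl⟩
  have hσ0 : 0 < σ := hσ ▸ Real.sqrt_pos.2 (by norm_num)
  have hσ1 : σ < 1 := hσ ▸ (Real.sqrt_lt' one_pos).2 (by norm_num)
  have hσ2 : σ ^ 2 = 1 / 2 := hσ ▸ Real.sq_sqrt (by norm_num)
  obtain ⟨ρ, hρ⟩ : ∃ ρ : ℝ, ρ = σ ^ τ := ⟨_, rfl⟩
  have hρ0 : 0 < ρ := hρ ▸ Real.rpow_pos_of_pos hσ0 _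
  have hρ1 : ρ < 1 := hρ ▸ Real.rpow_lt_one hσ0.le hσ1 hτ
  have hρs : ∀ N, ∑ m ∈ Finset.range N, ρ ^ m ≤ (1 - ρ)⁻¹ := fun N => by
    rw [← tsum_geometric_of_lt_one hρ0.le hρ1]
    exact (summable_geometric_of_lt_one hρ0.le hρ1).sum_le_tsum _ fun i _ => by positivity
  have h1ρ : 0 < (1 - ρ)⁻¹ := inv_pos.2 (by linarith)
  refine ⟨C * ((1 - ρ)⁻¹ * (1 - ρ)⁻¹), by positivity, ?_⟩
  intro R Y Z A₁ A₂ A₃ B₁ B₂ B₃ M W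
  obtain ⟨X, hX⟩ : ∃ X, X = Icc (-R) R := ⟨_, rfl⟩
  have hXo : X.OrdConnected := hX ▸ ordConnected_Icc
  have W' := W
  rw [← hX] at W'
  obtain ⟨γ, hγd⟩ : ∃ γ, γ = prim A₁ R := ⟨_, rfl⟩
  obtain ⟨γ', hγd'⟩ : ∃ γ', γ' = prim A₂ R := ⟨_, rfl⟩
  have hγ : StrictMono γ := hγd ▸ prim_strictMono W.mA₁ W.bA₁ R
  have hγ' : StrictMono γ' := hγd' ▸ prim_strictMono W.mA₂ W.bA₂ R
  have hg : ∀ x ∈ X, 0 ≤ γ x ∧ γ x < 1 := fun x hx =>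
    hγd ▸ prim_mem W.mA₁ W.bA₁ W.iA₁ (hX ▸ hx)
  have hg' : ∀ x ∈ X, 0 ≤ γ' x ∧ γ' x < 1 := fun x hx =>
    hγd' ▸ prim_mem W.mA₂ W.bA₂ W.iA₂ (hX ▸ hx)
  have hs := fun m => sys_dyadic hγ.monotone hXo W'.bX m
  have hs' := fun m => sys_dyadic hγ'.monotone hXo W'.bX m
  rw [← hX]
  have hest : ∀ m n, Est (kB (dyL γ X m) (dyR γ X m) (dyL γ' X n) (dyR γ' X n)) (X ×ˢ Y) (Z ×ˢ Z)
      A₁ A₂ A₃ B₁ B₂ B₃ (C * (ρ ^ m * ρ ^ n)) (a, b, c, d) := by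
    intro m n
    have hp : ∀ m : ℕ, ρ ^ m = (σ ^ m) ^ τ := fun m => by
      rw [hρ, ← Real.rpow_natCast, ← Real.rpow_natCast, ← Real.rpow_mul hσ0.le,
        ← Real.rpow_mul hσ0.le, mul_comm]
    have hp2 : ∀ m : ℕ, (σ ^ m) ^ 2 = (1 / 2) ^ m := fun m => by rw [pow_right_comm, hσ2]
    rw [hp, hp]
    refine H W' (hs m) (hs' n) (fun i => inter_subset_left) (fun j => inter_subset_left)
      (by positivity) (by positivity) (fun i => ?_) (fun j => ?_)
    · rw [hp2]
      exact lintegral_EX_le_of_dy W.mA₁ W.bA₁ (hX ▸ inter_subset_left) _ m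
        fun x hx => hγd ▸ hx.2
    · rw [hp2]
      exact lintegral_EX_le_of_dy W.mA₂ W.bA₂ (hX ▸ inter_subset_left) _ n
        fun x hx => hγd' ▸ hx.2
  intro u₁ u₂ u₃ hu₁ hu₂ hu₃
  have b₁ := W'.bs₁ hu₁ (1 - a) b
  have b₂ := W'.bs₂ hu₂ (1 - c) d
  have b₃ := W'.bs₃ hu₃ (1 - a - d) (1 - b - c)
  have hmK : ∀ N, Measurable fun x => ∑ m ∈ Finset.range N, ∑ n ∈ Finset.range N,
      kB (dyL γ X m) (dyR γ X m) (dyL γ' X n) (dyR γ' X n) x := fun N =>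
    Finset.measurable_fun_sum _ fun m _ => Finset.measurable_fun_sum _ fun n _ =>
      measurable_kB (hs m) (hs' n)
  refine le_of_tendsto (tendsto_Tri (K' := kF X) hmK (M := volume.real X * volume.real X)
    (fun N x => ?_) (fun x => ?_) b₃ b₁ b₂).norm (.of_forall fun N => ?_)
  · rw [sum_kB_eq hγ.monotone hγ'.monotone hXo W'.bX (fun x hx => (hg x hx).2)
      (fun x hx => (hg' x hx).2), norm_mul, norm_mul, norm_mul, norm_ex, norm_ex, one_mul, one_mul]
    exact mul_le_mul (norm_integral_ex_mul_le W'.mX W'.bX (fun t => (norm_dyK_le _ _ _).2) _)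
      (norm_integral_ex_mul_le W'.mX W'.bX (fun t => (norm_dyK_le _ _ _).1) _) (norm_nonneg _)
      (by positivity)
  · simp only [sum_kB_eq hγ.monotone hγ'.monotone hXo W'.bX (fun x hx => (hg x hx).2)
      (fun x hx => (hg' x hx).2), kF]
    refine Tendsto.const_mul _ (Tendsto.mul ?_ ?_)
    · exact tendsto_integral_ex_mul (T := fun N t => dyK γ X N x.2.1.1 t)
        (fun N => (measurable_dyK hγ.monotone.measurable W'.mX N).comp
        measurable_prodMk_left) W'.mX W'.bX (fun N t => (norm_dyK_le _ _ _).2)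
        (fun t => tendsto_dyK hγ (fun x hx => (hg x hx).1) _ _) _
    · exact tendsto_integral_ex_mul (T := fun N t => dyK γ' X N t x.2.2.1)
        (fun N => (measurable_dyK hγ'.monotone.measurable W'.mX N).comp
        measurable_prodMk_right) W'.mX W'.bX (fun N t => (norm_dyK_le _ _ _).1)
        (fun t => tendsto_dyK hγ' (fun x hx => (hg' x hx).1) _ _) _
  · choose D hD using fun m n =>
      exists_norm_kB_le (dyL γ X m) (dyR γ X m) (dyL γ' X n) (dyR γ' X n)
    rw [Tri_finsetSum _ (fun m _ => Finset.measurable_fun_sum _ fun n _ =>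
      measurable_kB (hs m) (hs' n)) (fun m _ => ⟨∑ n ∈ Finset.range N, D m n, fun x =>
        (norm_sum_le _ _).trans (Finset.sum_le_sum fun n _ => hD m n x)⟩) b₃ b₁ b₂]
    calc _ ≤ ∑ m ∈ Finset.range N, ∑ n ∈ Finset.range N, C * (ρ ^ m * ρ ^ n) := by
          refine (norm_sum_le _ _).trans (Finset.sum_le_sum fun m _ => ?_)
          rw [Tri_finsetSum _ (fun n _ => measurable_kB (hs m) (hs' n))
            (fun n _ => ⟨D m n, hD m n⟩) b₃ b₁ b₂]
          exact (norm_sum_le _ _).trans (Finset.sum_le_sum fun n _ => hest m n _ _ _ hu₁ hu₂ hu₃)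
      _ = C * ((∑ m ∈ Finset.range N, ρ ^ m) * ∑ n ∈ Finset.range N, ρ ^ n) := by
          rw [Finset.sum_mul_sum, Finset.mul_sum]
          refine Finset.sum_congr rfl fun m _ => ?_
          rw [Finset.mul_sum]
      _ ≤ _ := by
          gcongr <;> exact hρs N

theorem EX_log {x : ℝ} (hx : 0 < x) : EX (Real.log x) = ENNReal.ofReal x := by
  rw [EX, Real.exp_log hx]

theorem abs_log_le {x c K : ℝ} (hc : 0 < c) (h1 : c ≤ x) (h2 : x ≤ K) :
    |Real.log x| ≤ max |Real.log c| |Real.log K| := by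
  have h3 := Real.log_le_log hc h1
  have h4 := Real.log_le_log (hc.trans_le h1) h2
  rw [abs_le]
  constructor
  · have := neg_abs_le (Real.log c)
    have := le_max_left |Real.log c| |Real.log K|
    linarith
  · exact h4.trans ((le_abs_self _).trans (le_max_right _ _))

/-- Writing a bounded function as a bounded multiple of a product of weights of mass one. -/
theorem exists_factorization {X Y : Set ℝ}
    (bX : Bornology.IsBounded X) (bY : Bornology.IsBounded Y) (hY0 : volume Y ≠ 0)
    {F : ℝ × ℝ → ℂ} (hF : Measurable F) {K : ℝ} (hK : ∀ p, ‖F p‖ ≤ K) (h0 : ∀ p ∉ X ×ˢ Y, F p = 0)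
    {P q L : ℝ} (hP : 0 < P) (hq : 0 < q) (hL : 0 < L)
    (hFL : ∫⁻ x in X, (∫⁻ y in Y, ‖F (x, y)‖ₑ ^ q) ^ (P / q) < ENNReal.ofReal (L ^ P)) :
    ∃ (A : ℝ → ℝ) (B : ℝ × ℝ → ℝ) (u : ℝ × ℝ → ℂ) (M : ℝ), Measurable A ∧ Measurable B ∧
      (∀ x, |A x| ≤ M) ∧ (∀ x, |B x| ≤ M) ∧ ∫⁻ x in X, EX (A x) ≤ 1 ∧
      (∀ x, ∫⁻ y in Y, EX (B (x, y)) ≤ 1) ∧ Adm (X ×ˢ Y) u ∧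
      F = fun p => L * tw u (wgt (1 / P) (1 / q) A B) p := by
  have hK0 : 0 ≤ K := (norm_nonneg _).trans (hK 0)
  obtain ⟨V, hV⟩ : ∃ V, V = volume.real Y := ⟨_, rfl⟩
  have hYt : volume Y ≠ ⊤ := bY.measure_lt_top.ne
  have hXt : volume X ≠ ⊤ := bX.measure_lt_top.ne
  have hV0 : 0 < V := hV ▸ ENNReal.toReal_pos hY0 hYt
  have hVE : volume Y = ENNReal.ofReal V := by rw [hV, ofReal_measureReal hYt]
  have hmF : Measurable fun p => ‖F p‖ₑ ^ q := hF.enorm.pow_const q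
  obtain ⟨I, hI⟩ : ∃ I : ℝ → ℝ≥0∞, ∀ x, I x = ∫⁻ y in Y, ‖F (x, y)‖ₑ ^ q := ⟨_, fun _ => rfl⟩
  have hmI : Measurable I := by
    rw [funext hI]; exact Measurable.lintegral_prod_right' hmF
  have hFq : ∀ p, ‖F p‖ₑ ^ q = ENNReal.ofReal (‖F p‖ ^ q) := fun p => by
    rw [← ofReal_norm, ENNReal.ofReal_rpow_of_nonneg (norm_nonneg _) hq.le]
  have hIle : ∀ x, I x ≤ ENNReal.ofReal (K ^ q * V) := fun x => by
    rw [hI, ENNReal.ofReal_mul (by positivity), ← hVE, ← setLIntegral_const]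
    refine lintegral_mono fun y => ?_
    rw [hFq]
    exact ENNReal.ofReal_le_ofReal (Real.rpow_le_rpow (norm_nonneg _) (hK _) hq.le)
  have hIt : ∀ x, I x ≠ ⊤ := fun x => ((hIle x).trans_lt ENNReal.ofReal_lt_top).ne
  have hIr : ∀ x, (I x).toReal ≤ K ^ q * V := fun x =>
    ENNReal.toReal_le_of_le_ofReal (by positivity) (hIle x)
  simp only [← hI] at hFL
  have hev : ∀ᶠ ε in 𝓝[>] (0 : ℝ),
      ∫⁻ x in X, (I x + ENNReal.ofReal (ε * V)) ^ (P / q) < ENNReal.ofReal (L ^ P) := by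
    refine Tendsto.eventually_lt_const hFL ?_
    refine tendsto_lintegral_filter_of_dominated_convergence
      (fun _ => (ENNReal.ofReal (K ^ q * V) + ENNReal.ofReal V) ^ (P / q)) ?_ ?_ ?_ ?_
    · exact .of_forall fun ε => by fun_prop
    · filter_upwards [Ioo_mem_nhdsGT one_pos] with ε hε
      refine .of_forall fun x => ?_
      have : ε * V ≤ V := by nlinarith [hε.2]
      have h3 := hIle x
      gcongr
    · rw [setLIntegral_const]
      exact ENNReal.mul_ne_top (ENNReal.rpow_ne_top_of_nonneg (by positivity) (by simp)) hXt
    · refine .of_forall fun x => ?_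
      refine ((ENNReal.continuous_rpow_const.tendsto _).comp ?_)
      have : Tendsto (fun ε : ℝ => I x + ENNReal.ofReal (ε * V)) (𝓝 0)
          (𝓝 (I x + ENNReal.ofReal (0 * V))) :=
        (continuous_const.add (ENNReal.continuous_ofReal.comp (continuous_id.mul continuous_const)) :
          Continuous fun ε : ℝ => I x + ENNReal.ofReal (ε * V)).tendsto 0
      rw [zero_mul, ENNReal.ofReal_zero, add_zero] at this
      exact this.mono_left nhdsWithin_le_nhds
  obtain ⟨ε, hε, hε0⟩ := (hev.and self_mem_nhdsWithin).exists
  replace hε0 : 0 < ε := hε0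
  obtain ⟨n, hn⟩ : ∃ n : ℝ → ℝ, ∀ x, n x = (I x).toReal + ε * V := ⟨_, fun _ => rfl⟩
  have hmn : Measurable n := by rw [funext hn]; fun_prop
  have hnE : ∀ x, ENNReal.ofReal (n x) = I x + ENNReal.ofReal (ε * V) := fun x => by
    rw [hn, ENNReal.ofReal_add ENNReal.toReal_nonneg (by positivity), ENNReal.ofReal_toReal (hIt x)]
  have hn1 : ∀ x, ε * V ≤ n x := fun x => by
    rw [hn]; linarith [ENNReal.toReal_nonneg (a := I x)]
  have hn2 : ∀ x, n x ≤ K ^ q * V + ε * V := fun x => by rw [hn]; linarith [hIr x]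
  have hεV : 0 < ε * V := by positivity
  have hn0 : ∀ x, 0 < n x := fun x => hεV.trans_le (hn1 x)
  have hψ0 : ∀ x, 0 < n x ^ (P / q) / L ^ P := fun x => by have := hn0 x; positivity
  have hφ0 : ∀ p : ℝ × ℝ, 0 < (‖F p‖ ^ q + ε) / n p.1 := fun p => by have := hn0 p.1; positivity
  have hPq : 0 ≤ P / q := by positivity
  obtain ⟨A, hA⟩ : ∃ A : ℝ → ℝ, ∀ x, A x = Real.log (n x ^ (P / q) / L ^ P) := ⟨_, fun _ => rfl⟩
  obtain ⟨B, hB⟩ : ∃ B : ℝ × ℝ → ℝ, ∀ p, B p = Real.log ((‖F p‖ ^ q + ε) / n p.1) :=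
    ⟨_, fun _ => rfl⟩
  have hmA : Measurable A := by rw [funext hA]; fun_prop
  have hmB : Measurable B := by rw [funext hB]; fun_prop
  have hbA := fun x => abs_log_le (x := n x ^ (P / q) / L ^ P)
    (c := (ε * V) ^ (P / q) / L ^ P) (K := (K ^ q * V + ε * V) ^ (P / q) / L ^ P)
    (by positivity)
    (by have := Real.rpow_le_rpow hεV.le (hn1 x) hPq; gcongr)
    (by have := Real.rpow_le_rpow (hn0 x).le (hn2 x) hPq; gcongr)
  have hbB := fun p : ℝ × ℝ => abs_log_le (x := (‖F p‖ ^ q + ε) / n p.1)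
    (c := ε / (K ^ q * V + ε * V)) (K := (K ^ q + ε) / (ε * V))
    (by positivity)
    (by
      have h2 := hn2 p.1
      have := hn0 p.1
      gcongr
      have : 0 ≤ ‖F p‖ ^ q := by positivity
      linarith)
    (by
      have h2 := hn1 p.1
      have h3 := Real.rpow_le_rpow (norm_nonneg _) (hK p) hq.le
      gcongr)
  have hexpw : ∀ p, Real.exp (wgt (1 / P) (1 / q) A B p) = (‖F p‖ ^ q + ε) ^ (1 / q) / L := by
    intro p
    have h1 := hn0 p.1
    have e1 : Real.exp (1 / P * A p.1) = n p.1 ^ (1 / q) / L := by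
      rw [mul_comm, Real.exp_mul, hA, Real.exp_log (hψ0 _), Real.div_rpow (by positivity)
        (by positivity), ← Real.rpow_mul h1.le, ← Real.rpow_mul hL.le, mul_one_div_cancel hP.ne',
        Real.rpow_one]
      congr 2
      field_simp
    have e2 : Real.exp (1 / q * B p) = (‖F p‖ ^ q + ε) ^ (1 / q) / n p.1 ^ (1 / q) := by
      rw [mul_comm, Real.exp_mul, hB, Real.exp_log (hφ0 _), Real.div_rpow (by positivity) h1.le]
    have h2 : n p.1 ^ (1 / q) ≠ 0 := by positivity
    rw [wgt, Real.exp_add, e1, e2]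
    field_simp
  have hle : ∀ p, ‖F p‖ / L ≤ Real.exp (wgt (1 / P) (1 / q) A B p) := fun p => by
    rw [hexpw]
    gcongr
    calc ‖F p‖ = (‖F p‖ ^ q) ^ (1 / q) := by
          rw [← Real.rpow_mul (norm_nonneg _), mul_one_div_cancel hq.ne', Real.rpow_one]
      _ ≤ _ := by gcongr; linarith
  obtain ⟨M₁, hM₁⟩ : ∃ M₁, ∀ x, |A x| ≤ M₁ := ⟨_, fun x => by rw [hA]; exact hbA x⟩
  obtain ⟨M₂, hM₂⟩ : ∃ M₂, ∀ x, |B x| ≤ M₂ := ⟨_, fun x => by rw [hB]; exact hbB x⟩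
  have hmw := measurable_wgt (1 / P) (1 / q) hmA hmB
  refine ⟨A, B, fun p => F p / L * Complex.exp (-(wgt (1 / P) (1 / q) A B p : ℝ)), max M₁ M₂, hmA,
    hmB, fun x => (hM₁ x).trans (le_max_left _ _), fun x => (hM₂ x).trans (le_max_right _ _), ?_,
    fun x => ?_, ⟨by fun_prop, fun p => ?_, fun p hp => by simp [h0 p hp]⟩, ?_⟩
  · have hLP : 0 < L ^ P := by positivity
    have : ∀ x, EX (A x) = (I x + ENNReal.ofReal (ε * V)) ^ (P / q) * (ENNReal.ofReal (L ^ P))⁻¹ :=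
      fun x => by
        rw [hA, EX_log (hψ0 x), ENNReal.ofReal_div_of_pos hLP, ← hnE,
          ENNReal.ofReal_rpow_of_pos (hn0 x), div_eq_mul_inv]
    simp only [this]
    rw [lintegral_mul_const _ (by fun_prop), ← div_eq_mul_inv]
    exact ENNReal.div_le_of_le_mul (by rw [one_mul]; exact hε.le)
  · have h1 := hn0 x
    have : ∀ y, EX (B (x, y)) =
        (‖F (x, y)‖ₑ ^ q + ENNReal.ofReal ε) * (ENNReal.ofReal (n x))⁻¹ := fun y => by
      rw [hB, EX_log (hφ0 _), ENNReal.ofReal_div_of_pos h1, ENNReal.ofReal_add (by positivity)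
        hε0.le, hFq, div_eq_mul_inv]
    simp only [this]
    have hm2 : Measurable fun y => ‖F (x, y)‖ₑ ^ q + ENNReal.ofReal ε :=
      (hmF.comp measurable_prodMk_left).add_const _
    rw [lintegral_mul_const _ hm2, lintegral_add_right _ measurable_const, ← hI, setLIntegral_const,
      hVE, ← ENNReal.ofReal_mul hε0.le, ← hnE]
    exact ENNReal.mul_inv_le_one _
  · rw [norm_mul, norm_div, Complex.norm_real, Real.norm_of_nonneg hL.le, ← Complex.ofReal_neg,
      Complex.norm_exp_ofReal, Real.exp_neg]
    rw [← div_eq_mul_inv]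
    exact (div_le_one (Real.exp_pos _)).2 (hle p)
  · funext p
    have : (L : ℂ) ≠ 0 := by exact_mod_cast hL.ne'
    rw [tw, mul_assoc, ← Complex.exp_add, neg_add_cancel, Complex.exp_zero, mul_one,
      mul_div_cancel₀ _ this]

/-- The `P`-th power of the mixed norm `L^P(L^q)`. -/
noncomputable def mixI (P q : ℝ) (F : ℝ × ℝ → ℂ) : ℝ≥0∞ :=
  ∫⁻ x, (∫⁻ y, ‖F (x, y)‖ₑ ^ q) ^ (P / q)

/-- Bounded measurable functions vanishing off `Q`. -/
def BO (Q : Set (ℝ × ℝ)) (F : ℝ × ℝ → ℂ) : Prop :=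
  Measurable F ∧ (∃ K, ∀ p, ‖F p‖ ≤ K) ∧ ∀ p ∉ Q, F p = 0

theorem setLIntegral_le_mixI {P q : ℝ} (hP : 0 ≤ P) (hq : 0 ≤ q) (F : ℝ × ℝ → ℂ) (X Y : Set ℝ) :
    ∫⁻ x in X, (∫⁻ y in Y, ‖F (x, y)‖ₑ ^ q) ^ (P / q) ≤ mixI P q F := by
  refine (setLIntegral_le_lintegral _ _).trans (lintegral_mono fun x => ?_)
  have : 0 ≤ P / q := by positivity
  have h2 := setLIntegral_le_lintegral (μ := volume) Y fun y => ‖F (x, y)‖ₑ ^ q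
  dsimp only
  gcongr

theorem Tri_const_mul (K : (ℝ × ℝ) × (ℝ × ℝ) × (ℝ × ℝ) → ℂ) (h F₁ F₂ : ℝ × ℝ → ℂ) (c c₁ c₂ : ℂ) :
    Tri K (fun p => c * h p) (fun p => c₁ * F₁ p) (fun p => c₂ * F₂ p) =
      c₁ * c₂ * c * Tri K h F₁ F₂ := by
  rw [Tri, Tri, ← integral_const_mul]
  congr 1
  funext x
  ring

theorem volume_Icc_neg_ne_zero {R : ℝ} (hR : 0 < R) : volume (Icc (-R) R) ≠ 0 := by
  rw [Real.volume_Icc]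
  simpa using hR

theorem exists_Tri_bound {a b c d : ℝ} (ha : 0 < a) (hc : 0 < c)
    (hab : a < b) (hb : a + b < 1) (hcd : c < d) (hd : c + d < 1)
    (had : a + d < 1) (hbc : b + c < 1) :
    ∃ C : ℝ, 0 < C ∧ ∀ {R S T : ℝ} (_ : 0 < R) (_ : 0 < S) (_ : 0 < T) {h F₁ F₂ : ℝ × ℝ → ℂ}
      {L₁ L₂ L₃ : ℝ},
      BO (Icc (-R) R ×ˢ Icc (-S) S) F₁ → BO (Icc (-R) R ×ˢ Icc (-S) S) F₂ →
      BO (Icc (-T) T ×ˢ Icc (-T) T) h → 0 < L₁ → 0 < L₂ → 0 < L₃ →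
      mixI (1 / (1 - a)) (1 / b) F₁ < ENNReal.ofReal (L₁ ^ (1 / (1 - a))) →
      mixI (1 / (1 - c)) (1 / d) F₂ < ENNReal.ofReal (L₂ ^ (1 / (1 - c))) →
      mixI (1 / (1 - a - d)) (1 / (1 - b - c)) h < ENNReal.ofReal (L₃ ^ (1 / (1 - a - d))) →
      ‖Tri (kF (Icc (-R) R)) h F₁ F₂‖ ≤ C * (L₁ * L₂) * L₃ := by
  obtain ⟨C, hC, H⟩ := exists_est_full ha hc hab hb hcd hd had hbc
  refine ⟨C, hC, fun {R S T} hR hS hT {h F₁ F₂ L₁ L₂ L₃} hF₁ hF₂ hh hL₁ hL₂ hL₃ h1 h2 h3 => ?_⟩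
  have bI : ∀ x : ℝ, Bornology.IsBounded (Icc (-x) x) := fun x => Metric.isBounded_Icc _ _
  have p1 : 0 < 1 / (1 - a) := one_div_pos.2 (by linarith)
  have p2 : 0 < 1 / (1 - c) := one_div_pos.2 (by linarith)
  have p3 : 0 < 1 / (1 - a - d) := one_div_pos.2 (by linarith)
  have q1 : 0 < 1 / b := one_div_pos.2 (by linarith)
  have q2 : 0 < 1 / d := one_div_pos.2 (by linarith)
  have q3 : 0 < 1 / (1 - b - c) := one_div_pos.2 (by linarith)
  obtain ⟨m₁, ⟨K₁, k₁⟩, z₁⟩ := hF₁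
  obtain ⟨m₂, ⟨K₂, k₂⟩, z₂⟩ := hF₂
  obtain ⟨m₃, ⟨K₃, k₃⟩, z₃⟩ := hh
  obtain ⟨A₁, B₁, u₁, M₁, mA₁, mB₁, bA₁, bB₁, iA₁, iB₁, a₁, e₁⟩ :=
    exists_factorization (bI R) (bI S) (volume_Icc_neg_ne_zero hS) m₁ k₁ z₁ p1 q1 hL₁
      ((setLIntegral_le_mixI p1.le q1.le _ _ _).trans_lt h1)
  obtain ⟨A₂, B₂, u₂, M₂, mA₂, mB₂, bA₂, bB₂, iA₂, iB₂, a₂, e₂⟩ :=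
    exists_factorization (bI R) (bI S) (volume_Icc_neg_ne_zero hS) m₂ k₂ z₂ p2 q2 hL₂
      ((setLIntegral_le_mixI p2.le q2.le _ _ _).trans_lt h2)
  obtain ⟨A₃, B₃, u₃, M₃, mA₃, mB₃, bA₃, bB₃, iA₃, iB₃, a₃, e₃⟩ :=
    exists_factorization (bI T) (bI T) (volume_Icc_neg_ne_zero hT) m₃ k₃ z₃ p3 q3 hL₃
      ((setLIntegral_le_mixI p3.le q3.le _ _ _).trans_lt h3)
  obtain ⟨M, hM₁, hM₂, hM₃⟩ : ∃ M, M₁ ≤ M ∧ M₂ ≤ M ∧ M₃ ≤ M :=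
    ⟨max M₁ (max M₂ M₃), le_max_left _ _, (le_max_left _ _).trans (le_max_right _ _),
      (le_max_right _ _).trans (le_max_right _ _)⟩
  have W : Wts (Icc (-R) R) (Icc (-S) S) (Icc (-T) T) A₁ A₂ A₃ B₁ B₂ B₃ M :=
    ⟨measurableSet_Icc, measurableSet_Icc, measurableSet_Icc, bI R, bI S, bI T, mA₁, mA₂, mA₃,
      mB₁, mB₂, mB₃, fun x => (bA₁ x).trans hM₁, fun x => (bA₂ x).trans hM₂,
      fun x => (bA₃ x).trans hM₃, fun x => (bB₁ x).trans hM₁, fun x => (bB₂ x).trans hM₂,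
      fun x => (bB₃ x).trans hM₃, iA₁, iA₂, iA₃, iB₁, iB₂, iB₃⟩
  have := H W u₁ u₂ u₃ a₁ a₂ a₃
  simp only [one_div_one_div] at e₁ e₂ e₃
  rw [e₁, e₂, e₃, Tri_const_mul, norm_mul, norm_mul, norm_mul, Complex.norm_real,
    Complex.norm_real, Complex.norm_real, Real.norm_of_nonneg hL₁.le, Real.norm_of_nonneg hL₂.le,
    Real.norm_of_nonneg hL₃.le]
  calc _ ≤ L₁ * L₂ * L₃ * C := by gcongr
    _ = _ := by ring

/-- Duality for mixed norms of functions of bounded support. -/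
theorem mixI_le_of_dual {Z : Set ℝ} (bZ : Bornology.IsBounded Z) (mZ : MeasurableSet Z)
    {G : ℝ × ℝ → ℂ} (hG : BO (Z ×ˢ Z) G) {r s r' s' K : ℝ} (hr : r.HolderConjugate r')
    (hs : s.HolderConjugate s') (hK : 0 ≤ K)
    (H : ∀ h, BO (Z ×ˢ Z) h → ∀ L : ℝ, 0 < L → mixI r' s' h < ENNReal.ofReal (L ^ r') →
      ‖∫ p, h p * G p‖ ≤ K * L) :
    mixI r s G ≤ ENNReal.ofReal (K ^ r) := by
  obtain ⟨mG, ⟨D, hD⟩, zG⟩ := hG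
  have hD0 : 0 ≤ D := (norm_nonneg _).trans (hD 0)
  have hs0 := hs.pos
  have hr0 := hr.pos
  have hs0' := hs.symm.pos
  have hr0' := hr.symm.pos
  have hZt : volume Z ≠ ⊤ := bZ.measure_lt_top.ne
  have hmG : Measurable fun p => ‖G p‖ₑ ^ s := mG.enorm.pow_const s
  have hmGx : ∀ x, Measurable fun y => ‖G (x, y)‖ₑ ^ s := fun x =>
    hmG.comp measurable_prodMk_left
  have hGs : ∀ p, ‖G p‖ₑ ^ s = ENNReal.ofReal (‖G p‖ ^ s) := fun p => by
    rw [← ofReal_norm, ENNReal.ofReal_rpow_of_nonneg (norm_nonneg _) hs0.le]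
  obtain ⟨I, hI⟩ : ∃ I : ℝ → ℝ≥0∞, ∀ x, I x = ∫⁻ y, ‖G (x, y)‖ₑ ^ s := ⟨_, fun _ => rfl⟩
  have hmI : Measurable I := by
    rw [funext hI]; exact Measurable.lintegral_prod_right' hmG
  have hI0 : ∀ x ∉ Z, I x = 0 := fun x hx => by
    rw [hI, lintegral_eq_zero_of_ae_eq_zero]
    refine .of_forall fun y => ?_
    simp [zG (x, y) (by simp [hx]), hs0]
  obtain ⟨V, hV⟩ : ∃ V, V = volume.real Z := ⟨_, rfl⟩
  have hV0 : 0 ≤ V := hV ▸ measureReal_nonneg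
  have hVE : volume Z = ENNReal.ofReal V := by rw [hV, ofReal_measureReal hZt]
  have hIle : ∀ x, I x ≤ ENNReal.ofReal (D ^ s * V) := fun x => by
    rw [hI, ENNReal.ofReal_mul (by positivity), ← hVE, ← setLIntegral_const,
      ← lintegral_indicator mZ]
    refine lintegral_mono fun y => ?_
    by_cases hy : y ∈ Z
    · rw [indicator_of_mem hy, hGs]
      exact ENNReal.ofReal_le_ofReal (Real.rpow_le_rpow (norm_nonneg _) (hD _) hs0.le)
    · simp [zG (x, y) (by simp [hy]), hs0]
  have hIt : ∀ x, I x ≠ ⊤ := fun x => ((hIle x).trans_lt ENNReal.ofReal_lt_top).ne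
  obtain ⟨n, hn⟩ : ∃ n : ℝ → ℝ, ∀ x, n x = (I x).toReal := ⟨_, fun _ => rfl⟩
  have hmn : Measurable n := by rw [funext hn]; fun_prop
  have hnE : ∀ x, ENNReal.ofReal (n x) = I x := fun x => by rw [hn, ENNReal.ofReal_toReal (hIt x)]
  have hn0 : ∀ x, 0 ≤ n x := fun x => by rw [hn]; exact ENNReal.toReal_nonneg
  have hnD : ∀ x, n x ≤ D ^ s * V := fun x => by
    rw [hn]; exact ENNReal.toReal_le_of_le_ofReal (by positivity) (hIle x)
  have key : ∀ ε : ℝ, 0 < ε →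
      ∫⁻ x, {x | ε ≤ n x}.indicator (fun x => ENNReal.ofReal (n x ^ (r / s))) x ≤
        ENNReal.ofReal (K ^ r) := by
    intro ε hε
    have hmE : MeasurableSet {x | ε ≤ n x} := measurableSet_le measurable_const hmn
    have hEZ : ∀ x, ε ≤ n x → x ∈ Z := fun x hx => by
      by_contra h
      rw [hn, hI0 x h] at hx
      simp at hx
      linarith
    obtain ⟨W, hW⟩ : ∃ W : ℝ → ℝ, W = {x | ε ≤ n x}.indicator fun x => n x ^ (r / s - 1) :=
      ⟨_, rfl⟩
    have hmW : Measurable W := by rw [hW]; exact (hmn.pow_const _).indicator hmE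
    have hW0 : ∀ x, 0 ≤ W x := fun x => by
      rw [hW]; exact indicator_nonneg (fun x _ => Real.rpow_nonneg (hn0 x) _) x
    obtain ⟨DW, hDW⟩ : ∃ DW, ∀ x, W x ≤ DW := by
      refine ⟨max (ε ^ (r / s - 1)) ((D ^ s * V) ^ (r / s - 1)), fun x => ?_⟩
      rw [hW]
      by_cases hx : ε ≤ n x
      · rw [indicator_of_mem (by exact hx)]
        rcases le_total 0 (r / s - 1) with h | h
        · exact (Real.rpow_le_rpow (hn0 x) (hnD x) h).trans (le_max_right _ _)
        · exact (Real.rpow_le_rpow_of_nonpos hε hx h).trans (le_max_left _ _)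
      · rw [indicator_of_notMem (by exact hx)]
        positivity
    have hDW0 : 0 ≤ DW := (hW0 0).trans (hDW 0)
    obtain ⟨J, hJ⟩ : ∃ J : ℝ → ℝ≥0∞,
      J = {x | ε ≤ n x}.indicator (fun x => ENNReal.ofReal (n x ^ (r / s))) := ⟨_, rfl⟩
    rw [← hJ]
    have hWI : ∀ x, ENNReal.ofReal (W x) * I x = J x := fun x => by
      rw [hW, hJ]
      by_cases hx : ε ≤ n x
      · have h1 : 0 < n x := hε.trans_le hx
        rw [indicator_of_mem (by exact hx), indicator_of_mem (by exact hx), ← hnE,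
          ← ENNReal.ofReal_mul (by positivity), ← Real.rpow_add_one h1.ne', sub_add_cancel]
      · rw [indicator_of_notMem (by exact hx), indicator_of_notMem (by exact hx)]
        simp
    have hWI' : ∀ x, (ENNReal.ofReal (W x) ^ s' * I x) ^ (r' / s') = J x := fun x => by
      rw [hW, hJ]
      by_cases hx : ε ≤ n x
      · have h1 : 0 < n x := hε.trans_le hx
        rw [indicator_of_mem (by exact hx), indicator_of_mem (by exact hx), ← hnE,
          ENNReal.ofReal_rpow_of_nonneg (by positivity) hs0'.le,
          ← ENNReal.ofReal_mul (by positivity), ← Real.rpow_mul h1.le, ← Real.rpow_add_one h1.ne',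
          ENNReal.ofReal_rpow_of_nonneg (by positivity) (by positivity), ← Real.rpow_mul h1.le]
        congr 2
        have e1 := hs.inv_add_inv_eq_one
        have e2 := hr.sub_one_mul_conj
        have e3 : s'⁻¹ = 1 - s⁻¹ := by linarith
        calc ((r / s - 1) * s' + 1) * (r' / s') = r' * ((r / s - 1) + s'⁻¹) := by field_simp
          _ = ((r - 1) * r') / s := by rw [e3]; field_simp; ring
          _ = r / s := by rw [e2]
      · rw [indicator_of_notMem (by exact hx), indicator_of_notMem (by exact hx)]
        simp [hs0', hr0']
    have hJt : ∫⁻ x, J x ≠ ⊤ := by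
      refine ne_top_of_le_ne_top (b := ∫⁻ x in Z, ENNReal.ofReal ((D ^ s * V) ^ (r / s))) ?_ ?_
      · rw [setLIntegral_const]
        exact ENNReal.mul_ne_top ENNReal.ofReal_ne_top hZt
      · rw [← lintegral_indicator mZ]
        refine lintegral_mono fun x => ?_
        rw [hJ]
        by_cases hx : ε ≤ n x
        · rw [indicator_of_mem (by exact hx), indicator_of_mem (hEZ x hx)]
          exact ENNReal.ofReal_le_ofReal (Real.rpow_le_rpow (hn0 x) (hnD x) (by positivity))
        · rw [indicator_of_notMem (by exact hx)]
          exact zero_le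
    obtain ⟨h, hh⟩ : ∃ h : ℝ × ℝ → ℂ, ∀ p, h p =
      ((W p.1 * ‖G p‖ ^ (s - 2) : ℝ) : ℂ) * (starRingEnd ℂ) (G p) := ⟨_, fun _ => rfl⟩
    have hpow : ∀ p, ‖G p‖ ^ (s - 2) * ‖G p‖ = ‖G p‖ ^ (s - 1) := fun p => by
      rcases (norm_nonneg (G p)).eq_or_lt with h0 | h0
      · rw [← h0, mul_zero, Real.zero_rpow (by linarith [hs.lt])]
      · rw [← Real.rpow_add_one h0.ne']; ring_nf
    have hhn : ∀ p, ‖h p‖ = W p.1 * ‖G p‖ ^ (s - 1) := fun p => by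
      have := hW0 p.1
      rw [hh, norm_mul, Complex.norm_real, RCLike.norm_conj, Real.norm_of_nonneg (by positivity),
        mul_assoc, hpow]
    have hhG : ∀ p, h p * G p = ((W p.1 * ‖G p‖ ^ s : ℝ) : ℂ) := fun p => by
      have : ‖G p‖ ^ s = ‖G p‖ ^ (s - 2) * ‖G p‖ * ‖G p‖ := by
        rw [hpow]
        rcases (norm_nonneg (G p)).eq_or_lt with h0 | h0
        · rw [← h0, mul_zero, Real.zero_rpow hs0.ne']
        · rw [← Real.rpow_add_one h0.ne']; ring_nf
      rw [hh, mul_assoc, Complex.conj_mul', this]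
      push_cast
      ring
    have hmh : Measurable h := by
      rw [funext hh]
      fun_prop
    have hBO : BO (Z ×ˢ Z) h := by
      refine ⟨hmh, ⟨DW * D ^ (s - 1), fun p => ?_⟩, fun p hp => by rw [hh, zG p hp]; simp⟩
      rw [hhn]
      have h1 : 0 ≤ s - 1 := by linarith [hs.lt]
      have := Real.rpow_le_rpow (norm_nonneg _) (hD p) h1
      have := hDW p.1
      have := hW0 p.1
      gcongr
    have hmix : mixI r' s' h = ∫⁻ x, J x := by
      rw [mixI]
      refine lintegral_congr fun x => ?_
      rw [← hWI', hI, ← lintegral_const_mul _ (hmGx x)]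
      congr 1
      refine lintegral_congr fun y => ?_
      rw [hGs, ← ofReal_norm, hhn, ENNReal.ofReal_mul (hW0 _),
        ENNReal.mul_rpow_of_nonneg _ _ hs0'.le, ENNReal.ofReal_rpow_of_nonneg (p := s')
          (x := ‖G (x, y)‖ ^ (s - 1)) (by positivity) hs0'.le, ← Real.rpow_mul (norm_nonneg _),
        hs.sub_one_mul_conj]
    have h_int : ‖∫ p, h p * G p‖ = (∫⁻ x, J x).toReal := by
      simp only [hhG]
      rw [integral_complex_ofReal, Complex.norm_real, integral_eq_lintegral_of_nonneg_ae]
      · rw [Real.norm_of_nonneg ENNReal.toReal_nonneg]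
        congr 1
        have hm2 : Measurable fun p : ℝ × ℝ => ENNReal.ofReal (W p.1 * ‖G p‖ ^ s) := by fun_prop
        rw [Measure.volume_eq_prod, lintegral_prod _ hm2.aemeasurable]
        refine lintegral_congr fun x => ?_
        rw [← hWI, hI, ← lintegral_const_mul _ (hmGx x)]
        refine lintegral_congr fun y => ?_
        rw [ENNReal.ofReal_mul (hW0 _), hGs]
      · refine .of_forall fun p => ?_
        have := hW0 p.1
        dsimp
        positivity
      · exact (by fun_prop : Measurable fun p : ℝ × ℝ => W p.1 * ‖G p‖ ^ s).aestronglyMeasurable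
    obtain ⟨E, hE⟩ : ∃ E, E = (∫⁻ x, J x).toReal := ⟨_, rfl⟩
    have hEE : ∫⁻ x, J x = ENNReal.ofReal E := by rw [hE, ENNReal.ofReal_toReal hJt]
    have hE0 : 0 ≤ E := hE ▸ ENNReal.toReal_nonneg
    have h5 : ∀ L, E ^ (1 / r') < L → E ≤ K * L := fun L hL => by
      have hL0 : 0 < L := lt_of_le_of_lt (by positivity) hL
      have := H h hBO L hL0 (by
        rw [hmix, hEE]
        refine (ENNReal.ofReal_lt_ofReal_iff (by positivity)).2 ?_
        have := Real.rpow_lt_rpow (by positivity) hL hr0'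
        rwa [← Real.rpow_mul hE0, one_div_mul_cancel hr0'.ne', Real.rpow_one] at this)
      rwa [h_int, ← hE] at this
    have h6 : E ≤ K * E ^ (1 / r') := by
      have h7 : Tendsto (fun L : ℝ => K * L) (𝓝[>] (E ^ (1 / r'))) (𝓝 (K * E ^ (1 / r'))) :=
        ((continuous_const.mul continuous_id).tendsto _).mono_left nhdsWithin_le_nhds
      exact ge_of_tendsto h7 (by filter_upwards [self_mem_nhdsWithin] with L hL using h5 L hL)
    rw [hEE]
    refine ENNReal.ofReal_le_ofReal ?_
    rcases hE0.eq_or_lt with h0 | h0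
    · rw [← h0]; positivity
    · have h8 : E ^ (1 / r) * E ^ (1 / r') = E := by
        rw [← Real.rpow_add h0, one_div, one_div, hr.inv_add_inv_eq_one, Real.rpow_one]
      have h9 : E ^ (1 / r) ≤ K := by
        refine le_of_mul_le_mul_right (a := E ^ (1 / r')) ?_ (by positivity)
        rw [h8]; exact h6
      have := Real.rpow_le_rpow (by positivity) h9 hr0.le
      rwa [← Real.rpow_mul hE0, one_div_mul_cancel hr0.ne', Real.rpow_one] at this
  have hlim : Tendsto (fun k : ℕ => ∫⁻ x,
      {x | 1 / ((k : ℝ) + 1) ≤ n x}.indicator (fun x => ENNReal.ofReal (n x ^ (r / s))) x) atTop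
      (𝓝 (∫⁻ x, I x ^ (r / s))) := by
    refine lintegral_tendsto_of_tendsto_of_monotone (fun k => ?_) (.of_forall fun x => ?_)
      (.of_forall fun x => ?_)
    · have : MeasurableSet {x | 1 / ((k : ℝ) + 1) ≤ n x} := measurableSet_le measurable_const hmn
      exact ((hmn.pow_const _).ennreal_ofReal.indicator this).aemeasurable
    · intro k l hkl
      refine indicator_le_indicator_of_subset (fun x hx => ?_) (fun _ => zero_le) x
      refine le_trans ?_ (show 1 / ((k : ℝ) + 1) ≤ n x from hx)
      exact Nat.one_div_le_one_div hkl
    · rw [← hnE, ENNReal.ofReal_rpow_of_nonneg (hn0 x) (by positivity)]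
      refine tendsto_const_nhds.congr' ?_
      rcases (hn0 x).eq_or_lt with h0 | h0
      · refine .of_forall fun k => ?_
        have : 0 < r / s := by positivity
        dsimp only
        by_cases hx : x ∈ {x | 1 / ((k : ℝ) + 1) ≤ n x}
        · rw [indicator_of_mem hx]
        · rw [indicator_of_notMem hx, ← h0, Real.zero_rpow this.ne', ENNReal.ofReal_zero]
      · filter_upwards [(tendsto_one_div_add_atTop_nhds_zero_nat (𝕜 := ℝ)).eventually_le_const h0]
          with k hk
        rw [indicator_of_mem (by exact hk)]
  rw [mixI]
  simp only [← hI]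
  exact le_of_tendsto' hlim fun k => key _ Nat.one_div_pos_of_nat

theorem mixI_le_of_tendsto {P q : ℝ} (hP : 0 < P) (hq : 0 < q) {g : ℕ → ℝ × ℝ → ℂ}
    {G : ℝ × ℝ → ℂ} {K : ℝ≥0∞} (hm : ∀ n, Measurable (g n))
    (hg : ∀ p, Tendsto (fun n => g n p) atTop (𝓝 (G p))) (h : ∀ n, mixI P q (g n) ≤ K) :
    mixI P q G ≤ K := by
  have hPq : 0 < P / q := by positivity
  have hmq : ∀ n, Measurable fun p => ‖g n p‖ₑ ^ q := fun n => (hm n).enorm.pow_const q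
  have h1 : ∀ x, (∫⁻ y, ‖G (x, y)‖ₑ ^ q) ^ (P / q) ≤
      liminf (fun n => (∫⁻ y, ‖g n (x, y)‖ₑ ^ q) ^ (P / q)) atTop := fun x => by
    have e := (ENNReal.orderIsoRpow (P / q) hPq).liminf_apply (f := atTop)
      (u := fun n => ∫⁻ y, ‖g n (x, y)‖ₑ ^ q)
    simp only [ENNReal.orderIsoRpow_apply] at e
    rw [← e]
    refine ENNReal.rpow_le_rpow ?_ hPq.le
    calc _ = ∫⁻ y, liminf (fun n => ‖g n (x, y)‖ₑ ^ q) atTop := by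
          refine lintegral_congr fun y => ?_
          exact (((ENNReal.continuous_rpow_const.tendsto _).comp (hg (x, y)).enorm).liminf_eq).symm
      _ ≤ _ := lintegral_liminf_le fun n => (hmq n).comp measurable_prodMk_left
  calc mixI P q G ≤ ∫⁻ x, liminf (fun n => (∫⁻ y, ‖g n (x, y)‖ₑ ^ q) ^ (P / q)) atTop :=
        lintegral_mono h1
    _ ≤ liminf (fun n => mixI P q (g n)) atTop :=
        lintegral_liminf_le fun n => (Measurable.lintegral_prod_right' (hmq n)).pow_const _
    _ ≤ K := by
        refine (liminf_le_liminf (.of_forall h)).trans_eq ?_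
        exact tendsto_const_nhds.liminf_eq

theorem mixI_mono {P q : ℝ} (hP : 0 ≤ P) (hq : 0 ≤ q) {F G : ℝ × ℝ → ℂ}
    (h : ∀ p, ‖F p‖ ≤ ‖G p‖) : mixI P q F ≤ mixI P q G := by
  have h1 : 0 ≤ P / q := by positivity
  refine lintegral_mono fun x => ENNReal.rpow_le_rpow (lintegral_mono fun y => ?_) h1
  refine ENNReal.rpow_le_rpow ?_ hq
  rw [← ofReal_norm, ← ofReal_norm]
  exact ENNReal.ofReal_le_ofReal (h _)

theorem measurable_integral_ex_ordK {X : Set ℝ} (hX : MeasurableSet X) :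
    Measurable fun p : ℝ × ℝ => ∫ t, ex (t * p.1) * ordK X p.2 t := by
  have h := (measurable_ordK hX).comp (g := fun p : ℝ × ℝ => ordK X p.1 p.2)
    (f := fun q : (ℝ × ℝ) × ℝ => (q.1.2, q.2)) (by fun_prop)
  have h2 : Measurable fun q : (ℝ × ℝ) × ℝ => ex (q.2 * q.1.1) * ordK X q.1.2 q.2 :=
    Measurable.mul (by fun_prop) h
  exact h2.stronglyMeasurable.integral_prod_right'.measurable

theorem measurable_integral_ex_ordK' {X : Set ℝ} (hX : MeasurableSet X) :
    Measurable fun p : ℝ × ℝ => ∫ t, ex (t * p.1) * ordK X t p.2 := by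
  have h := (measurable_ordK hX).comp (g := fun p : ℝ × ℝ => ordK X p.1 p.2)
    (f := fun q : (ℝ × ℝ) × ℝ => (q.2, q.1.2)) (by fun_prop)
  have h2 : Measurable fun q : (ℝ × ℝ) × ℝ => ex (q.2 * q.1.1) * ordK X q.2 q.1.2 :=
    Measurable.mul (by fun_prop) h
  exact h2.stronglyMeasurable.integral_prod_right'.measurable

theorem measurable_kF {X : Set ℝ} (hX : MeasurableSet X) : Measurable (kF X) := by
  refine Measurable.mul (by fun_prop) (Measurable.mul ?_ ?_)
  · exact (measurable_integral_ex_ordK hX).comp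
      (g := fun p : ℝ × ℝ => ∫ t, ex (t * p.1) * ordK X p.2 t)
      (f := fun x : (ℝ × ℝ) × (ℝ × ℝ) × (ℝ × ℝ) => (x.1.1 - x.2.2.2, x.2.1.1)) (by fun_prop)
  · exact (measurable_integral_ex_ordK' hX).comp
      (g := fun p : ℝ × ℝ => ∫ t, ex (t * p.1) * ordK X t p.2)
      (f := fun x : (ℝ × ℝ) × (ℝ × ℝ) × (ℝ × ℝ) => (x.1.2 - x.2.1.2, x.2.2.1)) (by fun_prop)

theorem norm_kF_le {X : Set ℝ} (hX : MeasurableSet X) (hb : Bornology.IsBounded X)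
    (x : (ℝ × ℝ) × (ℝ × ℝ) × (ℝ × ℝ)) : ‖kF X x‖ ≤ volume.real X * volume.real X := by
  rw [kF, norm_mul, norm_mul, norm_mul, norm_ex, norm_ex, one_mul, one_mul]
  exact mul_le_mul (norm_integral_ex_mul_le hX hb (fun t => (norm_ordK_le _ _).2) _)
    (norm_integral_ex_mul_le hX hb (fun t => (norm_ordK_le _ _).1) _) (norm_nonneg _)
    (by positivity)

theorem kF_eq_zero {X : Set ℝ} {x : (ℝ × ℝ) × (ℝ × ℝ) × (ℝ × ℝ)}
    (h : x.2.1.1 ∉ X ∨ x.2.2.1 ∉ X) : kF X x = 0 := by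
  rcases h with h | h <;> simp [kF, ordK, h]

/-- The bilinear operator with kernel `kF X`. -/
noncomputable def GO (X : Set ℝ) (F₁ F₂ : ℝ × ℝ → ℂ) (z : ℝ × ℝ) : ℂ :=
  ∫ x : (ℝ × ℝ) × (ℝ × ℝ), kF X (z, x) * (F₁ x.1 * F₂ x.2)

section
variable {X : Set ℝ} {F₁ F₂ : ℝ × ℝ → ℂ}

theorem measurable_GO (hX : MeasurableSet X) (m₁ : Measurable F₁) (m₂ : Measurable F₂) :
    Measurable (GO X F₁ F₂) := by
  have h : Measurable fun q : (ℝ × ℝ) × (ℝ × ℝ) × (ℝ × ℝ) => kF X q * (F₁ q.2.1 * F₂ q.2.2) := by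
    have := measurable_kF hX
    fun_prop
  exact h.stronglyMeasurable.integral_prod_right'.measurable

theorem integrable_GO (hX : MeasurableSet X) (hb : Bornology.IsBounded X) (i₁ : Integrable F₁)
    (i₂ : Integrable F₂) (z : ℝ × ℝ) :
    Integrable fun x : (ℝ × ℝ) × (ℝ × ℝ) => kF X (z, x) * (F₁ x.1 * F₂ x.2) :=
  (i₁.mul_prod i₂).bdd_mul ((measurable_kF hX).comp measurable_prodMk_left).aestronglyMeasurable
    (.of_forall fun x => norm_kF_le hX hb (z, x))

theorem exists_norm_GO_le (hX : MeasurableSet X) (hb : Bornology.IsBounded X) (i₁ : Integrable F₁)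
    (i₂ : Integrable F₂) : ∃ K, ∀ z, ‖GO X F₁ F₂ z‖ ≤ K := by
  refine ⟨∫ x : (ℝ × ℝ) × (ℝ × ℝ), volume.real X * volume.real X * ‖F₁ x.1 * F₂ x.2‖, fun z =>
    norm_integral_le_of_norm_le ((i₁.mul_prod i₂).norm.const_mul _) (.of_forall fun x => ?_)⟩
  rw [norm_mul]
  have := norm_kF_le hX hb (z, x)
  gcongr

theorem BO.integrable {Q : Set (ℝ × ℝ)} (hQ : Bornology.IsBounded Q) {F : ℝ × ℝ → ℂ}
    (h : BO Q F) : Integrable F := by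
  obtain ⟨R, hR⟩ := hQ.exists_norm_le
  exact BS.integrable ⟨h.1, h.2.1, R, fun x hx => h.2.2 x fun h => absurd (hR x h) (not_le.2 hx)⟩

theorem Tri_eq_integral (hX : MeasurableSet X) (hb : Bornology.IsBounded X) (i₁ : Integrable F₁)
    (i₂ : Integrable F₂) {h : ℝ × ℝ → ℂ} (ih : Integrable h) :
    Tri (kF X) h F₁ F₂ = ∫ z, h z * GO X F₁ F₂ z := by
  have hi : Integrable fun x : (ℝ × ℝ) × (ℝ × ℝ) × (ℝ × ℝ) =>
      kF X x * (h x.1 * (F₁ x.2.1 * F₂ x.2.2)) :=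
    (ih.mul_prod (i₁.mul_prod i₂)).bdd_mul (measurable_kF hX).aestronglyMeasurable
      (.of_forall fun x => norm_kF_le hX hb x)
  rw [Tri, Measure.volume_eq_prod, integral_prod _ hi]
  refine integral_congr_ae (.of_forall fun z => ?_)
  simp only [GO]
  rw [← integral_const_mul]
  refine integral_congr_ae (.of_forall fun x => ?_)
  simp only
  ring

end

theorem tendsto_indicator_Icc {f : ℝ × ℝ → ℂ} (Q : ℕ → Set (ℝ × ℝ)) (p : ℝ × ℝ)
    (h : ∀ᶠ n in atTop, p ∈ Q n) : Tendsto (fun n => (Q n).indicator f p) atTop (𝓝 (f p)) := by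
  refine tendsto_const_nhds.congr' ?_
  filter_upwards [h] with n hn
  rw [indicator_of_mem hn]

theorem eventually_mem_Icc (x : ℝ) : ∀ᶠ n : ℕ in atTop, x ∈ Icc (-((n : ℝ) + 1)) (n + 1) := by
  filter_upwards [tendsto_natCast_atTop_atTop.eventually_ge_atTop |x|] with n hn
  have := abs_le.1 hn
  exact ⟨by linarith, by linarith⟩

theorem exists_GO_bound {a b c d : ℝ} (ha : 0 < a) (hc : 0 < c)
    (hab : a < b) (hb : a + b < 1) (hcd : c < d) (hd : c + d < 1)
    (had : a + d < 1) (hbc : b + c < 1) :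
    ∃ C : ℝ, 0 < C ∧ ∀ {R : ℝ} (_ : 0 < R) {F₁ F₂ : ℝ × ℝ → ℂ} {L₁ L₂ : ℝ},
      Measurable F₁ → Measurable F₂ → (∃ K, ∀ p, ‖F₁ p‖ ≤ K) → (∃ K, ∀ p, ‖F₂ p‖ ≤ K) →
      Integrable F₁ → Integrable F₂ → 0 < L₁ → 0 < L₂ →
      mixI (1 / (1 - a)) (1 / b) F₁ < ENNReal.ofReal (L₁ ^ (1 / (1 - a))) →
      mixI (1 / (1 - c)) (1 / d) F₂ < ENNReal.ofReal (L₂ ^ (1 / (1 - c))) →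
      mixI (1 / (a + d)) (1 / (b + c)) (GO (Icc (-R) R) F₁ F₂) ≤
        ENNReal.ofReal ((C * (L₁ * L₂)) ^ (1 / (a + d))) := by
  obtain ⟨C, hC, H⟩ := exists_Tri_bound ha hc hab hb hcd hd had hbc
  refine ⟨C, hC, fun {R} hR {F₁ F₂ L₁ L₂} m₁ m₂ b₁ b₂ i₁ i₂ hL₁ hL₂ h1 h2 => ?_⟩
  have bI : ∀ x : ℝ, Bornology.IsBounded (Icc (-x) x) := fun x => Metric.isBounded_Icc _ _
  have p0 : 0 < a + d := by linarith
  have q0 : 0 < b + c := by linarith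
  have p1 : 0 < 1 - a := by linarith
  have p2 : 0 < 1 - c := by linarith
  have q1 : 0 < b := by linarith
  have q2 : 0 < d := by linarith
  have hr : (1 / (a + d)).HolderConjugate (1 / (1 - a - d)) := by
    rw [Real.holderConjugate_iff, one_div, one_div, inv_inv, inv_inv]
    exact ⟨one_lt_inv₀ p0 |>.2 had, by ring⟩
  have hs : (1 / (b + c)).HolderConjugate (1 / (1 - b - c)) := by
    rw [Real.holderConjugate_iff, one_div, one_div, inv_inv, inv_inv]
    exact ⟨one_lt_inv₀ q0 |>.2 hbc, by ring⟩
  have step : ∀ {F₁ F₂ : ℝ × ℝ → ℂ} {S : ℝ}, 0 < S → BO (Icc (-R) R ×ˢ Icc (-S) S) F₁ →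
      BO (Icc (-R) R ×ˢ Icc (-S) S) F₂ →
      mixI (1 / (1 - a)) (1 / b) F₁ < ENNReal.ofReal (L₁ ^ (1 / (1 - a))) →
      mixI (1 / (1 - c)) (1 / d) F₂ < ENNReal.ofReal (L₂ ^ (1 / (1 - c))) →
      mixI (1 / (a + d)) (1 / (b + c)) (GO (Icc (-R) R) F₁ F₂) ≤
        ENNReal.ofReal ((C * (L₁ * L₂)) ^ (1 / (a + d))) := by
    intro F₁ F₂ S hS o₁ o₂ h1 h2
    have i₁ := o₁.integrable ((bI R).prod (bI S))
    have i₂ := o₂.integrable ((bI R).prod (bI S))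
    have mG := measurable_GO (measurableSet_Icc (a := -R) (b := R)) o₁.1 o₂.1
    have mZ : ∀ n : ℕ, MeasurableSet (Icc (-((n : ℝ) + 1)) (n + 1) ×ˢ Icc (-((n : ℝ) + 1)) (n + 1)) :=
      fun n => measurableSet_Icc.prod measurableSet_Icc
    refine mixI_le_of_tendsto (g := fun n : ℕ => (Icc (-((n : ℝ) + 1)) (n + 1) ×ˢ
      Icc (-((n : ℝ) + 1)) (n + 1)).indicator (GO (Icc (-R) R) F₁ F₂)) (by positivity)
      (by positivity) (fun n => mG.indicator (mZ n)) (fun p => ?_) fun n => ?_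
    · refine tendsto_indicator_Icc _ p ?_
      filter_upwards [eventually_mem_Icc p.1, eventually_mem_Icc p.2] with n h1 h2 using ⟨h1, h2⟩
    · obtain ⟨K, hK⟩ := exists_norm_GO_le (measurableSet_Icc (a := -R) (b := R)) (bI R) i₁ i₂
      refine mixI_le_of_dual (bI _) measurableSet_Icc ⟨mG.indicator (mZ n), ⟨K, fun p =>
        (norm_indicator_le_norm_self _ _).trans (hK p)⟩, fun p hp => indicator_of_notMem hp _⟩ hr hs
        (by positivity) fun h hh L hL hhL => ?_
      have := H hR hS (T := (n : ℝ) + 1) (by positivity) o₁ o₂ hh hL₁ hL₂ hL h1 h2 hhL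
      rw [Tri_eq_integral measurableSet_Icc (bI R) i₁ i₂
        (hh.integrable ((bI _).prod (bI _)))] at this
      refine le_trans (le_of_eq ?_) this
      congr 2
      funext p
      by_cases hp : p ∈ Icc (-((n : ℝ) + 1)) (n + 1) ×ˢ Icc (-((n : ℝ) + 1)) (n + 1)
      · rw [indicator_of_mem hp]
      · rw [hh.2.2 p hp, zero_mul, zero_mul]
  obtain ⟨Q, hQ⟩ : ∃ Q : ℕ → Set (ℝ × ℝ),
    ∀ n : ℕ, Q n = Icc (-R) R ×ˢ Icc (-((n : ℝ) + 1)) (n + 1) := ⟨_, fun _ => rfl⟩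
  have mQ : ∀ n, MeasurableSet (Q n) := fun n => by
    rw [hQ]; exact measurableSet_Icc.prod measurableSet_Icc
  have oQ : ∀ {F : ℝ × ℝ → ℂ}, Measurable F → (∃ K, ∀ p, ‖F p‖ ≤ K) → ∀ n,
      BO (Q n) ((Q n).indicator F) := fun hF ⟨K, hK⟩ n =>
    ⟨hF.indicator (mQ n), ⟨K, fun p => (norm_indicator_le_norm_self _ _).trans (hK p)⟩,
      fun p hp => indicator_of_notMem hp _⟩
  refine mixI_le_of_tendsto (g := fun n => GO (Icc (-R) R) ((Q n).indicator F₁)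
    ((Q n).indicator F₂)) (by positivity) (by positivity)
    (fun n => measurable_GO measurableSet_Icc (m₁.indicator (mQ n)) (m₂.indicator (mQ n)))
    (fun z => ?_) fun n => ?_
  · refine tendsto_integral_of_dominated_convergence
      (fun x => volume.real (Icc (-R) R) * volume.real (Icc (-R) R) * ‖F₁ x.1 * F₂ x.2‖)
      (fun n => ?_) ((i₁.mul_prod i₂).norm.const_mul _) (fun n => .of_forall fun x => ?_)
      (.of_forall fun x => ?_)
    · have h3 := m₁.indicator (mQ n)
      have h4 := m₂.indicator (mQ n)
      have h5 := (measurable_kF (measurableSet_Icc (a := -R) (b := R))).comp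
        (measurable_prodMk_left (x := z))
      exact (h5.mul ((h3.comp measurable_fst).mul (h4.comp measurable_snd))).aestronglyMeasurable
    · rw [norm_mul, norm_mul, norm_mul]
      have h3 := norm_kF_le measurableSet_Icc (bI R) (z, x)
      have h4 := norm_indicator_le_norm_self (s := Q n) F₁ x.1
      have h5 := norm_indicator_le_norm_self (s := Q n) F₂ x.2
      gcongr
    · by_cases hx : x.1.1 ∈ Icc (-R) R ∧ x.2.1 ∈ Icc (-R) R
      · refine Tendsto.const_mul _ (Tendsto.mul ?_ ?_)
        · refine tendsto_indicator_Icc _ _ ?_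
          filter_upwards [eventually_mem_Icc x.1.2] with n h1
          rw [hQ]
          exact ⟨hx.1, h1⟩
        · refine tendsto_indicator_Icc _ _ ?_
          filter_upwards [eventually_mem_Icc x.2.2] with n h1
          rw [hQ]
          exact ⟨hx.2, h1⟩
      · have : kF (Icc (-R) R) (z, x) = 0 := kF_eq_zero (not_and_or.1 hx)
        simp only [this, zero_mul]
        exact tendsto_const_nhds
  · have o₁ := oQ m₁ b₁ n
    have o₂ := oQ m₂ b₂ n
    refine step (S := (n : ℝ) + 1) (by positivity) (hQ n ▸ o₁) (hQ n ▸ o₂)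
      (lt_of_le_of_lt ?_ h1) (lt_of_le_of_lt ?_ h2)
    · exact mixI_mono (by positivity) (by positivity) fun p => norm_indicator_le_norm_self _ _
    · exact mixI_mono (by positivity) (by positivity) fun p => norm_indicator_le_norm_self _ _

/-- Swapping the two middle coordinates. -/
def swapMid (x : (ℝ × ℝ) × (ℝ × ℝ)) : (ℝ × ℝ) × (ℝ × ℝ) := ((x.1.1, x.2.1), (x.1.2, x.2.2))

/-- Swapping the second and the fourth coordinate. -/
def swapSnd (x : (ℝ × ℝ) × (ℝ × ℝ)) : (ℝ × ℝ) × (ℝ × ℝ) := ((x.1.1, x.2.2), (x.2.1, x.1.2))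

theorem measurable_swapMid : Measurable swapMid := by unfold swapMid; fun_prop

theorem measurable_swapSnd : Measurable swapSnd := by unfold swapSnd; fun_prop

theorem measurePreserving_swapMid : MeasurePreserving swapMid := by
  refine ⟨measurable_swapMid, ?_⟩
  have h1 : MeasurePreserving (fun q : ℝ × (ℝ × ℝ) => (q.2.1, (q.1, q.2.2))) volume volume :=
    (volume_preserving_prodAssoc (α₁ := ℝ) (β₁ := ℝ) (γ₁ := ℝ)).comp
      (((Measure.measurePreserving_swap (μ := (volume : Measure ℝ)) (ν := (volume : Measure ℝ))).prod
        (MeasurePreserving.id (volume : Measure ℝ))).comp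
        ((volume_preserving_prodAssoc (α₁ := ℝ) (β₁ := ℝ) (γ₁ := ℝ)).symm _))
  have h2 : MeasurePreserving swapMid volume volume :=
    ((volume_preserving_prodAssoc (α₁ := ℝ) (β₁ := ℝ) (γ₁ := ℝ × ℝ)).symm _).comp
      (((MeasurePreserving.id (volume : Measure ℝ)).prod h1).comp
        (volume_preserving_prodAssoc (α₁ := ℝ) (β₁ := ℝ) (γ₁ := ℝ × ℝ)))
  exact h2.map_eq

theorem measurePreserving_swapSnd : MeasurePreserving swapSnd := by
  have h := ((MeasurePreserving.id (volume : Measure (ℝ × ℝ))).prod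
    (Measure.measurePreserving_swap (μ := (volume : Measure ℝ)) (ν := (volume : Measure ℝ))))
  exact h.comp (measurePreserving_swapMid.comp h)

theorem measurableEmbedding_swapMid : MeasurableEmbedding swapMid :=
  (MeasurableEquiv.ofInvolutive swapMid (fun _ => rfl) measurable_swapMid).measurableEmbedding

theorem measurableEmbedding_swapSnd : MeasurableEmbedding swapSnd :=
  (MeasurableEquiv.ofInvolutive swapSnd (fun _ => rfl) measurable_swapSnd).measurableEmbedding

theorem integral_mul_integral_ex {X : Set ℝ} (hX : MeasurableSet X) (hb : Bornology.IsBounded X)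
    {f H : ℝ → ℂ} (hf : Integrable f) (hH : ∀ t, H t = ∫ u, f u * ex (-(u * t))) {k : ℝ → ℂ}
    (hk : Measurable k) (hkX : ∀ t, ‖k t‖ ≤ X.indicator (fun _ => (1 : ℝ)) t) (s : ℝ) :
    ∫ u, f u * ∫ t, ex (t * (s - u)) * k t = ∫ t, ex (t * s) * k t * H t := by
  have ik : Integrable k := by
    refine Integrable.mono' (g := X.indicator fun _ => (1 : ℝ)) ?_ hk.aestronglyMeasurable
      (.of_forall hkX)
    exact (integrable_indicator_iff hX).2 (integrableOn_const hb.measure_lt_top.ne)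
  have hi : Integrable fun p : ℝ × ℝ => ex (p.2 * (s - p.1)) * (f p.1 * k p.2) :=
    (hf.mul_prod ik).bdd_mul (c := 1)
      (by fun_prop : Measurable fun p : ℝ × ℝ => ex (p.2 * (s - p.1))).aestronglyMeasurable
      (.of_forall fun p => (norm_ex _).le)
  calc _ = ∫ u, ∫ t, ex (t * (s - u)) * (f u * k t) := by
        refine integral_congr_ae (.of_forall fun u => ?_)
        simp only
        rw [← integral_const_mul]
        refine integral_congr_ae (.of_forall fun t => ?_)
        simp only
        ring
    _ = ∫ t, ∫ u, ex (t * (s - u)) * (f u * k t) := integral_integral_swap hi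
    _ = _ := by
        refine integral_congr_ae (.of_forall fun t => ?_)
        simp only
        rw [hH, ← integral_const_mul]
        refine integral_congr_ae (.of_forall fun u => ?_)
        simp only
        rw [mul_sub, sub_eq_add_neg, ex_add, mul_comm t u]
        ring

/-- The region of integration, truncated to `X`. -/
def region (X : Set ℝ) : Set ((ℝ × ℝ) × (ℝ × ℝ)) :=
  {w | (w.1.1 ∈ X ∧ w.1.2 ∈ X ∧ w.1.1 < w.1.2) ∧ w.2.1 ∈ X ∧ w.2.2 ∈ X ∧ w.2.1 < w.2.2}

theorem measurableSet_region {X : Set ℝ} (hX : MeasurableSet X) : MeasurableSet (region X) := by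
  have h1 : MeasurableSet {w : (ℝ × ℝ) × (ℝ × ℝ) | w.1.1 < w.1.2} :=
    measurableSet_lt (by fun_prop) (by fun_prop)
  have h2 : MeasurableSet {w : (ℝ × ℝ) × (ℝ × ℝ) | w.2.1 < w.2.2} :=
    measurableSet_lt (by fun_prop) (by fun_prop)
  exact (((measurable_fst.comp measurable_fst) hX).inter
    (((measurable_snd.comp measurable_fst) hX).inter
    h1)).inter (((measurable_fst.comp measurable_snd) hX).inter
      (((measurable_snd.comp measurable_snd) hX).inter h2))

theorem ordK_mul_ordK (X : Set ℝ) (w : (ℝ × ℝ) × (ℝ × ℝ)) :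
    ordK X w.1.1 w.1.2 * ordK X w.2.1 w.2.2 = (region X).indicator (fun _ => 1) w := by
  classical
  by_cases h1 : w.1.1 ∈ X ∧ w.1.2 ∈ X ∧ w.1.1 < w.1.2
  · by_cases h2 : w.2.1 ∈ X ∧ w.2.2 ∈ X ∧ w.2.1 < w.2.2
    · rw [indicator_of_mem (show w ∈ region X from ⟨h1, h2⟩), ordK, ordK, if_pos h1, if_pos h2, one_mul]
    · rw [indicator_of_notMem fun h => h2 h.2, ordK, ordK, if_neg h2, mul_zero]
  · rw [indicator_of_notMem fun h => h1 h.1, ordK, if_neg h1, zero_mul]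

theorem GO_eq {X : Set ℝ} (hX : MeasurableSet X) (hb : Bornology.IsBounded X)
    {F₁ F₂ H₁ H₂ : ℝ × ℝ → ℂ} (i₁ : Integrable F₁) (i₂ : Integrable F₂)
    (j₁ : ∀ x, Integrable fun u => F₁ (x, u)) (j₂ : ∀ x, Integrable fun u => F₂ (x, u))
    (m₁ : Measurable H₁) (m₂ : Measurable H₂) {K₁ K₂ : ℝ} (k₁ : ∀ p, ‖H₁ p‖ ≤ K₁)
    (k₂ : ∀ p, ‖H₂ p‖ ≤ K₂) (e₁ : ∀ x t, H₁ (x, t) = ∫ u, F₁ (x, u) * ex (-(u * t)))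
    (e₂ : ∀ x t, H₂ (x, t) = ∫ u, F₂ (x, u) * ex (-(u * t))) (z : ℝ × ℝ) :
    GO X F₁ F₂ z = ∫ w in region X, H₁ (w.1.1, w.2.1) * H₂ (w.2.2, w.1.2) *
      (ex (z.1 * (w.1.1 + w.1.2)) * ex (z.2 * (w.2.1 + w.2.2))) := by
  have hK₁ : 0 ≤ K₁ := (norm_nonneg _).trans (k₁ 0)
  have hK₂ : 0 ≤ K₂ := (norm_nonneg _).trans (k₂ 0)
  have mo : ∀ x, Measurable fun t => ordK X x t := fun x =>
    (measurable_ordK hX).comp (measurable_prodMk_left (x := x))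
  have mo' : ∀ x, Measurable fun t => ordK X t x := fun x =>
    (measurable_ordK hX).comp (measurable_prodMk_right (y := x))
  obtain ⟨Φ, hΦ⟩ : ∃ Φ : (ℝ × ℝ) × (ℝ × ℝ) → ℂ, ∀ w, Φ w =
    (ex (w.1.1 * z.1) * ex (w.1.2 * z.2)) *
      ((ex (w.2.1 * z.2) * ordK X w.2.1 w.1.2 * H₁ (w.1.1, w.2.1)) *
        (ex (w.2.2 * z.1) * ordK X w.1.1 w.2.2 * H₂ (w.1.2, w.2.2))) := ⟨_, fun _ => rfl⟩
  have mΦ : Measurable Φ := by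
    have h1 := (measurable_ordK hX).comp (g := fun p : ℝ × ℝ => ordK X p.1 p.2)
      (f := fun w : (ℝ × ℝ) × (ℝ × ℝ) => (w.2.1, w.1.2)) (by fun_prop)
    have h2 := (measurable_ordK hX).comp (g := fun p : ℝ × ℝ => ordK X p.1 p.2)
      (f := fun w : (ℝ × ℝ) × (ℝ × ℝ) => (w.1.1, w.2.2)) (by fun_prop)
    rw [funext hΦ]
    refine Measurable.mul (by fun_prop) (Measurable.mul (Measurable.mul (Measurable.mul
      (by fun_prop) h1) (by fun_prop)) (Measurable.mul (Measurable.mul (by fun_prop) h2)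
        (by fun_prop)))
  have iΦ : Integrable Φ := by
    have hb4 : Bornology.IsBounded ((X ×ˢ X) ×ˢ (X ×ˢ X)) := (hb.prod hb).prod (hb.prod hb)
    obtain ⟨R, hR⟩ := hb4.exists_norm_le
    refine BS.integrable ⟨mΦ, ⟨K₁ * K₂, fun w => ?_⟩, R, fun w hw => ?_⟩
    · have h1 : ‖ordK X w.2.1 w.1.2‖ ≤ 1 :=
        (norm_ordK_le _ _).1.trans (indicator_le_self' (fun _ _ => zero_le_one) _)
      have h2 : ‖ordK X w.1.1 w.2.2‖ ≤ 1 :=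
        (norm_ordK_le _ _).1.trans (indicator_le_self' (fun _ _ => zero_le_one) _)
      have h3 := k₁ (w.1.1, w.2.1)
      have h4 := k₂ (w.1.2, w.2.2)
      rw [hΦ]
      simp only [norm_mul, norm_ex, one_mul]
      calc _ ≤ (1 * K₁) * (1 * K₂) := by gcongr
        _ = _ := by ring
    · have : w ∉ (X ×ˢ X) ×ˢ (X ×ˢ X) := fun h => absurd (hR w h) (not_le.2 hw)
      rw [hΦ]
      by_contra h0
      apply this
      by_cases h1 : w.2.1 ∈ X ∧ w.1.2 ∈ X ∧ w.2.1 < w.1.2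
      · by_cases h2 : w.1.1 ∈ X ∧ w.2.2 ∈ X ∧ w.1.1 < w.2.2
        · exact ⟨⟨h2.1, h1.2.1⟩, h1.1, h2.2.1⟩
        · exact absurd (by simp [ordK, h2]) h0
      · exact absurd (by simp [ordK, h1]) h0
  have left : GO X F₁ F₂ z = ∫ q : ℝ × ℝ, ∫ p : ℝ × ℝ, Φ (q, p) := by
    have hi : Integrable fun x => kF X (z, swapMid x) * (F₁ (swapMid x).1 * F₂ (swapMid x).2) :=
      (measurePreserving_swapMid.integrable_comp_emb measurableEmbedding_swapMid).2
      (integrable_GO hX hb i₁ i₂ z)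
    rw [GO, ← measurePreserving_swapMid.integral_comp measurableEmbedding_swapMid,
      Measure.volume_eq_prod, integral_prod _ hi]
    refine integral_congr_ae (.of_forall fun q => ?_)
    simp only [swapMid, kF, hΦ]
    rw [integral_const_mul]
    have e : ∀ p : ℝ × ℝ, ex (q.1 * z.1) * ex (q.2 * z.2) *
        ((∫ t, ex (t * (z.1 - p.2)) * ordK X q.1 t) * ∫ t, ex (t * (z.2 - p.1)) * ordK X t q.2) *
        (F₁ (q.1, p.1) * F₂ (q.2, p.2)) = ex (q.1 * z.1) * ex (q.2 * z.2) *
        ((F₁ (q.1, p.1) * ∫ t, ex (t * (z.2 - p.1)) * ordK X t q.2) *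
          (F₂ (q.2, p.2) * ∫ t, ex (t * (z.1 - p.2)) * ordK X q.1 t)) := fun p => by ring
    simp only [e]
    rw [integral_const_mul]
    congr 1
    rw [Measure.volume_eq_prod,
      integral_prod_mul (fun u => F₁ (q.1, u) * ∫ t, ex (t * (z.2 - u)) * ordK X t q.2)
        (fun u => F₂ (q.2, u) * ∫ t, ex (t * (z.1 - u)) * ordK X q.1 t),
      integral_prod_mul (fun t => ex (t * z.2) * ordK X t q.2 * H₁ (q.1, t))
        (fun t => ex (t * z.1) * ordK X q.1 t * H₂ (q.2, t)),
      integral_mul_integral_ex hX hb (j₁ q.1) (e₁ q.1) (mo' q.2) (fun t => (norm_ordK_le _ _).1),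
      integral_mul_integral_ex hX hb (j₂ q.2) (e₂ q.2) (mo q.1) (fun t => (norm_ordK_le _ _).2)]
  rw [left, ← integral_prod _ iΦ, ← Measure.volume_eq_prod,
    ← measurePreserving_swapSnd.integral_comp measurableEmbedding_swapSnd,
    ← integral_indicator (measurableSet_region hX)]
  refine integral_congr_ae (.of_forall fun w => ?_)
  simp only [hΦ, swapSnd]
  have h1 := ordK_mul_ordK X w
  have e1 : z.1 * (w.1.1 + w.1.2) = w.1.1 * z.1 + w.1.2 * z.1 := by ring
  have e2 : z.2 * (w.2.1 + w.2.2) = w.2.1 * z.2 + w.2.2 * z.2 := by ring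
  calc _ = (ordK X w.1.1 w.1.2 * ordK X w.2.1 w.2.2) * (H₁ (w.1.1, w.2.1) * H₂ (w.2.2, w.1.2) *
      (ex (z.1 * (w.1.1 + w.1.2)) * ex (z.2 * (w.2.1 + w.2.2)))) := by
        rw [e1, e2, ex_add, ex_add]; ring
    _ = _ := by
        rw [h1]
        by_cases hw : w ∈ region X
        · rw [indicator_of_mem hw, indicator_of_mem hw, one_mul]
        · rw [indicator_of_notMem hw, indicator_of_notMem hw, zero_mul]

theorem SchwartzMap.exists_decay_prod (f : 𝓢(ℝ × ℝ, ℂ)) :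
    ∃ C : ℝ, 0 ≤ C ∧ ∀ p : ℝ × ℝ, ‖f p‖ ≤ C * ((1 + p.1 ^ 2)⁻¹ * (1 + p.2 ^ 2)⁻¹) := by
  have h := SchwartzMap.one_add_le_sup_seminorm_apply (𝕜 := ℝ) (m := (4, 0)) le_rfl le_rfl f
  simp only [norm_iteratedFDeriv_zero] at h
  obtain ⟨C, hC⟩ : ∃ C, C = 2 ^ 4 * (Finset.Iic (4, 0)).sup
    (fun m => SchwartzMap.seminorm ℝ m.1 m.2) f := ⟨_, rfl⟩
  rw [← hC] at h
  refine ⟨C, (by positivity : (0 : ℝ) ≤ (1 + ‖(0 : ℝ × ℝ)‖) ^ 4 * ‖f 0‖).trans (h 0), fun p => ?_⟩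
  rw [← mul_inv, ← div_eq_mul_inv, le_div_iff₀ (by positivity), mul_comm]
  refine le_trans ?_ (h p)
  refine mul_le_mul_of_nonneg_right ?_ (norm_nonneg _)
  have h1 : p.1 ^ 2 ≤ ‖p‖ ^ 2 := by
    rw [← sq_abs]; exact pow_le_pow_left₀ (abs_nonneg _) (norm_fst_le p) 2
  have h2 : p.2 ^ 2 ≤ ‖p‖ ^ 2 := by
    rw [← sq_abs]; exact pow_le_pow_left₀ (abs_nonneg _) (norm_snd_le p) 2
  have h3 : 0 ≤ ‖p‖ := norm_nonneg p
  calc (1 + p.1 ^ 2) * (1 + p.2 ^ 2) ≤ (1 + ‖p‖ ^ 2) * (1 + ‖p‖ ^ 2) := by gcongr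
    _ ≤ (1 + ‖p‖) ^ 2 * (1 + ‖p‖) ^ 2 := by
        have : 1 + ‖p‖ ^ 2 ≤ (1 + ‖p‖) ^ 2 := by nlinarith
        gcongr
    _ = _ := by ring

theorem inv_one_add_sq_le_one (x : ℝ) : (1 + x ^ 2)⁻¹ ≤ 1 :=
  inv_le_one_of_one_le₀ (by nlinarith [sq_nonneg x])

theorem inv_one_add_sq_nonneg (x : ℝ) : 0 ≤ (1 + x ^ 2)⁻¹ := by positivity

theorem SchwartzMap.integrable_slice (f : 𝓢(ℝ × ℝ, ℂ)) (y : ℝ) :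
    Integrable fun x => f (x, y) := by
  obtain ⟨C, hC, h⟩ := f.exists_decay_prod
  refine Integrable.mono' (integrable_inv_one_add_sq.const_mul C)
    (f.continuous.comp (by fun_prop : Continuous fun x : ℝ => (x, y))).aestronglyMeasurable
    (.of_forall fun x => (h _).trans ?_)
  exact mul_le_mul_of_nonneg_left (mul_le_of_le_one_right (inv_one_add_sq_nonneg _)
    (inv_one_add_sq_le_one _)) hC

theorem exp_neg_eq_ex (x ξ : ℝ) : Complex.exp (-(2 * π * Complex.I * x * ξ)) = ex (-(x * ξ)) := by
  simp only [ex]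
  congr 1
  push_cast
  ring

theorem FT1v_eq (f : ℝ × ℝ → ℂ) (ξ y : ℝ) : FT1v f ξ y = ∫ x : ℝ, f (x, y) * ex (-(x * ξ)) := by
  simp only [FT1v, exp_neg_eq_ex]

theorem FT1v_eq_fourier (f : ℝ × ℝ → ℂ) (ξ y : ℝ) :
    FT1v f ξ y = 𝓕 (fun x : ℝ => f (x, y)) ξ := by
  rw [FT1v_eq, Real.fourier_real_eq_integral_exp_smul]
  refine integral_congr_ae (.of_forall fun x => ?_)
  simp only [ex, smul_eq_mul]
  rw [mul_comm]
  congr 2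
  push_cast
  ring

theorem SchwartzMap.FT1v_lineDeriv (f : 𝓢(ℝ × ℝ, ℂ)) (ξ y : ℝ) :
    FT1v (LineDeriv.lineDerivOp ((1, 0) : ℝ × ℝ) f : 𝓢(ℝ × ℝ, ℂ)) ξ y
      = (2 * π * I * ξ) * FT1v f ξ y := by
  have hd : ∀ x, HasDerivAt (fun x : ℝ => f (x, y))
      ((LineDeriv.lineDerivOp ((1, 0) : ℝ × ℝ) f : 𝓢(ℝ × ℝ, ℂ)) (x, y)) x := by
    intro x
    rw [SchwartzMap.lineDerivOp_apply_eq_fderiv]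
    have h1 : HasDerivAt (fun x : ℝ => (x, y)) ((1 : ℝ), (0 : ℝ)) x :=
      (hasDerivAt_id x).prodMk (hasDerivAt_const x y)
    exact HasFDerivAt.comp_hasDerivAt x (f.differentiableAt.hasFDerivAt) h1
  have hd' : deriv (fun x : ℝ => f (x, y))
      = fun x => (LineDeriv.lineDerivOp ((1, 0) : ℝ × ℝ) f : 𝓢(ℝ × ℝ, ℂ)) (x, y) :=
    funext fun x => (hd x).deriv
  have h := Real.fourier_deriv (f.integrable_slice y) (fun x => (hd x).differentiableAt)
    (by rw [hd']; exact SchwartzMap.integrable_slice _ y)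
  rw [FT1v_eq_fourier, FT1v_eq_fourier, ← hd', h]
  simp

theorem SchwartzMap.exists_FT1v_le (f : 𝓢(ℝ × ℝ, ℂ)) :
    ∃ C : ℝ, 0 ≤ C ∧ ∀ ξ y, ‖FT1v f ξ y‖ ≤ C * (1 + y ^ 2)⁻¹ := by
  obtain ⟨C, hC, h⟩ := f.exists_decay_prod
  refine ⟨C * π, by positivity, fun ξ y => ?_⟩
  rw [FT1v_eq]
  refine (norm_integral_le_integral_norm _).trans ?_
  calc _ ≤ ∫ x : ℝ, C * (1 + y ^ 2)⁻¹ * (1 + x ^ 2)⁻¹ := by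
        refine integral_mono_of_nonneg (.of_forall fun x => norm_nonneg _)
          (integrable_inv_one_add_sq.const_mul _) (.of_forall fun x => ?_)
        simp only [norm_mul, norm_ex, mul_one]
        exact (h _).trans (le_of_eq (by ring))
    _ = _ := by
        rw [integral_const_mul, integral_univ_inv_one_add_sq]; ring

theorem SchwartzMap.exists_FT1v_decay (f : 𝓢(ℝ × ℝ, ℂ)) :
    ∃ C : ℝ, 0 ≤ C ∧ ∀ ξ y, ‖FT1v f ξ y‖ ≤ C * ((1 + ξ ^ 2)⁻¹ * (1 + y ^ 2)⁻¹) := by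
  obtain ⟨A, hA, h⟩ := f.exists_FT1v_le
  obtain ⟨B, hB, h'⟩ := SchwartzMap.exists_FT1v_le
    (LineDeriv.lineDerivOp ((1, 0) : ℝ × ℝ) (LineDeriv.lineDerivOp ((1, 0) : ℝ × ℝ) f) :
      𝓢(ℝ × ℝ, ℂ))
  refine ⟨A + B, by positivity, fun ξ y => ?_⟩
  have h2 := h' ξ y
  rw [SchwartzMap.FT1v_lineDeriv, SchwartzMap.FT1v_lineDeriv] at h2
  have h3 : ξ ^ 2 * ‖FT1v f ξ y‖ ≤ B * (1 + y ^ 2)⁻¹ := by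
    refine le_trans ?_ h2
    simp only [norm_mul, norm_real, norm_I, Complex.norm_ofNat, mul_one, Real.norm_eq_abs,
      abs_of_pos Real.pi_pos]
    have : 2 * π * |ξ| * (2 * π * |ξ| * ‖FT1v f ξ y‖) = (2 * π) ^ 2 * (ξ ^ 2 * ‖FT1v f ξ y‖) := by
      rw [← sq_abs ξ]; ring
    rw [this]
    refine le_mul_of_one_le_left (by positivity) ?_
    nlinarith [Real.pi_gt_three]
  rw [mul_left_comm, ← div_eq_inv_mul, le_div_iff₀ (by positivity)]
  calc _ = ‖FT1v f ξ y‖ + ξ ^ 2 * ‖FT1v f ξ y‖ := by ring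
    _ ≤ A * (1 + y ^ 2)⁻¹ + B * (1 + y ^ 2)⁻¹ := add_le_add (h ξ y) h3
    _ = _ := by ring

theorem SchwartzMap.measurable_FT1v (f : 𝓢(ℝ × ℝ, ℂ)) :
    Measurable fun p : ℝ × ℝ => FT1v f p.1 p.2 := by
  simp only [FT1v_eq]
  have hc : Continuous fun q : (ℝ × ℝ) × ℝ => f (q.2, q.1.2) * ex (-(q.2 * q.1.1)) :=
    (f.continuous.comp (by fun_prop)).mul (continuous_ex.comp (by fun_prop))
  exact (hc.stronglyMeasurable.integral_prod_right' (ν := volume)).measurable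

theorem integrable_inv_one_add_sq_prod :
    Integrable fun p : ℝ × ℝ => (1 + p.1 ^ 2)⁻¹ * (1 + p.2 ^ 2)⁻¹ :=
  integrable_inv_one_add_sq.mul_prod integrable_inv_one_add_sq

theorem SchwartzMap.integrable_FT1v (f : 𝓢(ℝ × ℝ, ℂ)) :
    Integrable fun p : ℝ × ℝ => FT1v f p.1 p.2 := by
  obtain ⟨C, hC, h⟩ := f.exists_FT1v_decay
  exact Integrable.mono' (integrable_inv_one_add_sq_prod.const_mul C)
    f.measurable_FT1v.aestronglyMeasurable (.of_forall fun p => h p.1 p.2)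

theorem SchwartzMap.integrable_FT1v_slice (f : 𝓢(ℝ × ℝ, ℂ)) (ξ : ℝ) :
    Integrable fun y => FT1v f ξ y := by
  obtain ⟨C, hC, h⟩ := f.exists_FT1v_le
  exact Integrable.mono' (integrable_inv_one_add_sq.const_mul C)
    (f.measurable_FT1v.comp (measurable_prodMk_left (x := ξ))).aestronglyMeasurable
    (.of_forall fun y => h ξ y)

theorem SchwartzMap.exists_norm_FT1v_le (f : 𝓢(ℝ × ℝ, ℂ)) :
    ∃ K : ℝ, ∀ p : ℝ × ℝ, ‖FT1v f p.1 p.2‖ ≤ K := by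
  obtain ⟨C, hC, h⟩ := f.exists_FT1v_le
  exact ⟨C, fun p => (h p.1 p.2).trans (mul_le_of_le_one_right hC (inv_one_add_sq_le_one _))⟩

theorem FT2_eq (f : ℝ × ℝ → ℂ) (ξ : ℝ × ℝ) :
    FT2 f ξ = ∫ x : ℝ × ℝ, f x * (ex (-(x.1 * ξ.1)) * ex (-(x.2 * ξ.2))) := by
  simp only [FT2, ← ex_add]
  refine integral_congr_ae (.of_forall fun x => ?_)
  simp only [ex]
  congr 2
  push_cast
  ring

theorem SchwartzMap.FT2_eq_integral_FT1v (f : 𝓢(ℝ × ℝ, ℂ)) (ξ t : ℝ) :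
    FT2 f (ξ, t) = ∫ u, FT1v f ξ u * ex (-(u * t)) := by
  rw [FT2_eq]
  have hi : Integrable (fun x : ℝ × ℝ => f x * (ex (-(x.1 * ξ)) * ex (-(x.2 * t))))
      (volume.prod volume) := by
    refine (f.integrable (μ := volume)).mul_bdd (c := 1) (Continuous.aestronglyMeasurable ?_)
      (.of_forall fun x => ?_)
    · exact (continuous_ex.comp (by fun_prop)).mul (continuous_ex.comp (by fun_prop))
    · simp [norm_ex]
  rw [Measure.volume_eq_prod, integral_prod_symm _ hi]
  refine integral_congr_ae (.of_forall fun u => ?_)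
  simp only
  rw [FT1v_eq, ← integral_mul_const]
  refine integral_congr_ae (.of_forall fun x => ?_)
  simp only
  ring

theorem SchwartzMap.measurable_FT2 (f : 𝓢(ℝ × ℝ, ℂ)) : Measurable (FT2 f) := by
  have hc : Continuous fun q : (ℝ × ℝ) × (ℝ × ℝ) =>
      f q.2 * (ex (-(q.2.1 * q.1.1)) * ex (-(q.2.2 * q.1.2))) :=
    (f.continuous.comp (by fun_prop)).mul ((continuous_ex.comp (by fun_prop)).mul
      (continuous_ex.comp (by fun_prop)))
  have h := (hc.stronglyMeasurable.integral_prod_right' (ν := volume)).measurable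
  have he : FT2 f = fun ξ : ℝ × ℝ =>
    ∫ x : ℝ × ℝ, f x * (ex (-(x.1 * ξ.1)) * ex (-(x.2 * ξ.2))) := funext fun ξ => FT2_eq f ξ
  rw [he]
  exact h

theorem norm_FT2_le (f : ℝ × ℝ → ℂ) (ξ : ℝ × ℝ) : ‖FT2 f ξ‖ ≤ ∫ x, ‖f x‖ := by
  rw [FT2_eq]
  refine (norm_integral_le_integral_norm _).trans (le_of_eq ?_)
  simp [norm_ex]

/-- The Schwartz function with the two variables exchanged. -/
noncomputable def SchwartzMap.swap (f : 𝓢(ℝ × ℝ, ℂ)) : 𝓢(ℝ × ℝ, ℂ) :=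
  SchwartzMap.compCLMOfContinuousLinearEquiv ℝ (ContinuousLinearEquiv.prodComm ℝ ℝ ℝ) f

theorem SchwartzMap.FT2v_eq (f : 𝓢(ℝ × ℝ, ℂ)) (x η : ℝ) : FT2v f x η = FT1v f.swap η x := rfl

theorem SchwartzMap.FT2_swap (f : 𝓢(ℝ × ℝ, ℂ)) (x η : ℝ) : FT2 f.swap (x, η) = FT2 f (η, x) := by
  have hp : MeasurePreserving (Prod.swap : ℝ × ℝ → ℝ × ℝ) volume volume :=
    Measure.measurePreserving_swap
  rw [FT2_eq, FT2_eq, ← hp.integral_comp MeasurableEquiv.prodComm.measurableEmbedding]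
  refine integral_congr_ae (.of_forall fun p => ?_)
  simp only [Prod.fst_swap, Prod.snd_swap]
  rw [show f.swap p.swap = f p from rfl, mul_comm (ex _)]

theorem SchwartzMap.integrable_norm_FT1v_rpow (f : 𝓢(ℝ × ℝ, ℂ)) {q : ℝ} (hq : 1 ≤ q) (ξ : ℝ) :
    Integrable fun y => ‖FT1v f ξ y‖ ^ q := by
  obtain ⟨C, hC, h⟩ := f.exists_FT1v_le
  refine Integrable.mono' (integrable_inv_one_add_sq.const_mul (C ^ q))
    (((f.measurable_FT1v.comp (measurable_prodMk_left (x := ξ))).norm).pow_const q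
      ).aestronglyMeasurable (.of_forall fun y => ?_)
  rw [Real.norm_of_nonneg (by positivity)]
  calc _ ≤ (C * (1 + y ^ 2)⁻¹) ^ q := Real.rpow_le_rpow (norm_nonneg _) (h ξ y) (by linarith)
    _ = C ^ q * ((1 + y ^ 2)⁻¹) ^ q := Real.mul_rpow hC (inv_one_add_sq_nonneg _)
    _ ≤ _ := by
        refine mul_le_mul_of_nonneg_left ?_ (by positivity)
        exact Real.rpow_le_self_of_le_one (inv_one_add_sq_nonneg _) (inv_one_add_sq_le_one _) hq

theorem SchwartzMap.integrable_mixed_FT1v (f : 𝓢(ℝ × ℝ, ℂ)) {P q : ℝ} (hP : 1 ≤ P) (hq : 1 ≤ q) :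
    Integrable fun ξ => (∫ y, ‖FT1v f ξ y‖ ^ q) ^ (P / q) := by
  obtain ⟨C, hC, h⟩ := f.exists_FT1v_decay
  have hq0 : 0 < q := by linarith
  have hm : Measurable fun ξ => (∫ y, ‖FT1v f ξ y‖ ^ q) ^ (P / q) :=
    (((f.measurable_FT1v.norm.pow_const q).stronglyMeasurable.integral_prod_right'
      (ν := volume)).measurable).pow_const _
  refine Integrable.mono' (integrable_inv_one_add_sq.const_mul (C ^ P * π ^ (P / q)))
    hm.aestronglyMeasurable (.of_forall fun ξ => ?_)
  have h0 : 0 ≤ ∫ y, ‖FT1v f ξ y‖ ^ q := integral_nonneg fun y => by positivity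
  rw [Real.norm_of_nonneg (by positivity)]
  have h1 : ∫ y, ‖FT1v f ξ y‖ ^ q ≤ (C * (1 + ξ ^ 2)⁻¹) ^ q * π := by
    rw [← integral_univ_inv_one_add_sq, ← integral_const_mul]
    refine integral_mono (f.integrable_norm_FT1v_rpow hq ξ)
      (integrable_inv_one_add_sq.const_mul _) fun y => ?_
    calc _ ≤ (C * (1 + ξ ^ 2)⁻¹ * (1 + y ^ 2)⁻¹) ^ q :=
          Real.rpow_le_rpow (norm_nonneg _) ((h ξ y).trans (le_of_eq (by ring))) hq0.le
      _ = (C * (1 + ξ ^ 2)⁻¹) ^ q * ((1 + y ^ 2)⁻¹) ^ q :=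
          Real.mul_rpow (by positivity) (inv_one_add_sq_nonneg _)
      _ ≤ _ := by
          refine mul_le_mul_of_nonneg_left ?_ (by positivity)
          exact Real.rpow_le_self_of_le_one (inv_one_add_sq_nonneg _) (inv_one_add_sq_le_one _) hq
  calc _ ≤ ((C * (1 + ξ ^ 2)⁻¹) ^ q * π) ^ (P / q) := Real.rpow_le_rpow h0 h1 (by positivity)
    _ = C ^ P * ((1 + ξ ^ 2)⁻¹) ^ P * π ^ (P / q) := by
        rw [Real.mul_rpow (by positivity) Real.pi_pos.le, ← Real.rpow_mul (by positivity),
          mul_div_cancel₀ _ hq0.ne', Real.mul_rpow hC (inv_one_add_sq_nonneg _)]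
    _ ≤ C ^ P * (1 + ξ ^ 2)⁻¹ * π ^ (P / q) := by
        gcongr
        exact Real.rpow_le_self_of_le_one (inv_one_add_sq_nonneg _) (inv_one_add_sq_le_one _) hP
    _ = _ := by ring

theorem SchwartzMap.mixI_FT1v (f : 𝓢(ℝ × ℝ, ℂ)) {P q : ℝ} (hP : 1 ≤ P) (hq : 1 ≤ q) :
    mixI P q (fun p => FT1v f p.1 p.2)
      = ENNReal.ofReal (∫ ξ, (∫ y, ‖FT1v f ξ y‖ ^ q) ^ (P / q)) := by
  have hq0 : 0 < q := by linarith
  rw [ofReal_integral_eq_lintegral_ofReal (f.integrable_mixed_FT1v hP hq)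
    (.of_forall fun ξ => Real.rpow_nonneg (integral_nonneg fun y => by positivity) _), mixI]
  refine lintegral_congr fun ξ => ?_
  rw [← ENNReal.ofReal_rpow_of_nonneg (integral_nonneg fun y => by positivity) (by positivity),
    ofReal_integral_eq_lintegral_ofReal (f.integrable_norm_FT1v_rpow hq ξ)
      (.of_forall fun y => by positivity)]
  congr 1
  refine lintegral_congr fun y => ?_
  rw [← ENNReal.ofReal_rpow_of_nonneg (norm_nonneg _) hq0.le, ofReal_norm]

theorem integral_mixed_le {r s : ℝ} (hr : 0 < r) (hs : 0 < s) {G : ℝ × ℝ → ℂ} {M : ℝ}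
    (hM : 0 ≤ M) (h : mixI r s G ≤ ENNReal.ofReal (M ^ r)) :
    (∫ x : ℝ, (∫ y : ℝ, ‖G (x, y)‖ ^ s) ^ (r / s)) ^ (1 / r) ≤ M := by
  have h0 : ∀ x, 0 ≤ ∫ y : ℝ, ‖G (x, y)‖ ^ s := fun x => integral_nonneg fun y => by positivity
  have h1 : ‖∫ x : ℝ, (∫ y : ℝ, ‖G (x, y)‖ ^ s) ^ (r / s)‖ₑ ≤ mixI r s G := by
    refine (enorm_integral_le_lintegral_enorm _).trans (lintegral_mono fun x => ?_)
    rw [Real.enorm_rpow_of_nonneg (h0 x) (by positivity)]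
    refine ENNReal.rpow_le_rpow ?_ (by positivity)
    refine (enorm_integral_le_lintegral_enorm _).trans (lintegral_mono fun y => ?_)
    simp only
    rw [Real.enorm_rpow_of_nonneg (norm_nonneg _) hs.le, enorm_norm]
  have h2 : 0 ≤ ∫ x : ℝ, (∫ y : ℝ, ‖G (x, y)‖ ^ s) ^ (r / s) :=
    integral_nonneg fun x => Real.rpow_nonneg (h0 x) _
  have h3 : ∫ x : ℝ, (∫ y : ℝ, ‖G (x, y)‖ ^ s) ^ (r / s) ≤ M ^ r := by
    have h4 := h1.trans h
    rw [Real.enorm_of_nonneg h2] at h4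
    exact (ENNReal.ofReal_le_ofReal_iff (by positivity)).1 h4
  calc _ ≤ (M ^ r) ^ (1 / r) := Real.rpow_le_rpow h2 h3 (by positivity)
    _ = M := by rw [← Real.rpow_mul hM, mul_one_div_cancel hr.ne', Real.rpow_one]

theorem BHT2_eq (f₁ f₂ : ℝ × ℝ → ℂ) (z : ℝ × ℝ) : BHT2 f₁ f₂ z =
    ∫ w in {w : (ℝ × ℝ) × (ℝ × ℝ) | w.1.1 < w.1.2 ∧ w.2.1 < w.2.2},
      FT2 f₁ (w.1.1, w.2.1) * FT2 f₂ (w.1.2, w.2.2) *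
        (ex (z.1 * (w.1.1 + w.1.2)) * ex (z.2 * (w.2.1 + w.2.2))) := by
  rw [BHT2]
  refine integral_congr_ae (.of_forall fun w => ?_)
  simp only [← ex_add]
  congr 1
  simp only [ex]
  congr 1
  push_cast
  ring

theorem iUnion_region_Icc :
    ⋃ n : ℕ, region (Icc (-((n : ℝ) + 1)) (n + 1)) =
      {w : (ℝ × ℝ) × (ℝ × ℝ) | w.1.1 < w.1.2 ∧ w.2.1 < w.2.2} := by
  ext w
  simp only [mem_iUnion, region, mem_ofPred_eq]
  constructor
  · rintro ⟨n, h⟩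
    exact ⟨h.1.2.2, h.2.2.2⟩
  · rintro ⟨h1, h2⟩
    obtain ⟨n, a, b, c, d⟩ := ((eventually_mem_Icc w.1.1).and ((eventually_mem_Icc w.1.2).and
      ((eventually_mem_Icc w.2.1).and (eventually_mem_Icc w.2.2)))).exists
    exact ⟨n, ⟨a, b, h1⟩, c, d, h2⟩

theorem monotone_region_Icc :
    Monotone fun n : ℕ => region (Icc (-((n : ℝ) + 1)) (n + 1)) := by
  intro n m h
  have h' : (n : ℝ) ≤ m := by exact_mod_cast h
  have hs : Icc (-((n : ℝ) + 1)) (n + 1) ⊆ Icc (-((m : ℝ) + 1)) (m + 1) :=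
    Icc_subset_Icc (by linarith) (by linarith)
  rintro w ⟨⟨a, b, h1⟩, c, d, h2⟩
  exact ⟨⟨hs a, hs b, h1⟩, hs c, hs d, h2⟩

theorem SchwartzMap.GO_eq_setIntegral (f₁ f₂ : 𝓢(ℝ × ℝ, ℂ)) (n : ℕ) (z : ℝ × ℝ) :
    GO (Icc (-((n : ℝ) + 1)) (n + 1)) (fun p => FT1v f₁ p.1 p.2) (fun p => FT1v f₂.swap p.1 p.2) z
      = ∫ w in region (Icc (-((n : ℝ) + 1)) (n + 1)),
        FT2 f₁ (w.1.1, w.2.1) * FT2 f₂ (w.1.2, w.2.2) *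
          (ex (z.1 * (w.1.1 + w.1.2)) * ex (z.2 * (w.2.1 + w.2.2))) := by
  rw [GO_eq measurableSet_Icc (Metric.isBounded_Icc _ _) f₁.integrable_FT1v
    f₂.swap.integrable_FT1v f₁.integrable_FT1v_slice f₂.swap.integrable_FT1v_slice
    f₁.measurable_FT2 f₂.swap.measurable_FT2 (norm_FT2_le _) (norm_FT2_le _)
    f₁.FT2_eq_integral_FT1v f₂.swap.FT2_eq_integral_FT1v]
  simp only [SchwartzMap.FT2_swap]

theorem SchwartzMap.tendsto_GO (f₁ f₂ : 𝓢(ℝ × ℝ, ℂ))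
    (hi : IntegrableOn (fun w : (ℝ × ℝ) × (ℝ × ℝ) =>
      FT2 f₁ (w.1.1, w.2.1) * FT2 f₂ (w.1.2, w.2.2)) {w | w.1.1 < w.1.2 ∧ w.2.1 < w.2.2})
    (z : ℝ × ℝ) :
    Tendsto (fun n : ℕ => GO (Icc (-((n : ℝ) + 1)) (n + 1)) (fun p => FT1v f₁ p.1 p.2)
      (fun p => FT1v f₂.swap p.1 p.2) z) atTop (𝓝 (BHT2 f₁ f₂ z)) := by
  simp only [SchwartzMap.GO_eq_setIntegral, BHT2_eq, ← iUnion_region_Icc]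
  refine tendsto_setIntegral_of_monotone (fun n => measurableSet_region measurableSet_Icc)
    monotone_region_Icc ?_
  rw [iUnion_region_Icc]
  refine Integrable.mul_bdd (c := 1) hi (Continuous.aestronglyMeasurable ?_)
    (.of_forall fun w => ?_)
  · exact (continuous_ex.comp (by fun_prop)).mul (continuous_ex.comp (by fun_prop))
  · simp [norm_ex]

theorem SchwartzMap.BHT2_eq_zero (f₁ f₂ : 𝓢(ℝ × ℝ, ℂ))
    (hi : ¬ IntegrableOn (fun w : (ℝ × ℝ) × (ℝ × ℝ) =>
      FT2 f₁ (w.1.1, w.2.1) * FT2 f₂ (w.1.2, w.2.2)) {w | w.1.1 < w.1.2 ∧ w.2.1 < w.2.2})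
    (z : ℝ × ℝ) : BHT2 f₁ f₂ z = 0 := by
  rw [BHT2_eq]
  refine integral_undef fun h => hi ?_
  have h' := Integrable.mul_bdd (c := 1) (g := fun w : (ℝ × ℝ) × (ℝ × ℝ) =>
    ex (-(z.1 * (w.1.1 + w.1.2))) * ex (-(z.2 * (w.2.1 + w.2.2)))) h
    (Continuous.aestronglyMeasurable
      ((continuous_ex.comp (by fun_prop)).mul (continuous_ex.comp (by fun_prop))))
    (.of_forall fun w => by simp [norm_ex])
  refine h'.congr (.of_forall fun w => ?_)
  simp only
  have e : ∀ t : ℝ, ex t * ex (-t) = 1 := fun t => by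
    rw [← ex_add, add_neg_cancel]; simp [ex]
  linear_combination (FT2 f₁ (w.1.1, w.2.1) * FT2 f₂ (w.1.2, w.2.2)) *
    (ex (z.2 * (w.2.1 + w.2.2)) * ex (-(z.2 * (w.2.1 + w.2.2))) * e (z.1 * (w.1.1 + w.1.2)) +
      e (z.2 * (w.2.1 + w.2.2)))

theorem SchwartzMap.mixI_BHT2_le {a b c d : ℝ} (ha : 0 < a) (hc : 0 < c)
    (hab : a < b) (hb : a + b < 1) (hcd : c < d) (hd : c + d < 1)
    (had : a + d < 1) (hbc : b + c < 1) :
    ∃ C : ℝ, 0 < C ∧ ∀ (f₁ f₂ : 𝓢(ℝ × ℝ, ℂ)) {L₁ L₂ : ℝ}, 0 < L₁ → 0 < L₂ →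
      mixI (1 / (1 - a)) (1 / b) (fun p => FT1v f₁ p.1 p.2)
        < ENNReal.ofReal (L₁ ^ (1 / (1 - a))) →
      mixI (1 / (1 - c)) (1 / d) (fun p => FT1v f₂.swap p.1 p.2)
        < ENNReal.ofReal (L₂ ^ (1 / (1 - c))) →
      mixI (1 / (a + d)) (1 / (b + c)) (BHT2 f₁ f₂) ≤
        ENNReal.ofReal ((C * (L₁ * L₂)) ^ (1 / (a + d))) := by
  obtain ⟨C, hC, H⟩ := exists_GO_bound ha hc hab hb hcd hd had hbc
  refine ⟨C, hC, fun f₁ f₂ L₁ L₂ hL₁ hL₂ h₁ h₂ => ?_⟩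
  have hP : 0 < 1 / (a + d) := one_div_pos.2 (by linarith)
  have hq : 0 < 1 / (b + c) := one_div_pos.2 (by linarith)
  have hn : ∀ n : ℕ, mixI (1 / (a + d)) (1 / (b + c)) (GO (Icc (-((n : ℝ) + 1)) (n + 1))
      (fun p => FT1v f₁ p.1 p.2) (fun p => FT1v f₂.swap p.1 p.2)) ≤
      ENNReal.ofReal ((C * (L₁ * L₂)) ^ (1 / (a + d))) := fun n =>
    H (by positivity) f₁.measurable_FT1v f₂.swap.measurable_FT1v f₁.exists_norm_FT1v_le
      f₂.swap.exists_norm_FT1v_le f₁.integrable_FT1v f₂.swap.integrable_FT1v hL₁ hL₂ h₁ h₂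
  by_cases hi : IntegrableOn (fun w : (ℝ × ℝ) × (ℝ × ℝ) =>
      FT2 f₁ (w.1.1, w.2.1) * FT2 f₂ (w.1.2, w.2.2)) {w | w.1.1 < w.1.2 ∧ w.2.1 < w.2.2}
  · exact mixI_le_of_tendsto hP hq
      (fun n => measurable_GO measurableSet_Icc f₁.measurable_FT1v f₂.swap.measurable_FT1v)
      (f₁.tendsto_GO f₂ hi) hn
  · refine (mixI_mono hP.le hq.le fun p => ?_).trans (hn 0)
    rw [f₁.BHT2_eq_zero f₂ hi, norm_zero]
    exact norm_nonneg _

theorem ENNReal.ofReal_lt_ofReal_rpow_add {P N ε : ℝ} (hP : 0 < P) (hN : 0 ≤ N) (hε : 0 < ε) :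
    ENNReal.ofReal N < ENNReal.ofReal ((N ^ (1 / P) + ε) ^ P) := by
  refine (ENNReal.ofReal_lt_ofReal_iff (by positivity)).2 ?_
  calc N = (N ^ (1 / P)) ^ P := by
        rw [← Real.rpow_mul hN, one_div_mul_cancel hP.ne', Real.rpow_one]
    _ < _ := Real.rpow_lt_rpow (by positivity) (by linarith) hP

theorem le_mul_mul_of_forall_pos_le_add {A C a b : ℝ}
    (h : ∀ ε : ℝ, 0 < ε → A ≤ C * ((a + ε) * (b + ε))) : A ≤ C * a * b := by
  have hlim : Tendsto (fun ε : ℝ => C * ((a + ε) * (b + ε))) (𝓝[>] 0)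
      (𝓝 (C * ((a + 0) * (b + 0)))) :=
    (Continuous.tendsto (by fun_prop) 0).mono_left nhdsWithin_le_nhds
  rw [add_zero, add_zero, ← mul_assoc] at hlim
  exact ge_of_tendsto hlim (eventually_mem_nhdsWithin.mono fun ε hε => h ε hε)

end

/-- mixed estimates for `BHT ⊗ BHT` with one function Wiener in the
first variable and the other Wiener in the second variable.  Here `p₁' = p₁/(p₁-1)`,
`p₂' = p₂/(p₂-1)`, `r = p₁q₂/(p₁+q₂)` and `s = p₂q₁/(p₂+q₁)`. -/
theorem stmt17 (p₁ p₂ q₁ q₂ r s : ℝ) (hp₁ : 2 < p₁) (hp₂ : 2 < p₂)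
    (hq₁l : p₁ / (p₁ - 1) < q₁) (hq₁u : q₁ < p₁)
    (hq₂l : p₂ / (p₂ - 1) < q₂) (hq₂u : q₂ < p₂)
    (h1 : 1 / p₁ + 1 / q₂ < min 1 (3 / 2 - 1 / q₁))
    (h2 : 1 / p₂ + 1 / q₁ < min 1 (3 / 2 - 1 / q₂))
    (hr : r = p₁ * q₂ / (p₁ + q₂)) (hs : s = p₂ * q₁ / (p₂ + q₁)) :
    ∃ C : ℝ, 0 < C ∧ ∀ f₁ f₂ : SchwartzMap (ℝ × ℝ) ℂ,
      (∫ z₁ : ℝ, (∫ z₂ : ℝ, ‖BHT2 ⇑f₁ ⇑f₂ (z₁, z₂)‖ ^ s) ^ (r / s)) ^ (1 / r) ≤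
        C * (∫ ξ : ℝ, (∫ y : ℝ, ‖FT1v ⇑f₁ ξ y‖ ^ q₁) ^ ((p₁ / (p₁ - 1)) / q₁)) ^
              (1 / (p₁ / (p₁ - 1))) *
            (∫ η : ℝ, (∫ x : ℝ, ‖FT2v ⇑f₂ x η‖ ^ q₂) ^ ((p₂ / (p₂ - 1)) / q₂)) ^
              (1 / (p₂ / (p₂ - 1))) := by
  have conj : ∀ {p q : ℝ}, 2 < p → p / (p - 1) < q → q < p → 0 < q ∧ 1 ≤ q ∧ 1 ≤ p / (p - 1) ∧
      1 / p < 1 / q ∧ 1 / p + 1 / q < 1 ∧ 1 / (1 - 1 / p) = p / (p - 1) := by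
    intro p q hp hl hu
    have hp1 : 0 < p - 1 := by linarith
    have h1 : 1 ≤ p / (p - 1) := (one_le_div hp1).2 (by linarith)
    have hq : 0 < q := by linarith
    refine ⟨hq, by linarith, h1, one_div_lt_one_div_of_lt hq hu, ?_, ?_⟩
    · have h3 : 1 / q < 1 / (p / (p - 1)) := one_div_lt_one_div_of_lt (by linarith) hl
      have h4 : 1 / (p / (p - 1)) = 1 - 1 / p := by
        have : p ≠ 0 := by linarith
        field_simp
      linarith
    · have : p ≠ 0 := by linarith
      have := hp1.ne'
      field_simp
  obtain ⟨hq₁, hq₁1, hP₁1, hab, hb, hP₁⟩ := conj hp₁ hq₁l hq₁u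
  obtain ⟨hq₂, hq₂1, hP₂1, hcd, hd, hP₂⟩ := conj hp₂ hq₂l hq₂u
  have hp₁0 : 0 < p₁ := by linarith
  have hp₂0 : 0 < p₂ := by linarith
  have had := h1.trans_le (min_le_left _ _)
  have hbc : 1 / q₁ + 1 / p₂ < 1 := by rw [add_comm]; exact h2.trans_le (min_le_left _ _)
  have hre : 1 / (1 / p₁ + 1 / q₂) = r := by rw [hr]; field_simp; ring
  have hse : 1 / (1 / q₁ + 1 / p₂) = s := by rw [hs]; field_simp
  have hr0 : 0 < r := by rw [hr]; positivity
  have hs0 : 0 < s := by rw [hs]; positivity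
  obtain ⟨C, hC, H⟩ := SchwartzMap.mixI_BHT2_le (one_div_pos.2 hp₁0) (one_div_pos.2 hp₂0)
    hab hb hcd hd had hbc
  simp only [hre, hse, hP₁, hP₂, one_div_one_div] at H
  refine ⟨C, hC, fun f₁ f₂ => ?_⟩
  simp only [SchwartzMap.FT2v_eq]
  have hN₁ : 0 ≤ ∫ ξ : ℝ, (∫ y : ℝ, ‖FT1v ⇑f₁ ξ y‖ ^ q₁) ^ ((p₁ / (p₁ - 1)) / q₁) :=
    integral_nonneg fun ξ => Real.rpow_nonneg (integral_nonneg fun y => by positivity) _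
  have hN₂ : 0 ≤ ∫ ξ : ℝ, (∫ y : ℝ, ‖FT1v f₂.swap ξ y‖ ^ q₂) ^ ((p₂ / (p₂ - 1)) / q₂) :=
    integral_nonneg fun ξ => Real.rpow_nonneg (integral_nonneg fun y => by positivity) _
  have e₁ := f₁.mixI_FT1v hP₁1 hq₁1
  have e₂ := f₂.swap.mixI_FT1v hP₂1 hq₂1
  generalize (∫ ξ : ℝ, (∫ y : ℝ, ‖FT1v ⇑f₁ ξ y‖ ^ q₁) ^ ((p₁ / (p₁ - 1)) / q₁)) = N₁ at *
  generalize (∫ ξ : ℝ, (∫ y : ℝ, ‖FT1v f₂.swap ξ y‖ ^ q₂) ^ ((p₂ / (p₂ - 1)) / q₂)) = N₂ at *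
  have key : ∀ ε : ℝ, 0 < ε →
      (∫ z₁ : ℝ, (∫ z₂ : ℝ, ‖BHT2 ⇑f₁ ⇑f₂ (z₁, z₂)‖ ^ s) ^ (r / s)) ^ (1 / r) ≤
      C * ((N₁ ^ (1 / (p₁ / (p₁ - 1))) + ε) * (N₂ ^ (1 / (p₂ / (p₂ - 1))) + ε)) := by
    intro ε hε
    refine integral_mixed_le hr0 hs0 (by positivity)
      (H f₁ f₂ (by positivity) (by positivity) ?_ ?_)
    · rw [e₁]; exact ENNReal.ofReal_lt_ofReal_rpow_add (by linarith) hN₁ hε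
    · rw [e₂]; exact ENNReal.ofReal_lt_ofReal_rpow_add (by linarith) hN₂ hε
  exact le_mul_mul_of_forall_pos_le_add key
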